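/- (Fried–Goldman dichotomy.) Let Γ be a subgroup of the group Aff(ℝ³) of affine transformations of ℝ³ whose action on ℝ³ is properly discontinuous. Then either Γ is virtually polycyclic, or the linear part homomorphism L : Γ → GL(3,ℝ) is injective, its image L(Γ) is a discrete subgroup of GL(3,ℝ), and L(Γ) is conjugate in GL(3,ℝ) to a subgroup of the orthogonal group O(2,1). -/

import Mathlib

/-- A group is virtually polycyclic if it has a finite-index subgroup which is
solvable and all of whose subgroups are finitely generated. -/
def IsVirtuallyPolycyclic (G : Type*) [Group G] : Prop :=
  ∃ H : Subgroup G, H.index ≠ 0 ∧ IsSolvable H ∧ ∀ K : Subgroup H, K.FG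

/-- The Lorentzian bilinear form `B(x, y) = x₁y₁ + x₂y₂ − x₃y₃` on `ℝ³`. -/
def lorentzForm (x y : Fin 3 → ℝ) : ℝ :=
  x 0 * y 0 + x 1 * y 1 - x 2 * y 2

/-- The element of `GL(3, ℝ)` corresponding to the linear part of an affine
self-equivalence of `ℝ³`. -/
noncomputable def linearPartGL (γ : (Fin 3 → ℝ) ≃ᵃ[ℝ] (Fin 3 → ℝ)) :
    GL (Fin 3) ℝ :=
  Matrix.GeneralLinearGroup.toLin.symm
    ((LinearMap.GeneralLinearGroup.generalLinearEquiv ℝ (Fin 3 → ℝ)).symm γ.linear)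

section

set_option linter.deprecated false

open Subgroup in
/-- Every subgroup is finitely generated. -/
def NoethGrp (G : Type*) [Group G] : Prop := ∀ K : Subgroup G, K.FG

/-- Every commutative subgroup is finitely generated. -/
def CommFG (G : Type*) [Group G] : Prop :=
  ∀ K : Subgroup G, (∀ a ∈ K, ∀ b ∈ K, a * b = b * a) → K.FG

theorem fg_ext {G H : Type*} [Group G] [Group H] (f : G →* H) (K : Subgroup G)
    (h1 : (K.map f).FG) (h2 : (K ⊓ f.ker).FG) : K.FG := by
  classical
  obtain ⟨S, hS⟩ := h1
  obtain ⟨T, hT⟩ := h2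
  have hx : ∀ s : H, ∃ g : G, s ∈ S → g ∈ K ∧ f g = s := by
    intro s
    by_cases hs : s ∈ S
    · have : s ∈ K.map f := by rw [← hS]; exact Subgroup.subset_closure hs
      obtain ⟨g, hg, rfl⟩ := this
      exact ⟨g, fun _ => ⟨hg, rfl⟩⟩
    · exact ⟨1, fun h => absurd h hs⟩
  choose φ hφ using hx
  refine ⟨S.image φ ∪ T, ?_⟩
  set L := Subgroup.closure ((S.image φ ∪ T : Finset G) : Set G) with hL
  have hTL : K ⊓ f.ker ≤ L := by
    rw [← hT]; apply Subgroup.closure_mono; simp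
  have hSL : S.image φ ⊆ S.image φ ∪ T := Finset.subset_union_left
  have hLK : L ≤ K := by
    rw [hL, Subgroup.closure_le]
    intro x hx
    simp only [Finset.coe_union, Finset.coe_image, Set.mem_union, Set.mem_image,
      Finset.mem_coe] at hx
    rcases hx with ⟨s, hs, rfl⟩ | hx
    · exact (hφ s hs).1
    · have : x ∈ K ⊓ f.ker := by rw [← hT]; exact Subgroup.subset_closure hx
      exact this.1
  refine le_antisymm hLK ?_
  have hmap : K.map f ≤ L.map f := by
    rw [← hS, Subgroup.closure_le]
    intro s hs
    refine ⟨φ s, ?_, (hφ s hs).2⟩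
    apply Subgroup.subset_closure
    exact_mod_cast hSL (Finset.mem_image_of_mem _ hs)
  intro k hk
  obtain ⟨l, hl, hlk⟩ := hmap ⟨k, hk, rfl⟩
  have : l⁻¹ * k ∈ L := hTL ⟨K.mul_mem (K.inv_mem (hLK hl)) hk, by
    change l⁻¹ * k ∈ f.ker
    rw [MonoidHom.mem_ker, map_mul, map_inv, hlk]; simp⟩
  have := L.mul_mem hl this
  simpa using this

theorem Subgroup.FG.map' {G H : Type*} [Group G] [Group H] (f : G →* H) {K : Subgroup G}
    (h : K.FG) : (K.map f).FG := by
  classical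
  obtain ⟨S, hS⟩ := h
  exact ⟨S.image f, by rw [← hS, MonoidHom.map_closure]; simp⟩

theorem fg_of_map_inj {G H : Type*} [Group G] [Group H] (f : G →* H) (hf : Function.Injective f)
    (K : Subgroup G) (h1 : (K.map f).FG) : K.FG := by
  refine fg_ext f K h1 ?_
  rw [(MonoidHom.ker_eq_bot_iff f).2 hf, inf_bot_eq]
  exact ⟨∅, by simp⟩

theorem CommFG.of_injective {G H : Type*} [Group G] [Group H] (f : G →* H)
    (hf : Function.Injective f) (h : CommFG H) : CommFG G := by
  intro K hK
  refine fg_of_map_inj f hf K (h _ ?_)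
  rintro _ ⟨a, ha, rfl⟩ _ ⟨b, hb, rfl⟩
  rw [← map_mul, ← map_mul, hK a ha b hb]

theorem NoethGrp.of_ext {G H : Type*} [Group G] [Group H] (f : G →* H)
    (h1 : NoethGrp f.range) (h2 : NoethGrp f.ker) : NoethGrp G := by
  intro K
  refine fg_ext f K ?_ ?_
  · have := (h1 (K.map f.rangeRestrict)).map' f.range.subtype
    rw [Subgroup.map_map] at this
    exact this
  · have := (h2 ((K).subgroupOf f.ker)).map' f.ker.subtype
    rw [Subgroup.subgroupOf_map_subtype] at this
    exact this

/-- peel off finitely many centralizers -/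
theorem fg_of_centralizer {G : Type*} [Group G] (Z : Subgroup G)
    (hZ : Z ≤ Subgroup.center G) (hG : CommFG G) (B : Subgroup G)
    (hB : ∀ a ∈ B, ∀ b ∈ B, a * b * a⁻¹ * b⁻¹ ∈ Z) (S : Finset G) (hS : (S : Set G) ⊆ B)
    (h : (B ⊓ Subgroup.centralizer (S : Set G)).FG) : B.FG := by
  classical
  induction S using Finset.induction_on with
  | empty =>
    convert h using 1
    symm
    rw [inf_eq_left]
    intro x _
    simp [Subgroup.mem_centralizer_iff]
  | insert m S hm ih =>
    apply ih (fun x hx => hS (by simp [hx]))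
    have hmB : m ∈ B := hS (by simp)
    set K := B ⊓ Subgroup.centralizer (S : Set G) with hK
    let f : K →* G :=
      { toFun := fun b => b * m * (b : G)⁻¹ * m⁻¹
        map_one' := by simp
        map_mul' := by
          intro a b
          have hb := hZ (hB b b.2.1 m hmB)
          have ha := Subgroup.mem_center_iff.1 hb a
          simp only [Subgroup.coe_mul]
          calc (a : G) * b * m * (a * b : G)⁻¹ * m⁻¹
              = (a * (b * m * (b:G)⁻¹ * m⁻¹)) * m * (a:G)⁻¹ * m⁻¹ := by group
            _ = ((b * m * (b:G)⁻¹ * m⁻¹) * a) * m * (a:G)⁻¹ * m⁻¹ := by rw [ha]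
            _ = (b * m * (b:G)⁻¹ * m⁻¹) * (a * m * (a:G)⁻¹ * m⁻¹) := by group
            _ = _ := (Subgroup.mem_center_iff.1 hb _).symm }
    have key : (⊤ : Subgroup K).FG := by
      refine fg_ext f ⊤ ?_ ?_
      · apply hG
        rintro _ ⟨a, -, rfl⟩ y hy
        have := Subgroup.mem_center_iff.1 (hZ (hB a a.2.1 m hmB)) y
        exact this.symm
      · rw [top_inf_eq]
        apply fg_of_map_inj K.subtype K.subtype_injective
        convert h using 1
        ext x
        simp only [Subgroup.mem_map, Subgroup.mem_inf, Subgroup.mem_centralizer_iff,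
          MonoidHom.mem_ker, Finset.coe_insert, Set.mem_insert_iff, Finset.mem_coe]
        constructor
        · rintro ⟨y, hy, rfl⟩
          refine ⟨y.2.1, ?_⟩
          rintro z (rfl | hz)
          · have h2 : (y : G) * z * (y : G)⁻¹ * z⁻¹ = 1 := hy
            rw [mul_inv_eq_one, mul_inv_eq_iff_eq_mul] at h2
            exact h2.symm
          · exact Subgroup.mem_centralizer_iff.1 y.2.2 z hz
        · rintro ⟨h1, h2⟩
          refine ⟨⟨x, h1, Subgroup.mem_centralizer_iff.2 fun z hz => h2 z (Or.inr hz)⟩, ?_, rfl⟩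
          change x * m * x⁻¹ * m⁻¹ = 1
          rw [mul_inv_eq_one, mul_inv_eq_iff_eq_mul]
          exact (h2 m (Or.inl rfl)).symm
    have := key.map' K.subtype
    rwa [← MonoidHom.range_eq_map, Subgroup.range_subtype] at this

theorem commFG_quot {G : Type*} [Group G] (Z : Subgroup G) [Z.Normal]
    (hZ : Z ≤ Subgroup.center G) (hG : CommFG G) : CommFG (G ⧸ Z) := by
  classical
  intro K hK
  set B := K.comap (QuotientGroup.mk' Z) with hBdef
  have hB : ∀ a ∈ B, ∀ b ∈ B, a * b * a⁻¹ * b⁻¹ ∈ Z := by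
    intro a ha b hb
    have := hK _ ha _ hb
    rw [← QuotientGroup.ker_mk' Z, MonoidHom.mem_ker, map_mul, map_mul, map_mul, this]
    simp
  have hKB : K = B.map (QuotientGroup.mk' Z) := by
    rw [hBdef, Subgroup.map_comap_eq_self_of_surjective (QuotientGroup.mk'_surjective Z)]
  rw [hKB]
  apply Subgroup.FG.map'
  obtain ⟨M, -, hM⟩ := zorn_le_nonempty₀
    {M : Subgroup G | M ≤ B ∧ ∀ a ∈ M, ∀ b ∈ M, a * b = b * a} (by
      intro c hc hch y hy
      have hdir : DirectedOn (· ≤ ·) c := hch.directedOn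
      refine ⟨sSup c, ⟨sSup_le fun M hM => (hc hM).1, ?_⟩, fun z hz => le_sSup hz⟩
      intro a ha b hb
      rw [Subgroup.mem_sSup_of_directedOn ⟨y, hy⟩ hdir] at ha hb
      obtain ⟨M1, h1, ha⟩ := ha
      obtain ⟨M2, h2, hb⟩ := hb
      obtain ⟨M3, h3, h13, h23⟩ := hdir M1 h1 M2 h2
      exact (hc h3).2 a (h13 ha) b (h23 hb)) (⊥ : Subgroup G)
      ⟨bot_le, by
        intro a ha b hb
        rw [Subgroup.mem_bot] at ha hb
        rw [ha, hb]⟩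
  obtain ⟨⟨hMB, hMc⟩, hMax⟩ := hM
  obtain ⟨S, hS⟩ := hG M hMc
  have hSM : (S : Set G) ⊆ M := by rw [← hS]; exact Subgroup.subset_closure
  refine fg_of_centralizer Z hZ hG B hB S (hSM.trans hMB) ?_
  have : B ⊓ Subgroup.centralizer (S : Set G) = M := by
    apply le_antisymm
    · rintro x ⟨hxB, hxc⟩
      rw [← Subgroup.centralizer_closure, hS] at hxc
      have hxM := Subgroup.mem_centralizer_iff.1 hxc
      have hcl : ∀ a ∈ Subgroup.closure ((M : Set G) ∪ {x}),
          ∀ b ∈ Subgroup.closure ((M : Set G) ∪ {x}), a * b = b * a := by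
        have hgen : ∀ a ∈ ((M : Set G) ∪ {x}), ∀ b ∈ ((M : Set G) ∪ {x}), a * b = b * a := by
          rintro a (ha | rfl) b (hb | rfl)
          · exact hMc a ha b hb
          · exact hxM a ha
          · exact (hxM b hb).symm
          · rfl
        let := Subgroup.closureCommGroupOfComm hgen
        intro a ha b hb
        have := mul_comm (⟨a, ha⟩ : Subgroup.closure ((M : Set G) ∪ {x})) ⟨b, hb⟩
        exact congrArg Subtype.val this
      have := hMax (y := Subgroup.closure ((M : Set G) ∪ {x})) ⟨by
        rw [Subgroup.closure_le]
        rintro a (ha | rfl)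
        · exact hMB ha
        · exact hxB, hcl⟩ (fun a ha => Subgroup.subset_closure (Or.inl ha))
      exact this (Subgroup.subset_closure (Or.inr rfl))
    · intro x hx
      exact ⟨hMB hx, Subgroup.mem_centralizer_iff.2 fun h hh => hMc h (hSM hh) x hx⟩
  rw [this]
  exact hG M hMc

open scoped commutatorElement in
theorem malcev_aux.{u} (hE : ∀ (A : Type u) [Group A], (∀ a b : A, a * b = b * a) → Group.FG A →
      CommFG (MulAut A)) :
    ∀ (d : ℕ) (G : Type u) [Group G], derivedSeries G d = ⊥ → CommFG G → NoethGrp G := by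
  intro d
  induction d with
  | zero =>
    intro G _ h _ K
    have : K = ⊥ := le_bot_iff.1 (h ▸ le_top)
    rw [this]
    exact ⟨∅, by simp⟩
  | succ d ih =>
    intro G _ hd hG
    have hn : (derivedSeries G d).Normal := derivedSeries_normal G d
    have hAc : ∀ a ∈ derivedSeries G d, ∀ b ∈ derivedSeries G d, a * b = b * a := by
      intro a ha b hb
      have : ⁅a, b⁆ ∈ derivedSeries G (d+1) := by
        rw [derivedSeries_succ]; exact Subgroup.commutator_mem_commutator ha hb
      rw [hd, Subgroup.mem_bot, commutatorElement_eq_one_iff_mul_comm] at this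
      exact this
    have hAfg : Group.FG (derivedSeries G d) := (Group.fg_iff_subgroup_fg _).2 (hG _ hAc)
    let f : G →* MulAut (derivedSeries G d) := MulAut.conjNormal
    have hfA : derivedSeries G d ≤ f.ker := by
      intro a ha
      rw [MonoidHom.mem_ker]
      ext b
      change ((MulAut.conjNormal a b : derivedSeries G d) : G) = b
      rw [MulAut.conjNormal_apply, hAc a ha b b.2]; simp
    have hCc : ∀ c ∈ f.ker, ∀ a ∈ derivedSeries G d, c * a = a * c := by
      intro c hc a ha
      have h1 : f c ⟨a, ha⟩ = ⟨a, ha⟩ := by rw [MonoidHom.mem_ker.1 hc]; rfl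
      have h2 : ((MulAut.conjNormal c ⟨a, ha⟩ : derivedSeries G d) : G) = a :=
        congrArg Subtype.val h1
      rw [MulAut.conjNormal_apply] at h2
      exact mul_inv_eq_iff_eq_mul.1 h2
    apply NoethGrp.of_ext f
    · apply ih
      · rw [← map_derivedSeries_eq f.rangeRestrict_surjective, Subgroup.map_eq_bot_iff,
          MonoidHom.ker_rangeRestrict]
        exact hfA
      · exact (hE _ (fun a b => Subtype.ext (hAc a a.2 b b.2)) hAfg).of_injective
          f.range.subtype f.range.subtype_injective
    · have hC : CommFG f.ker := hG.of_injective f.ker.subtype f.ker.subtype_injective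
      have hn' : (derivedSeries f.ker d).Normal := derivedSeries_normal _ d
      have hle : ∀ x ∈ derivedSeries f.ker d, (x : G) ∈ derivedSeries G d := fun x hx =>
        map_derivedSeries_le_derivedSeries f.ker.subtype d ⟨x, hx, rfl⟩
      have hcen : derivedSeries f.ker d ≤ Subgroup.center f.ker := by
        intro x hx
        rw [Subgroup.mem_center_iff]
        intro g
        exact Subtype.ext (hCc g g.2 x (hle x hx))
      have h1 : NoethGrp (f.ker ⧸ derivedSeries f.ker d) := by
        apply ih
        · rw [← map_derivedSeries_eq (QuotientGroup.mk'_surjective (derivedSeries f.ker d)),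
            Subgroup.map_eq_bot_iff, QuotientGroup.ker_mk']
        · exact commFG_quot _ hcen hC
      intro K
      refine fg_ext (QuotientGroup.mk' (derivedSeries f.ker d)) K (h1 _) (hC _ ?_)
      rintro a ⟨-, ha⟩ b ⟨-, hb⟩
      rw [SetLike.mem_coe, QuotientGroup.ker_mk'] at ha hb
      exact Subtype.ext (hAc _ (hle _ ha) _ (hle _ hb))

end

section

open Filter Topology in
theorem exp_surj_units (E : Type*) [NormedCommRing E] [NormedAlgebra ℂ E] [NormedAlgebra ℚ E]
    [FiniteDimensional ℂ E] [CompleteSpace E] (a : E) (ha : IsUnit a) :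
    ∃ x : E, NormedSpace.exp x = a := by
  set R := Set.range (NormedSpace.exp : E → E) with hR
  have hd : HasStrictFDerivAt (NormedSpace.exp : E → E)
      ((ContinuousLinearEquiv.refl ℂ E : E ≃L[ℂ] E) : E →L[ℂ] E) 0 :=
    hasStrictFDerivAt_exp_zero
  have hR1 : R ∈ 𝓝 (1 : E) := by
    have h := hd.map_nhds_eq_of_equiv
    rw [NormedSpace.exp_zero] at h
    rw [← h]
    exact Filter.mem_map.2 (Filter.univ_mem' fun x => ⟨x, rfl⟩)
  have hinv : ∀ x : E, NormedSpace.exp x * NormedSpace.exp (-x) = 1 := by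
    intro x
    rw [← NormedSpace.exp_add, add_neg_cancel, NormedSpace.exp_zero]
  have hopen : IsOpen R := by
    rw [isOpen_iff_mem_nhds]
    rintro _ ⟨x, rfl⟩
    have hc : Continuous fun z : E => z * NormedSpace.exp (-x) := by fun_prop
    have h := hc.tendsto (NormedSpace.exp x)
    rw [hinv] at h
    filter_upwards [h hR1] with z hz
    obtain ⟨w, hw⟩ := hz
    refine ⟨w + x, ?_⟩
    rw [NormedSpace.exp_add, hw, mul_assoc, mul_comm (NormedSpace.exp (-x)), hinv, mul_one]
  have hcl : ∀ u ∈ closure R, IsUnit u → u ∈ R := by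
    intro u hu huu
    obtain ⟨v, hv⟩ := huu.exists_right_inv
    have hc : Continuous fun z : E => z * v := by fun_prop
    have h := hc.tendsto u
    simp only [hv] at h
    obtain ⟨z, hz1, ⟨x, rfl⟩⟩ := mem_closure_iff_nhds.1 hu _ (h hR1)
    obtain ⟨w, hw⟩ := hz1
    refine ⟨x + -w, ?_⟩
    rw [NormedSpace.exp_add]
    have h3 : NormedSpace.exp x = NormedSpace.exp w * u := by
      rw [hw, mul_assoc, mul_comm v u, hv, mul_one]
    rw [h3]
    calc _ = u * (NormedSpace.exp w * NormedSpace.exp (-w)) := by ring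
      _ = u := by rw [hinv, mul_one]
  let f : ℂ → E := fun z => 1 + z • (a - 1)
  have hf : Continuous f := by fun_prop
  let S : Set ℂ := {z | IsUnit (f z)}
  have hSfin : Sᶜ.Finite := by
    have hsp : (spectrum ℂ (LinearMap.mulLeft ℂ (1 - a))).Finite := Module.End.finite_spectrum _
    refine (hsp.image (fun z => z⁻¹)).subset ?_
    intro z hz
    have hz' : ¬ IsUnit (f z) := hz
    have hz0 : z ≠ 0 := by
      rintro rfl
      apply hz'
      simp [f]
    refine ⟨z⁻¹, ?_, inv_inv z⟩
    rw [spectrum.mem_iff]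
    intro hu
    apply hz'
    have hs : Function.Surjective
        (algebraMap ℂ (Module.End ℂ E) z⁻¹ - LinearMap.mulLeft ℂ (1 - a)) :=
      ((Module.End.isUnit_iff _).1 hu).2
    obtain ⟨w, hw⟩ := hs 1
    refine IsUnit.of_mul_eq_one (z⁻¹ • w) ?_
    simp only [LinearMap.sub_apply, Module.algebraMap_end_apply, LinearMap.mulLeft_apply] at hw
    calc f z * (z⁻¹ • w) = z⁻¹ • w + (z * z⁻¹) • ((a - 1) * w) := by
          simp only [f, add_mul, one_mul, smul_mul_assoc, mul_smul_comm, smul_smul, smul_add]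
          rw [mul_comm z z⁻¹]
      _ = z⁻¹ • w - (1 - a) * w := by
          rw [mul_inv_cancel₀ hz0, one_smul]; ring
      _ = 1 := hw
  have hSp : IsPreconnected S := by
    have := Set.Countable.isPathConnected_compl_of_one_lt_rank (E := ℂ)
      (by rw [Complex.rank_real_complex]; norm_num) hSfin.countable
    rw [compl_compl] at this
    exact this.isConnected.isPreconnected
  have him := hSp.image f hf.continuousOn
  have hsub := him.subset_of_closure_inter_subset hopen
    ⟨1, ⟨0, by change IsUnit (f 0); simp [f], by simp [f]⟩, ⟨0, NormedSpace.exp_zero⟩⟩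
    (by rintro u ⟨hu, z, hz, rfl⟩; exact hcl _ hu hz)
  exact hsub ⟨1, by change IsUnit (f 1); simpa [f] using ha, by simp [f]⟩

open Filter Topology in
theorem fg_of_discrete_comm_alg (E : Type*) [NormedCommRing E] [NormedAlgebra ℂ E]
    [FiniteDimensional ℂ E] (B : Type*) [Group B] (ρ : B →* E)
    (U : Set E) (hU : U ∈ 𝓝 (1 : E)) (hfin : {g | ρ g ∈ U}.Finite) : Group.FG B := by
  have : CompleteSpace E := FiniteDimensional.complete ℂ E
  let _ : NormedAlgebra ℚ E := NormedAlgebra.restrictScalars ℚ ℂ E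
  let _ : NormedSpace ℝ E := NormedSpace.restrictScalars ℝ ℂ E
  have : FiniteDimensional ℝ E := FiniteDimensional.trans ℝ ℂ E
  have hd : HasStrictFDerivAt (NormedSpace.exp : E → E)
      ((ContinuousLinearEquiv.refl ℂ E : E ≃L[ℂ] E) : E →L[ℂ] E) 0 :=
    hasStrictFDerivAt_exp_zero
  have hinv : ∀ x : E, NormedSpace.exp x * NormedSpace.exp (-x) = 1 := by
    intro x
    rw [← NormedSpace.exp_add, add_neg_cancel, NormedSpace.exp_zero]
  let Λ : AddSubgroup E :=
    { carrier := {x | NormedSpace.exp x ∈ Set.range ρ}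
      zero_mem' := ⟨1, by rw [NormedSpace.exp_zero, map_one]⟩
      add_mem' := by
        rintro x y ⟨g, hg⟩ ⟨h, hh⟩
        exact ⟨g * h, by rw [map_mul, hg, hh, NormedSpace.exp_add]⟩
      neg_mem' := by
        rintro x ⟨g, hg⟩
        refine ⟨g⁻¹, ?_⟩
        have h1 : ρ g⁻¹ * ρ g = 1 := by rw [← map_mul, inv_mul_cancel, map_one]
        rw [hg] at h1
        calc ρ g⁻¹ = ρ g⁻¹ * (NormedSpace.exp x * NormedSpace.exp (-x)) := by rw [hinv, mul_one]
          _ = _ := by rw [← mul_assoc, h1, one_mul] }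
  have hdisc : DiscreteTopology (AddSubgroup.toIntSubmodule Λ) := by
    apply discreteTopology_of_isOpen_singleton_zero
    have h1 := hd.eventually_left_inverse
    have hcont : Continuous (NormedSpace.exp : E → E) := NormedSpace.exp_continuous
    have h2 : ∀ᶠ x in 𝓝 (0 : E), NormedSpace.exp x ∈ U := by
      have := hcont.tendsto 0
      rw [NormedSpace.exp_zero] at this
      exact this hU
    have hV := h1.and h2
    set V := {x | HasStrictFDerivAt.localInverse NormedSpace.exp
      (ContinuousLinearEquiv.refl ℂ E) 0 hd (NormedSpace.exp x) = x ∧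
        NormedSpace.exp x ∈ U} with hVdef
    have hVn : V ∈ 𝓝 (0 : E) := hV
    have hfinV : (V ∩ Λ).Finite := by
      refine ((hfin.image ρ).image (HasStrictFDerivAt.localInverse NormedSpace.exp
        (ContinuousLinearEquiv.refl ℂ E) 0 hd)).subset ?_
      rintro x ⟨⟨hx1, hx2⟩, ⟨g, hg⟩⟩
      exact ⟨_, ⟨g, by change ρ g ∈ U; rw [hg]; exact hx2, rfl⟩, by rw [hg]; exact hx1⟩
    have hfin2 : ((V ∩ Λ) \ {0}).Finite := hfinV.subset Set.sdiff_subset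
    have hn : (V ∩ ((V ∩ Λ) \ {0})ᶜ) ∈ 𝓝 (0 : E) :=
      Filter.inter_mem hVn (hfin2.isClosed.isOpen_compl.mem_nhds (by simp))
    have hpre : ((↑) : AddSubgroup.toIntSubmodule Λ → E) ⁻¹' (V ∩ ((V ∩ Λ) \ {0})ᶜ) ∈
        𝓝 (0 : AddSubgroup.toIntSubmodule Λ) :=
      continuous_subtype_val.continuousAt.preimage_mem_nhds (by simpa using hn)
    have : (((↑) : AddSubgroup.toIntSubmodule Λ → E) ⁻¹' (V ∩ ((V ∩ Λ) \ {0})ᶜ)) = {0} := by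
      ext x
      constructor
      · rintro ⟨hx1, hx2⟩
        by_contra h
        apply hx2
        refine ⟨⟨hx1, x.2⟩, ?_⟩
        intro h0
        exact h (Subtype.ext h0)
      · rintro rfl
        exact mem_of_mem_nhds hpre
    rw [this] at hpre
    rw [isOpen_iff_mem_nhds]
    rintro _ rfl
    exact hpre
  have hΛ : AddGroup.FG (AddSubgroup.toIntSubmodule Λ) :=
    Module.Finite.iff_addGroup_fg.1 (instModuleFinite_of_discrete_submodule _)
  have hΛ' : Group.FG (Multiplicative (AddSubgroup.toIntSubmodule Λ)) :=
    AddGroup.fg_iff_mul_fg.1 hΛ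
  let e : Multiplicative (AddSubgroup.toIntSubmodule Λ) →* E :=
    { toFun := fun x => NormedSpace.exp ((Multiplicative.toAdd x : AddSubgroup.toIntSubmodule Λ) : E)
      map_one' := NormedSpace.exp_zero
      map_mul' := fun x y => NormedSpace.exp_add }
  have hmap : (⊤ : Subgroup B).map ρ.toHomUnits = (⊤ : Subgroup _).map e.toHomUnits := by
    ext u
    constructor
    · rintro ⟨g, -, rfl⟩
      obtain ⟨x, hx⟩ := exp_surj_units E (ρ.toHomUnits g : E) (Units.isUnit _)
      exact ⟨Multiplicative.ofAdd ⟨x, ⟨g, hx.symm⟩⟩, trivial, Units.ext hx⟩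
    · rintro ⟨x, -, rfl⟩
      obtain ⟨g, hg⟩ := (Multiplicative.toAdd x).2
      exact ⟨g, trivial, Units.ext hg⟩
  rw [Group.fg_def]
  refine fg_ext ρ.toHomUnits ⊤ ?_ ?_
  · rw [hmap]
    exact (Group.fg_def.1 hΛ').map' _
  · have hk : ((⊤ ⊓ ρ.toHomUnits.ker : Subgroup B) : Set B).Finite := by
      refine hfin.subset ?_
      rintro g ⟨-, hg⟩
      have h1 : ρ.toHomUnits g = 1 := hg
      have : ρ g = 1 := congrArg Units.val h1
      change ρ g ∈ U
      rw [this]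
      exact mem_of_mem_nhds hU
    have := hk.to_subtype
    rw [← Group.fg_iff_subgroup_fg]
    exact Group.fg_of_finite

open Filter Topology in
theorem fg_of_discrete_comm_ring {A : Type*} [NormedRing A] [NormedAlgebra ℂ A]
    [FiniteDimensional ℂ A] (B : Type*) [Group B]
    (hB : ∀ a b : B, a * b = b * a) (ρ : B →* A)
    (U : Set A) (hU : U ∈ 𝓝 (1 : A)) (hfin : {g | ρ g ∈ U}.Finite) :
    Group.FG B := by
  let S := Algebra.adjoin ℂ (Set.range ρ)
  have hc : IsMulCommutative S := Algebra.isMulCommutative_adjoin ℂ (by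
    rintro _ ⟨a, rfl⟩ _ ⟨b, rfl⟩
    rw [← map_mul, ← map_mul, hB])
  let _ : NormedCommRing S :=
    { (inferInstance : NormedRing S) with mul_comm := fun a b => hc.is_comm.comm a b }
  let ρ' : B →* S := ρ.codRestrict S.toSubmonoid (fun g => Algebra.subset_adjoin ⟨g, rfl⟩)
  let _ : NormedAlgebra ℂ S := { (inferInstance : Algebra ℂ S) with
    norm_smul_le := fun r x => norm_smul_le r (x : A) }
  have : FiniteDimensional ℂ S := FiniteDimensional.finiteDimensional_submodule S.toSubmodule
  refine fg_of_discrete_comm_alg S B ρ' (((↑) : S → A) ⁻¹' U) ?_ hfin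
  exact continuous_subtype_val.continuousAt.preimage_mem_nhds (by simpa using hU)

open Filter Topology in
theorem fg_of_discrete_comm_matrix {n : Type*} [Fintype n] [DecidableEq n] (B : Type*) [Group B]
    (hB : ∀ a b : B, a * b = b * a) (ρ : B →* Matrix n n ℂ)
    (U : Set (Matrix n n ℂ)) (hU : U ∈ 𝓝 (1 : Matrix n n ℂ)) (hfin : {g | ρ g ∈ U}.Finite) :
    Group.FG B := by
  let e := (Matrix.toEuclideanCLM (n := n) (𝕜 := ℂ))
  let ρ' : B →* (EuclideanSpace ℂ n →L[ℂ] EuclideanSpace ℂ n) :=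
    { toFun := fun g => e (ρ g), map_one' := by simp, map_mul' := fun a b => by simp }
  have hcont : Continuous (e.symm : _ → Matrix n n ℂ) :=
    LinearMap.continuous_of_finiteDimensional
      ({ toFun := e.symm, map_add' := map_add e.symm, map_smul' := fun c x => map_smul e.symm c x } :
        (EuclideanSpace ℂ n →L[ℂ] EuclideanSpace ℂ n) →ₗ[ℂ] Matrix n n ℂ)
  refine fg_of_discrete_comm_ring B hB ρ' (e.symm ⁻¹' U) ?_ ?_
  · apply hcont.continuousAt.preimage_mem_nhds
    rwa [map_one]
  · convert hfin using 3
    rename_i g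
    change e.symm (e (ρ g)) ∈ U ↔ _
    rw [StarAlgEquiv.symm_apply_apply]

open Filter Topology in
theorem fg_of_discrete_comm_real {n : Type*} [Fintype n] [DecidableEq n] (B : Type*) [Group B]
    (hB : ∀ a b : B, a * b = b * a) (ρ : B →* Matrix n n ℝ)
    (U : Set (Matrix n n ℝ)) (hU : U ∈ 𝓝 (1 : Matrix n n ℝ)) (hfin : {g | ρ g ∈ U}.Finite) :
    Group.FG B := by
  refine fg_of_discrete_comm_matrix B hB
    (((Complex.ofRealHom.mapMatrix : Matrix n n ℝ →+* Matrix n n ℂ) : _ →* _).comp ρ)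
    ((fun M : Matrix n n ℂ => M.map Complex.re) ⁻¹' U) ?_ ?_
  · have hc : Continuous (fun M : Matrix n n ℂ => M.map Complex.re) := by fun_prop
    apply hc.continuousAt.preimage_mem_nhds
    have : (1 : Matrix n n ℂ).map Complex.re = 1 := by
      ext i j; by_cases h : i = j <;> simp [h, Matrix.one_apply]
    rwa [this]
  · convert hfin using 3
    rename_i g
    have : (fun M : Matrix n n ℂ => M.map Complex.re) ((Complex.ofRealHom.mapMatrix) (ρ g)) = ρ g := by
      ext i j; simp
    change (fun M : Matrix n n ℂ => M.map Complex.re) ((Complex.ofRealHom.mapMatrix) (ρ g)) ∈ U ↔ _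
    rw [this]

end

section

theorem commFG_mulAut (A : Type*) [Group A] (hA : ∀ a b : A, a * b = b * a) (hfg : Group.FG A) :
    CommFG (MulAut A) := by
  classical
  let _ : CommGroup A := { (inferInstance : Group A) with mul_comm := hA }
  intro K hK
  rw [← Group.fg_iff_subgroup_fg]
  let M := Additive A
  have hM : AddGroup.FG M := GroupFG.iff_add_fg.1 hfg
  have hMf : Module.Finite ℤ M := Module.Finite.iff_addGroup_fg.2 hM
  let T := Submodule.torsion ℤ M
  have hTfin : Finite T := Module.finite_of_fg_torsion _ (Submodule.torsion_isTorsion)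
  have : Module.Free ℤ (M ⧸ T) := inferInstance
  let b := Module.finBasis ℤ (M ⧸ T)
  let F : MulAut A →* (M →ₗ[ℤ] M) :=
    { toFun := fun φ => (MonoidHom.toAdditive (φ : A →* A)).toIntLinearMap
      map_one' := rfl
      map_mul' := fun _ _ => rfl }
  have hT : ∀ φ, T ≤ T.comap (F φ) := by
    intro φ x hx
    rw [Submodule.mem_comap]
    obtain ⟨a, ha⟩ := (Submodule.mem_torsion_iff _).1 hx
    refine (Submodule.mem_torsion_iff _).2 ⟨a, ?_⟩
    have := congrArg (F φ) ha
    simpa using this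
  let Q : MulAut A →* Module.End ℤ (M ⧸ T) :=
    { toFun := fun φ => T.mapQ T (F φ) (hT φ)
      map_one' := by
        ext x; rfl
      map_mul' := by
        intro φ ψ; ext x; rfl }
  let ρ0 : MulAut A →*
      Matrix (Fin (Module.finrank ℤ (M ⧸ T))) (Fin (Module.finrank ℤ (M ⧸ T))) ℤ :=
    { toFun := fun φ => LinearMap.toMatrixAlgEquiv b (Q φ)
      map_one' := by rw [map_one, map_one]
      map_mul' := fun x y => by rw [map_mul, map_mul] }
  let ρ : K →* Matrix (Fin (Module.finrank ℤ (M ⧸ T))) (Fin (Module.finrank ℤ (M ⧸ T))) ℝ :=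
    ((Int.castRingHom ℝ).mapMatrix).toMonoidHom.comp (ρ0.comp K.subtype)
  have hker : {g : MulAut A | ρ0 g = 1}.Finite := by
    obtain ⟨S, hS⟩ := Group.fg_def.1 hfg
    have hmem : ∀ g : MulAut A, ρ0 g = 1 → ∀ a : A, (Additive.ofMul (g a) - Additive.ofMul a : M) ∈ T := by
      intro g hg a
      have h1 : Q g = 1 := by
        apply (LinearMap.toMatrixAlgEquiv b).injective
        rw [map_one]; exact hg
      have h2 : Q g (T.mkQ (Additive.ofMul a)) = T.mkQ (Additive.ofMul a) := by rw [h1]; rfl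
      have h3 : T.mkQ (Additive.ofMul (g a)) = T.mkQ (Additive.ofMul a) := h2
      rw [← sub_eq_zero, ← map_sub] at h3
      exact (Submodule.Quotient.mk_eq_zero T).1 h3
    let Φ : {g : MulAut A | ρ0 g = 1} → (S → T) := fun g s => ⟨_, hmem g g.2 s⟩
    have hinj : Function.Injective Φ := by
      intro g h hgh
      apply Subtype.ext
      have heq : (g.1 : A →* A) = (h.1 : A →* A) := by
        apply MonoidHom.eq_of_eqOn_dense hS
        intro s hs
        have h1 := congrArg Subtype.val (congrFun hgh ⟨s, hs⟩)
        have h2 : (Additive.ofMul (g.1 s) - Additive.ofMul s : M) =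
            Additive.ofMul (h.1 s) - Additive.ofMul s := h1
        exact Additive.ofMul.injective (sub_left_inj.1 h2)
      ext a
      exact DFunLike.congr_fun heq a
    have : Finite {g : MulAut A | ρ0 g = 1} := Finite.of_injective Φ hinj
    exact Set.toFinite _
  refine fg_of_discrete_comm_real K (fun a b => Subtype.ext (hK a a.2 b b.2)) ρ
    {M | ∀ i j, |M i j - (1 : Matrix _ _ ℝ) i j| < 1} ?_ ?_
  · have : {M : Matrix (Fin (Module.finrank ℤ (M ⧸ T))) (Fin (Module.finrank ℤ (M ⧸ T))) ℝ |
        ∀ i j, |M i j - (1 : Matrix _ _ ℝ) i j| < 1} =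
        ⋂ i, ⋂ j, {M | |M i j - (1 : Matrix _ _ ℝ) i j| < 1} := by
      ext; simp
    rw [this]
    refine IsOpen.mem_nhds ?_ (by simp)
    refine isOpen_iInter_of_finite fun i => isOpen_iInter_of_finite fun j => ?_
    exact isOpen_lt (by fun_prop) continuous_const
  · refine Set.Finite.of_finite_image (f := Subtype.val) (hker.subset ?_) Subtype.val_injective.injOn
    rintro _ ⟨g, hg, rfl⟩
    change ρ0 g = 1
    ext i j
    have h1 := hg i j
    have h2 : ρ g i j = ((ρ0 g i j : ℤ) : ℝ) := rfl
    rw [h2] at h1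
    have h3 : (1 : Matrix (Fin (Module.finrank ℤ (M ⧸ T))) (Fin (Module.finrank ℤ (M ⧸ T))) ℝ) i j =
        (((1 : Matrix (Fin (Module.finrank ℤ (M ⧸ T))) (Fin (Module.finrank ℤ (M ⧸ T))) ℤ) i j : ℤ) : ℝ) := by
      by_cases h : i = j <;> simp [h, Matrix.one_apply]
    rw [h3, ← Int.cast_sub, ← Int.cast_abs] at h1
    have h4 : |ρ0 g i j - (1 : Matrix _ _ ℤ) i j| < 1 := by exact_mod_cast h1
    rw [Int.abs_lt_one_iff, sub_eq_zero] at h4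
    exact h4

theorem malcev (G : Type*) [Group G] [h : Group.IsSolvable G] (hG : CommFG G) : NoethGrp G := by
  obtain ⟨d, hd⟩ := h.solvable
  exact malcev_aux (fun A _ h1 h2 => commFG_mulAut A h1 h2) d G hd hG

end

section

/-- The affine action attached to a linear part and a translational part. -/
def affAct {Γ : Type*} [Group Γ] (A : Γ →* Matrix (Fin 3) (Fin 3) ℝ) (b : Γ → Fin 3 → ℝ)
    (γ : Γ) (x : Fin 3 → ℝ) : Fin 3 → ℝ := (A γ).mulVec x + b γ

/-- A faithful properly discontinuous affine action of `Γ` on `ℝ³`. -/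
structure AffP {Γ : Type*} [Group Γ] (A : Γ →* Matrix (Fin 3) (Fin 3) ℝ) (b : Γ → Fin 3 → ℝ) :
    Prop where
  coc : ∀ γ δ, b (γ * δ) = (A γ).mulVec (b δ) + b γ
  faith : ∀ γ, A γ = 1 → b γ = 0 → γ = 1
  proper : ∀ R : ℝ, {γ | ∃ x, ‖x‖ ≤ R ∧ ‖affAct A b γ x‖ ≤ R}.Finite

namespace AffP

variable {Γ : Type*} [Group Γ] {A : Γ →* Matrix (Fin 3) (Fin 3) ℝ} {b : Γ → Fin 3 → ℝ}

theorem b_one (h : AffP A b) : b 1 = 0 := by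
  have := h.coc 1 1
  simpa using this

theorem act_mul (h : AffP A b) (γ δ : Γ) (x : Fin 3 → ℝ) :
    affAct A b (γ * δ) x = affAct A b γ (affAct A b δ x) := by
  simp only [affAct, map_mul, h.coc, Matrix.mulVec_add, Matrix.mulVec_mulVec, add_assoc]

theorem act_one (h : AffP A b) (x : Fin 3 → ℝ) : affAct A b 1 x = x := by
  simp [affAct, h.b_one]

theorem act_zero (γ : Γ) : affAct A b γ 0 = b γ := by simp [affAct]

theorem mul_inv_A (γ : Γ) : A γ * A γ⁻¹ = 1 := by rw [← map_mul, mul_inv_cancel, map_one]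

theorem inv_mul_A (γ : Γ) : A γ⁻¹ * A γ = 1 := by rw [← map_mul, inv_mul_cancel, map_one]

theorem restrict (h : AffP A b) (H : Subgroup Γ) :
    AffP (A.comp H.subtype) (fun γ : H => b γ) where
  coc := fun γ δ => h.coc γ δ
  faith := fun γ h1 h2 => Subtype.ext (h.faith γ h1 h2)
  proper := fun R => by
    refine Set.Finite.of_finite_image (f := Subtype.val) ((h.proper R).subset ?_)
      Subtype.val_injective.injOn
    rintro _ ⟨g, hg, rfl⟩
    exact hg

theorem finite_of_bdd (h : AffP A b) (S : Set Γ) (R R' : ℝ)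
    (hS : ∀ γ ∈ S, ∃ x, ‖x‖ ≤ R ∧ ‖affAct A b γ x‖ ≤ R') : S.Finite := by
  refine (h.proper (max R R')).subset ?_
  intro γ hγ
  obtain ⟨x, h1, h2⟩ := hS γ hγ
  exact ⟨x, h1.trans (le_max_left _ _), h2.trans (le_max_right _ _)⟩

theorem _root_.mulVec_bound (Q : Matrix (Fin 3) (Fin 3) ℝ) :
    ∃ C : ℝ, 0 ≤ C ∧ ∀ x : Fin 3 → ℝ, ‖Q.mulVec x‖ ≤ C * ‖x‖ :=
  ⟨‖(Matrix.mulVecLin Q).toContinuousLinearMap‖, norm_nonneg _,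
    fun x => (Matrix.mulVecLin Q).toContinuousLinearMap.le_opNorm x⟩

/-- conjugate linear part -/
def _root_.conjHom (A : Γ →* Matrix (Fin 3) (Fin 3) ℝ) (P Q : Matrix (Fin 3) (Fin 3) ℝ)
    (hPQ : P * Q = 1) (hQP : Q * P = 1) : Γ →* Matrix (Fin 3) (Fin 3) ℝ where
  toFun γ := P * A γ * Q
  map_one' := by simp [hPQ]
  map_mul' := fun x y => by
    rw [map_mul]
    calc P * (A x * A y) * Q = P * A x * 1 * A y * Q := by simp [mul_assoc]
      _ = _ := by rw [← hQP]; simp only [mul_assoc]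

theorem conj (h : AffP A b) (P Q : Matrix (Fin 3) (Fin 3) ℝ) (hPQ : P * Q = 1) (hQP : Q * P = 1) :
    AffP (conjHom A P Q hPQ hQP) (fun γ => P.mulVec (b γ)) where
  coc := fun γ δ => by
    simp only [conjHom, MonoidHom.coe_mk, OneHom.coe_mk, h.coc, Matrix.mulVec_add,
      Matrix.mulVec_mulVec, mul_assoc, hQP, mul_one]
  faith := fun γ h1 h2 => by
    apply h.faith
    · have h3 : P * A γ * Q = 1 := h1
      calc A γ = (Q * P) * A γ * (Q * P) := by simp [hQP]
        _ = Q * (P * A γ * Q) * P := by simp only [mul_assoc]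
        _ = 1 := by rw [h3, mul_one, hQP]
    · have := congrArg (Q.mulVec) h2
      simpa [Matrix.mulVec_mulVec, hQP] using this
  proper := fun R => by
    obtain ⟨C, hC0, hC⟩ := mulVec_bound Q
    refine h.finite_of_bdd _ (C * R) (C * R) ?_
    rintro γ ⟨x, h1, h2⟩
    refine ⟨Q.mulVec x, (hC x).trans (by gcongr), ?_⟩
    have : affAct A b γ (Q.mulVec x) = Q.mulVec (affAct (conjHom A P Q hPQ hQP)
        (fun γ => P.mulVec (b γ)) γ x) := by
      simp only [affAct, conjHom, MonoidHom.coe_mk, OneHom.coe_mk, Matrix.mulVec_add,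
        Matrix.mulVec_mulVec, hQP, Matrix.one_mulVec, ← mul_assoc, one_mul]
    rw [this]
    exact (hC _).trans (by gcongr)

theorem trans (h : AffP A b) (q : Fin 3 → ℝ) :
    AffP A (fun γ => b γ + (A γ).mulVec q - q) where
  coc := fun γ δ => by
    simp only [h.coc, map_mul, Matrix.mulVec_add, Matrix.mulVec_sub, Matrix.mulVec_mulVec]
    abel
  faith := fun γ h1 h2 => by
    apply h.faith γ h1
    simpa [h1] using h2
  proper := fun R => by
    refine h.finite_of_bdd _ (R + ‖q‖) (R + ‖q‖) ?_
    rintro γ ⟨x, h1, h2⟩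
    refine ⟨x + q, (norm_add_le _ _).trans (by gcongr), ?_⟩
    have : affAct A b γ (x + q) = affAct A (fun γ => b γ + (A γ).mulVec q - q) γ x + q := by
      simp only [affAct, Matrix.mulVec_add]; abel
    rw [this]
    exact (norm_add_le _ _).trans (by gcongr)

theorem finOrder_of_fixed (h : AffP A b) (γ : Γ) (x : Fin 3 → ℝ) (hx : affAct A b γ x = x) :
    IsOfFinOrder γ := by
  have hp : ∀ n : ℕ, affAct A b (γ ^ n) x = x := by
    intro n
    induction n with
    | zero => rw [pow_zero, h.act_one]
    | succ n ih => rw [pow_succ, h.act_mul, hx, ih]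
  rw [← finite_powers]
  refine (h.proper ‖x‖).subset ?_
  rintro _ ⟨n, rfl⟩
  exact ⟨x, le_rfl, by simp only [hp]; rfl⟩

theorem fixed_of_det (A' : Matrix (Fin 3) (Fin 3) ℝ) (c : Fin 3 → ℝ) (hd : (A' - 1).det ≠ 0) :
    ∃ x, A'.mulVec x + c = x := by
  refine ⟨((A' - 1)⁻¹).mulVec (-c), ?_⟩
  have h1 : (A' - 1).mulVec (((A' - 1)⁻¹).mulVec (-c)) = -c := by
    rw [Matrix.mulVec_mulVec, Matrix.mul_nonsing_inv _ (isUnit_iff_ne_zero.2 hd), Matrix.one_mulVec]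
  rw [Matrix.sub_mulVec, Matrix.one_mulVec] at h1
  rw [sub_eq_iff_eq_add] at h1
  rw [h1]; abel

theorem finOrder_of_det (h : AffP A b) (γ : Γ) (hd : (A γ - 1).det ≠ 0) : IsOfFinOrder γ := by
  obtain ⟨x, hx⟩ := fixed_of_det (A γ) (b γ) hd
  exact h.finOrder_of_fixed γ x hx

/-- The homogeneous 4-dimensional matrix. -/
def mat4 (h : AffP A b) : Γ →* Matrix (Fin 3 ⊕ Fin 1) (Fin 3 ⊕ Fin 1) ℝ where
  toFun γ := Matrix.fromBlocks (A γ) (Matrix.of fun i _ => b γ i) 0 1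
  map_one' := by
    rw [map_one, h.b_one]
    convert Matrix.fromBlocks_one
    ext; rfl
  map_mul' := fun x y => by
    rw [Matrix.fromBlocks_multiply]
    simp only [Matrix.mul_zero, add_zero, Matrix.mul_one, Matrix.zero_mul, map_mul, zero_add, h.coc]
    congr 1

theorem noeth (h : AffP A b) [Group.IsSolvable Γ] : NoethGrp Γ := by
  apply malcev
  intro K hK
  rw [← Group.fg_iff_subgroup_fg]
  refine fg_of_discrete_comm_real K (fun a b => Subtype.ext (hK a a.2 b b.2))
    (h.mat4.comp K.subtype)
    {M | ∀ i, |M (Sum.inl i) (Sum.inr 0)| < 1} ?_ ?_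
  · have : {M : Matrix (Fin 3 ⊕ Fin 1) (Fin 3 ⊕ Fin 1) ℝ | ∀ i, |M (Sum.inl i) (Sum.inr 0)| < 1}
        = ⋂ i, {M | |M (Sum.inl i) (Sum.inr 0)| < 1} := by
      ext; simp
    rw [this]
    refine IsOpen.mem_nhds ?_ (by simp)
    refine isOpen_iInter_of_finite fun i => ?_
    exact isOpen_lt (by fun_prop) continuous_const
  · refine Set.Finite.of_finite_image (f := Subtype.val) ((h.proper 1).subset ?_)
      Subtype.val_injective.injOn
    rintro _ ⟨g, hg, rfl⟩
    refine ⟨0, by simp, ?_⟩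
    rw [act_zero]
    refine (pi_norm_le_iff_of_nonneg zero_le_one).2 fun i => ?_
    exact (hg i).le

end AffP

end

section

open Matrix

theorem par2 (v z : Fin 2 → ℝ) (hv : v ≠ 0) (h : z 0 * v 1 = z 1 * v 0) : ∃ c : ℝ, z = c • v := by
  by_cases h0 : v 0 = 0
  · have h1 : v 1 ≠ 0 := by
      intro h1; apply hv; ext i; fin_cases i <;> simp [h0, h1]
    refine ⟨z 1 / v 1, ?_⟩
    rw [h0, mul_zero] at h
    have hz : z 0 = 0 := by
      rcases mul_eq_zero.1 h with h | h
      · exact h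
      · exact absurd h h1
    ext i; fin_cases i
    · simp [hz, h0]
    · simp [h1]
  · refine ⟨z 0 / v 0, ?_⟩
    ext i; fin_cases i
    · simp [h0]
    · simp; field_simp; linarith

theorem mul2 (M N : Matrix (Fin 2) (Fin 2) ℝ) (i j : Fin 2) :
    (M * N) i j = M i 0 * N 0 j + M i 1 * N 1 j := by
  rw [Matrix.mul_apply, Fin.sum_univ_two]

theorem mulVec2 (M : Matrix (Fin 2) (Fin 2) ℝ) (v : Fin 2 → ℝ) (i : Fin 2) :
    (M.mulVec v) i = M i 0 * v 0 + M i 1 * v 1 := by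
  simp [Matrix.mulVec, dotProduct, Fin.sum_univ_two]

theorem ext2 {M N : Matrix (Fin 2) (Fin 2) ℝ} (h00 : M 0 0 = N 0 0) (h01 : M 0 1 = N 0 1)
    (h10 : M 1 0 = N 1 0) (h11 : M 1 1 = N 1 1) : M = N := by
  ext i j; fin_cases i <;> fin_cases j <;> assumption

/-- two unipotents fixing the same vector commute -/
theorem fix_comm2 (M N : Matrix (Fin 2) (Fin 2) ℝ) (v : Fin 2 → ℝ) (hv : v ≠ 0)
    (hM : M.mulVec v = v) (hN : N.mulVec v = v) (hMd : M.det = 1) (hNd : N.det = 1) :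
    M * N = N * M := by
  have key : ∀ M : Matrix (Fin 2) (Fin 2) ℝ, M.mulVec v = v → M.det = 1 → ∃ s : ℝ,
      M 0 0 = 1 + s * v 0 * v 1 ∧ M 0 1 = - s * v 0 ^ 2 ∧ M 1 0 = s * v 1 ^ 2 ∧
      M 1 1 = 1 - s * v 0 * v 1 := by
    intro M hM hd
    have e0 := congrFun hM 0
    have e1 := congrFun hM 1
    rw [mulVec2] at e0 e1
    rw [det_fin_two] at hd
    by_cases h0 : v 0 = 0
    · have h1 : v 1 ≠ 0 := by
        intro h1; apply hv; ext i; fin_cases i <;> simp [h0, h1]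
      rw [h0] at e0 e1
      have a1 : M 0 1 = 0 := by
        have : M 0 1 * v 1 = 0 := by linarith
        exact (mul_eq_zero.1 this).resolve_right h1
      have a2 : M 1 1 = 1 := by
        have : (M 1 1 - 1) * v 1 = 0 := by linarith
        linarith [(mul_eq_zero.1 this).resolve_right h1]
      rw [a1, a2] at hd
      refine ⟨M 1 0 / v 1 ^ 2, ?_, ?_, ?_, ?_⟩
      · rw [h0]; linarith
      · rw [h0, a1]; ring
      · field_simp
      · rw [h0, a2]; ring
    · refine ⟨- M 0 1 / v 0 ^ 2, ?_, ?_, ?_, ?_⟩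
      · field_simp
        linarith
      · field_simp
      · field_simp
        have hs : (M 0 0 - 1) * v 0 = - M 0 1 * v 1 := by linarith
        have hs2 : M 1 0 * v 0 = (1 - M 1 1) * v 1 := by linarith
        have h3 : (M 1 1 - 1 + (M 0 0 - 1)) * v 0 * v 0 = 0 := by
          linear_combination (v 0 * v 0) * hd + M 0 1 * v 0 * hs2 - v 0 * (M 1 1 - 1) * hs
        have h4 : M 1 1 - 1 + (M 0 0 - 1) = 0 := by
          have := (mul_eq_zero.1 h3).resolve_right h0
          exact (mul_eq_zero.1 this).resolve_right h0
        linear_combination v 0 * hs2 - v 0 * v 1 * h4 + v 1 * hs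
      · field_simp
        have hs : (M 0 0 - 1) * v 0 = - M 0 1 * v 1 := by linarith
        have hs2 : M 1 0 * v 0 = (1 - M 1 1) * v 1 := by linarith
        have h3 : (M 1 1 - 1 + (M 0 0 - 1)) * v 0 * v 0 = 0 := by
          linear_combination (v 0 * v 0) * hd + M 0 1 * v 0 * hs2 - v 0 * (M 1 1 - 1) * hs
        have h4 : M 1 1 - 1 + (M 0 0 - 1) = 0 := by
          have := (mul_eq_zero.1 h3).resolve_right h0
          exact (mul_eq_zero.1 this).resolve_right h0
        linear_combination v 0 * h4 - hs
  obtain ⟨s, a1, a2, a3, a4⟩ := key M hM hMd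
  obtain ⟨t, b1, b2, b3, b4⟩ := key N hN hNd
  apply ext2 <;> simp only [mul2, a1, a2, a3, a4, b1, b2, b3, b4] <;> ring

theorem trace_pow_hyp (M : Matrix (Fin 2) (Fin 2) ℝ) (hd : M.det = 1) (ht : 2 < |M.trace|)
    (n : ℕ) (hn : n ≠ 0) : M ^ n ≠ 1 := by
  have hCH : M * M = M.trace • M - 1 := by
    rw [det_fin_two] at hd
    apply ext2 <;> simp [mul2, trace_fin_two] <;> linarith
  have hrec : ∀ k, (M ^ (k + 2)).trace = M.trace * (M ^ (k + 1)).trace - (M ^ k).trace := by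
    intro k
    rw [pow_add, pow_two, hCH, mul_sub, trace_sub, mul_smul_comm, trace_smul, mul_one, ← pow_succ,
      smul_eq_mul]
  have hinc : ∀ k, 2 ≤ |(M ^ k).trace| ∧ |(M ^ k).trace| < |(M ^ (k + 1)).trace| := by
    intro k
    induction k with
    | zero => simpa using ht
    | succ k ih =>
      obtain ⟨h1, h2⟩ := ih
      refine ⟨by linarith, ?_⟩
      rw [hrec]
      have h3 := abs_sub_abs_le_abs_sub (M.trace * (M ^ (k + 1)).trace) (M ^ k).trace
      rw [abs_mul] at h3
      nlinarith [abs_nonneg (M ^ (k + 1)).trace]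
  intro h
  obtain ⟨k, rfl⟩ := Nat.exists_eq_succ_of_ne_zero hn
  have h1 := hinc k
  have h2 : (M ^ (k + 1)).trace = 2 := by rw [Nat.succ_eq_add_one] at h; rw [h]; simp
  rw [h2] at h1
  norm_num at h1
  linarith

theorem sl2_dich {G : Type*} [Group G] (ρ : G →* Matrix (Fin 2) (Fin 2) ℝ) (Δ : Subgroup G)
    (hd : ∀ g ∈ Δ, (ρ g).det = 1) (ht : ∀ g ∈ Δ, |(ρ g).trace| ≤ 2) :
    (∃ v : Fin 2 → ℝ, v ≠ 0 ∧ ∀ g ∈ Δ, ∃ c : ℝ, (ρ g).mulVec v = c • v) ∨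
    (∀ g ∈ Δ, ∀ h ∈ Δ, ρ g * ρ h = ρ h * ρ g) := by
  by_cases hp : ∃ p ∈ Δ, ρ p ≠ 1 ∧ ρ p ≠ -1 ∧ |(ρ p).trace| = 2
  · left
    obtain ⟨p, hpΔ, hp1, hp2, hp3⟩ := hp
    have hCH : ρ p * ρ p = (ρ p).trace • ρ p - 1 := by
      have := hd p hpΔ
      rw [det_fin_two] at this
      apply ext2 <;> simp [mul2, trace_fin_two] <;> linarith
    -- q = p^2 has trace 2
    have hq : ∃ q ∈ Δ, ρ q ≠ 1 ∧ (ρ q).trace = 2 := by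
      rcases abs_eq (by norm_num : (0:ℝ) ≤ 2) |>.1 hp3 with h | h
      · exact ⟨p, hpΔ, hp1, h⟩
      · refine ⟨p * p, Δ.mul_mem hpΔ hpΔ, ?_, ?_⟩
        · rw [map_mul, hCH, h]
          intro h2
          apply hp2
          ext i j
          have := congrFun (congrFun h2 i) j
          simp only [Matrix.sub_apply, Matrix.smul_apply, smul_eq_mul, Matrix.neg_apply] at this ⊢
          linarith
        · rw [map_mul, hCH, h]
          simp [trace_sub, trace_smul, h]
          norm_num
    obtain ⟨q, hqΔ, hq1, hq2⟩ := hq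
    set N := ρ q - 1 with hN
    have hN0 : N ≠ 0 := sub_ne_zero.2 hq1
    have hdq := hd q hqΔ
    have hNN : N * N = 0 := by
      rw [det_fin_two] at hdq
      rw [trace_fin_two] at hq2
      apply ext2 <;> simp [hN, mul2]
      · linear_combination (ρ q 0 0) * hq2 - hdq
      · linear_combination (ρ q 0 1) * hq2
      · linear_combination (ρ q 1 0) * hq2
      · linear_combination (ρ q 1 1) * hq2 - hdq
    have hpow : ∀ n : ℕ, ρ (q ^ n) = 1 + (n : ℝ) • N := by
      intro n
      induction n with
      | zero => simp
      | succ n ih =>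
        have hq' : ρ q = 1 + N := by rw [hN]; abel
        rw [pow_succ, map_mul, ih, hq', add_mul, mul_add, mul_add, smul_mul_assoc, smul_mul_assoc,
          hNN]
        push_cast
        rw [add_smul]
        simp
        abel
    have htr : ∀ g ∈ Δ, (N * ρ g).trace = 0 := by
      intro g hg
      by_contra hne
      have hb : ∀ n : ℕ, |(ρ g).trace + n * (N * ρ g).trace| ≤ 2 := by
        intro n
        have := ht (q ^ n * g) (Δ.mul_mem (Δ.pow_mem hqΔ n) hg)
        rw [map_mul, hpow, add_mul, one_mul, smul_mul_assoc, trace_add, trace_smul,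
          smul_eq_mul] at this
        exact this
      have hb2 : ∀ n : ℕ, n * |(N * ρ g).trace| ≤ 4 := by
        intro n
        have h1 := hb n
        have h2 := ht g hg
        have h3 : (n : ℝ) * |(N * ρ g).trace| = |(n * (N * ρ g).trace)| := by
          rw [abs_mul, Nat.abs_cast]
        rw [h3]
        rw [abs_le] at *
        constructor <;> linarith
      obtain ⟨n, hn⟩ := exists_nat_gt (4 / |(N * ρ g).trace|)
      rw [div_lt_iff₀ (abs_pos.2 hne)] at hn
      linarith [hb2 n]
    have hNt : N 0 0 + N 1 1 = 0 := by
      rw [trace_fin_two] at hq2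
      simp [hN]; linarith
    have hv : ∃ v : Fin 2 → ℝ, v ≠ 0 ∧ ∃ w, v = N.mulVec w := by
      by_contra hcon
      push Not at hcon
      apply hN0
      ext i j
      by_contra h
      apply hcon (N.mulVec (Pi.single j 1)) _ _ rfl
      intro h0
      have := congrFun h0 i
      simp at this
      exact h this
    obtain ⟨v, hv0, w, hw⟩ := hv
    refine ⟨v, hv0, fun g hg => ?_⟩
    have hNv : N.mulVec v = 0 := by rw [hw, mulVec_mulVec, hNN, zero_mulVec]
    have hNgN : N * ρ g * N = 0 := by
      have h1 := htr g hg
      have h00 := congrFun (congrFun hNN 0) 0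
      have h01 := congrFun (congrFun hNN 0) 1
      have h10 := congrFun (congrFun hNN 1) 0
      have h11 := congrFun (congrFun hNN 1) 1
      rw [trace_fin_two, mul2, mul2] at h1
      simp only [mul2, Matrix.zero_apply] at h00 h01 h10 h11
      have e : N 1 1 = - N 0 0 := by linarith
      rw [e] at h1
      apply ext2 <;> simp only [mul2, Matrix.zero_apply, e]
      · linear_combination N 0 0 * h1 + (ρ g 1 1) * h00
      · linear_combination N 0 1 * h1 - (ρ g 0 1) * h00
      · linear_combination N 1 0 * h1 - ρ g 1 0 * h00
      · linear_combination -N 0 0 * h1 + (ρ g 0 0) * h00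
    have hNgv : N.mulVec ((ρ g).mulVec v) = 0 := by
      rw [hw, mulVec_mulVec, mulVec_mulVec, hNgN, zero_mulVec]
    apply par2 v _ hv0
    set z := (ρ g).mulVec v
    obtain ⟨i, j, hij⟩ : ∃ i j, N i j ≠ 0 := by
      by_contra hcon
      push Not at hcon
      exact hN0 (by ext i j; simp [hcon])
    have e1 := congrFun hNv i
    have e2 := congrFun hNgv i
    rw [mulVec2] at e1 e2
    simp only [Pi.zero_apply] at e1 e2
    have f1 : N i 0 * (z 0 * v 1 - z 1 * v 0) = 0 := by
      linear_combination v 1 * e2 - z 1 * e1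
    have f2 : N i 1 * (z 0 * v 1 - z 1 * v 0) = 0 := by
      linear_combination - v 0 * e2 + z 0 * e1
    have : z 0 * v 1 - z 1 * v 0 = 0 := by
      fin_cases j
      · exact (mul_eq_zero.1 f1).resolve_left hij
      · exact (mul_eq_zero.1 f2).resolve_left hij
    linarith
  · right
    push Not at hp
    intro g hg h hh
    by_cases h1 : ρ g = 1
    · rw [h1, one_mul, mul_one]
    by_cases h2 : ρ g = -1
    · rw [h2]; simp
    have h3 : |(ρ g).trace| < 2 := lt_of_le_of_ne (ht g hg) (hp g hg h1 h2)
    have hdg := hd g hg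
    have hdh := hd h hh
    have htc : (ρ (g * h * (g⁻¹ * h⁻¹))).trace ≤ 2 :=
      (abs_le.1 (ht _ (Δ.mul_mem (Δ.mul_mem hg hh) (Δ.mul_mem (Δ.inv_mem hg) (Δ.inv_mem hh))))).2
    have hinv : ∀ g ∈ Δ, ρ g⁻¹ = (ρ g).adjugate := by
      intro g hg
      have h1 : ρ g⁻¹ * ρ g = 1 := by rw [← map_mul, inv_mul_cancel, map_one]
      calc ρ g⁻¹ = ρ g⁻¹ * (ρ g * (ρ g).adjugate) := by
            rw [mul_adjugate, hd g hg, one_smul, mul_one]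
        _ = _ := by rw [← mul_assoc, h1, one_mul]
    rw [map_mul, map_mul, map_mul, hinv g hg, hinv h hh] at htc
    rw [adjugate_fin_two, adjugate_fin_two, trace_fin_two] at htc
    simp only [mul2, of_apply, cons_val', cons_val_zero, cons_val_one, cons_val_fin_one] at htc
    rw [trace_fin_two] at h3
    rw [det_fin_two] at hdg hdh
    obtain ⟨h3a, h3b⟩ := abs_lt.1 h3
    have key : ∀ p q r s a b c d : ℝ, -2 < p + s → p + s < 2 → p * s - q * r = 1 →
        (q * c - b * r) ^ 2 + ((p - s) * b + q * (d - a)) * (r * (a - d) + c * (s - p)) ≤ 0 →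
        q * c - b * r = 0 ∧ (p - s) * b + q * (d - a) = 0 ∧ r * (a - d) + c * (s - p) = 0 := by
      intro p q r s a b c d h1 h2 h3 h4
      set x := q * c - b * r with hx
      set y := (p - s) * b + q * (d - a) with hy
      set z := r * (a - d) + c * (s - p) with hz
      have e : (p - s) * x + q * z + r * y = 0 := by rw [hx, hy, hz]; ring
      have hq : q ≠ 0 := by
        rintro rfl
        nlinarith [sq_nonneg (p - s)]
      have hdis : (p - s) ^ 2 / 4 + r * q < 0 := by nlinarith
      have h5 : (q * x - (p - s) * y / 2) ^ 2 - ((p - s) ^ 2 / 4 + r * q) * y ^ 2 =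
          q ^ 2 * (x ^ 2 + y * z) := by linear_combination -q * y * e
      have h6 : q ^ 2 * (x ^ 2 + y * z) ≤ 0 := mul_nonpos_of_nonneg_of_nonpos (sq_nonneg q) h4
      have hy0 : y = 0 := by
        by_contra hy0
        have : 0 < y ^ 2 := by positivity
        nlinarith [sq_nonneg (q * x - (p - s) * y / 2)]
      rw [hy0] at h5 e
      have hx0 : x = 0 := by
        have : (q * x) ^ 2 ≤ 0 := by rw [hy0] at h6; nlinarith
        have h7 : q * x = 0 := by
          by_contra h8
          have : 0 < (q * x) ^ 2 := by positivity
          linarith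
        exact (mul_eq_zero.1 h7).resolve_left hq
      rw [hx0] at e
      refine ⟨hx0, hy0, ?_⟩
      have : q * z = 0 := by linarith
      exact (mul_eq_zero.1 this).resolve_left hq
    obtain ⟨k1, k2, k3⟩ := key (ρ g 0 0) (ρ g 0 1) (ρ g 1 0) (ρ g 1 1)
      (ρ h 0 0) (ρ h 0 1) (ρ h 1 0) (ρ h 1 1) h3a h3b hdg (by
        have e2 : (ρ g 0 0 * ρ g 1 1 - ρ g 0 1 * ρ g 1 0) * (ρ h 0 0 * ρ h 1 1 - ρ h 0 1 * ρ h 1 0)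
          = 1 := by rw [hdg, hdh, one_mul]
        linarith)
    apply ext2 <;> simp only [mul2] <;> linarith

end

section

open Matrix
open scoped commutatorElement

theorem mul3 (M N : Matrix (Fin 3) (Fin 3) ℝ) (i j : Fin 3) :
    (M * N) i j = M i 0 * N 0 j + M i 1 * N 1 j + M i 2 * N 2 j := by
  rw [Matrix.mul_apply, Fin.sum_univ_three]

theorem mulVec3 (M : Matrix (Fin 3) (Fin 3) ℝ) (v : Fin 3 → ℝ) (i : Fin 3) :
    (M.mulVec v) i = M i 0 * v 0 + M i 1 * v 1 + M i 2 * v 2 := by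
  simp [Matrix.mulVec, dotProduct, Fin.sum_univ_three]

theorem ext3 {M N : Matrix (Fin 3) (Fin 3) ℝ} (h00 : M 0 0 = N 0 0) (h01 : M 0 1 = N 0 1)
    (h02 : M 0 2 = N 0 2) (h10 : M 1 0 = N 1 0) (h11 : M 1 1 = N 1 1) (h12 : M 1 2 = N 1 2)
    (h20 : M 2 0 = N 2 0) (h21 : M 2 1 = N 2 1) (h22 : M 2 2 = N 2 2) : M = N := by
  ext i j; fin_cases i <;> fin_cases j <;> assumption

theorem vext3 {v w : Fin 3 → ℝ} (h0 : v 0 = w 0) (h1 : v 1 = w 1) (h2 : v 2 = w 2) : v = w := by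
  ext i; fin_cases i <;> assumption

theorem der_succ_le {G : Type*} [Group G] (n : ℕ) (N : Subgroup G)
    (h : ∀ a ∈ derivedSeries G n, ∀ b ∈ derivedSeries G n, ⁅a, b⁆ ∈ N) :
    derivedSeries G (n + 1) ≤ N := by
  rw [derivedSeries_succ, Subgroup.commutator_le]
  exact h

theorem der_succ_le_of_comm {G M : Type*} [Group G] [Monoid M] (ρ : G →* M) (n : ℕ)
    (h : ∀ a ∈ derivedSeries G n, ∀ b ∈ derivedSeries G n, ρ a * ρ b = ρ b * ρ a) :
    ∀ g ∈ derivedSeries G (n + 1), ρ g = 1 := by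
  have := der_succ_le n ρ.ker (fun a ha b hb => by
    rw [MonoidHom.mem_ker, commutatorElement_def, map_mul, map_mul, map_mul, h a ha b hb, ← map_mul,
      ← map_mul, ← map_mul]
    simp)
  intro g hg
  exact MonoidHom.mem_ker.1 (this hg)

theorem der_one_of_comm {G M : Type*} [Group G] [CommMonoid M] (f : G →* M) (n : ℕ) :
    ∀ g ∈ derivedSeries G (n + 1), f g = 1 :=
  der_succ_le_of_comm f n (fun a _ b _ => mul_comm _ _)

theorem der_dich {G : Type*} [Group G] (ρ : G →* Matrix (Fin 2) (Fin 2) ℝ) (n : ℕ)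
    (hd : ∀ g ∈ derivedSeries G n, (ρ g).det = 1)
    (h : (∃ v : Fin 2 → ℝ, v ≠ 0 ∧ ∀ g ∈ derivedSeries G n, ∃ c : ℝ, (ρ g).mulVec v = c • v) ∨
    (∀ g ∈ derivedSeries G n, ∀ h ∈ derivedSeries G n, ρ g * ρ h = ρ h * ρ g)) :
    ∀ g ∈ derivedSeries G (n + 2), ρ g = 1 := by
  rcases h with ⟨v, hv, h⟩ | h
  · have hmul : ∀ a b, ρ a * ρ b = ρ (a * b) := fun a b => (map_mul ρ a b).symm
    let N : Subgroup G :=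
      { carrier := {g | (ρ g).mulVec v = v}
        one_mem' := by
          change (ρ 1).mulVec v = v
          rw [map_one, one_mulVec]
        mul_mem' := by
          intro a b ha hb
          change (ρ (a * b)).mulVec v = v
          change (ρ a).mulVec v = v at ha
          change (ρ b).mulVec v = v at hb
          rw [map_mul, ← mulVec_mulVec, hb, ha]
        inv_mem' := by
          intro a ha
          change (ρ a).mulVec v = v at ha
          change (ρ a⁻¹).mulVec v = v
          have h1 : ((ρ a⁻¹) * (ρ a)).mulVec v = v := by
            rw [← map_mul, inv_mul_cancel, map_one, one_mulVec]
          rwa [← mulVec_mulVec, ha] at h1 }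
    have h1 : derivedSeries G (n + 1) ≤ N := by
      apply der_succ_le
      intro a ha b hb
      change (ρ ⁅a, b⁆).mulVec v = v
      obtain ⟨c, hc⟩ := h a ha
      obtain ⟨d, hd⟩ := h b hb
      have e1 : (ρ (a * b)).mulVec v = (ρ (b * a)).mulVec v := by
        rw [map_mul, map_mul, ← mulVec_mulVec, ← mulVec_mulVec, hc, hd, mulVec_smul, mulVec_smul,
          hc, hd, smul_comm]
      have e2 : ⁅a, b⁆ = a * b * (b * a)⁻¹ := by rw [commutatorElement_def]; group
      have e3 : ρ (b * a)⁻¹ *ᵥ ρ (b * a) *ᵥ v = v := by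
        rw [mulVec_mulVec, ← map_mul, inv_mul_cancel, map_one, one_mulVec]
      obtain ⟨k, hk⟩ : ∃ k : ℝ, (ρ (b * a)).mulVec v = k • v :=
        h _ (Subgroup.mul_mem _ hb ha)
      have hk0 : k ≠ 0 := by
        rintro rfl
        rw [hk, zero_smul, mulVec_zero] at e3
        exact hv e3.symm
      have e4 : (ρ (b * a)⁻¹).mulVec v = k⁻¹ • v := by
        rw [hk, mulVec_smul] at e3
        rw [← e3, smul_smul, inv_mul_cancel₀ hk0, one_smul, e3]
      rw [e2, map_mul, ← mulVec_mulVec, e4, mulVec_smul, e1, hk, smul_smul, inv_mul_cancel₀ hk0,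
        one_smul]
    refine der_succ_le_of_comm ρ (n + 1) (fun a ha b hb => ?_)
    have hanti := derivedSeries_antitone G (Nat.le_succ n)
    exact fix_comm2 _ _ v hv (h1 ha) (h1 hb) (hd a (hanti ha)) (hd b (hanti hb))
  · intro g hg
    exact der_succ_le_of_comm ρ n h g (derivedSeries_antitone G (Nat.le_succ (n+1)) hg)

namespace AffP

variable {Γ : Type*} [Group Γ] {A : Γ →* Matrix (Fin 3) (Fin 3) ℝ} {b : Γ → Fin 3 → ℝ}

theorem ext_of (h : AffP A b) {γ δ : Γ} (h1 : A γ = A δ) (h2 : b γ = b δ) : γ = δ := by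
  have hb : b (γ⁻¹ * δ) = 0 := by
    have e := h.coc γ⁻¹ γ
    rw [inv_mul_cancel, h.b_one, h2] at e
    rw [h.coc, ← e]
  have hA : A (γ⁻¹ * δ) = 1 := by rw [map_mul, ← h1, inv_mul_A]
  have := h.faith _ hA hb
  exact inv_mul_eq_one.1 this

theorem solv_of_comm_A (h : AffP A b) (n : ℕ)
    (hc : ∀ g ∈ derivedSeries Γ n, ∀ k ∈ derivedSeries Γ n, A g * A k = A k * A g) :
    Group.IsSolvable Γ := by
  refine ⟨n + 2, ?_⟩
  rw [eq_bot_iff]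
  have h1 := der_succ_le_of_comm A n hc
  apply der_succ_le
  intro a ha c hd
  rw [Subgroup.mem_bot, commutatorElement_eq_one_iff_mul_comm]
  apply h.ext_of
  · rw [map_mul, map_mul, h1 a ha, h1 c hd]
  · rw [h.coc, h.coc, h1 a ha, h1 c hd, one_mulVec, one_mulVec, add_comm]

/-- lower right block -/
def rhoL (A : Γ →* Matrix (Fin 3) (Fin 3) ℝ) (hA : ∀ γ, A γ 1 0 = 0 ∧ A γ 2 0 = 0) :
    Γ →* Matrix (Fin 2) (Fin 2) ℝ where
  toFun γ := !![A γ 1 1, A γ 1 2; A γ 2 1, A γ 2 2]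
  map_one' := by apply ext2 <;> simp
  map_mul' := fun x y => by
    obtain ⟨h1, h2⟩ := hA x
    apply ext2 <;> simp [mul2, mul3, h1, h2]

/-- upper left block -/
def rhoP (A : Γ →* Matrix (Fin 3) (Fin 3) ℝ) (hA : ∀ γ, A γ 2 0 = 0 ∧ A γ 2 1 = 0) :
    Γ →* Matrix (Fin 2) (Fin 2) ℝ where
  toFun γ := !![A γ 0 0, A γ 0 1; A γ 1 0, A γ 1 1]
  map_one' := by apply ext2 <;> simp
  map_mul' := fun x y => by
    obtain ⟨h1, h2⟩ := hA y
    apply ext2 <;> simp [mul2, mul3, h1, h2]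

/-- top left entry -/
def chiL (A : Γ →* Matrix (Fin 3) (Fin 3) ℝ) (hA : ∀ γ, A γ 1 0 = 0 ∧ A γ 2 0 = 0) :
    Γ →* ℝ where
  toFun γ := A γ 0 0
  map_one' := by simp
  map_mul' := fun x y => by
    obtain ⟨h1, h2⟩ := hA y
    simp [mul3, h1, h2]

/-- bottom right entry -/
def chiP (A : Γ →* Matrix (Fin 3) (Fin 3) ℝ) (hA : ∀ γ, A γ 2 0 = 0 ∧ A γ 2 1 = 0) :
    Γ →* ℝ where
  toFun γ := A γ 2 2
  map_one' := by simp
  map_mul' := fun x y => by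
    obtain ⟨h1, h2⟩ := hA x
    simp [mul3, h1, h2]

theorem plane_solv (h : AffP A b) (hA : ∀ γ, A γ 2 0 = 0 ∧ A γ 2 1 = 0) : Group.IsSolvable Γ := by
  set ρ := rhoP A hA with hρ
  have hchi : ∀ n, ∀ g ∈ derivedSeries Γ (n + 1), A g 2 2 = 1 := fun n g hg =>
    der_one_of_comm (chiP A hA) n g hg
  have hdet : ∀ n, ∀ g ∈ derivedSeries Γ (n + 1), (ρ g).det = 1 := fun n g hg =>
    der_one_of_comm ((detMonoidHom).comp ρ) n g hg
  have hb2mul : ∀ x y, A x 2 2 = 1 → b (x * y) 2 = b x 2 + b y 2 := by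
    intro x y hx
    rw [h.coc, Pi.add_apply, mulVec3, (hA x).1, (hA x).2, hx]; ring
  let N : Subgroup Γ :=
    { carrier := {g | A g 2 2 = 1 ∧ b g 2 = 0}
      one_mem' := by simp [h.b_one]
      mul_mem' := by
        rintro x y ⟨hx, hx2⟩ ⟨hy, hy2⟩
        refine ⟨?_, ?_⟩
        · have := map_mul (chiP A hA) x y
          change A (x * y) 2 2 = A x 2 2 * A y 2 2 at this
          rw [this, hx, hy, one_mul]
        · rw [hb2mul x y hx, hx2, hy2, add_zero]
      inv_mem' := by
        rintro x ⟨hx, hx2⟩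
        refine ⟨?_, ?_⟩
        · have := map_mul (chiP A hA) x x⁻¹
          change A (x * x⁻¹) 2 2 = A x 2 2 * A x⁻¹ 2 2 at this
          rw [hx, mul_inv_cancel] at this
          simp at this
          exact this.symm
        · have := hb2mul x x⁻¹ hx
          rw [mul_inv_cancel, h.b_one, hx2] at this
          simp at this
          exact this.symm }
  have hN : derivedSeries Γ 2 ≤ N := by
    apply der_succ_le 1
    intro x hx y hy
    have hx2 := hchi 0 x hx
    have hy2 := hchi 0 y hy
    have hc := hchi 0 _ (Subgroup.mul_mem _ hy hx)
    have hcm : ⁅x, y⁆ ∈ derivedSeries Γ 1 := Subgroup.commutator_le_self _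
      (Subgroup.commutator_mem_commutator hx hy)
    have hcc := hchi 0 _ hcm
    refine ⟨hcc, ?_⟩
    have e : ⁅x, y⁆ * (y * x) = x * y := by rw [commutatorElement_def]; group
    have e2 := hb2mul _ (y * x) hcc
    rw [e, hb2mul x y hx2, hb2mul y x hy2] at e2
    linarith
  have hdich := sl2_dich ρ (derivedSeries Γ 2) (hdet 1) (by
    intro g hg
    by_contra hcon
    push Not at hcon
    have hd := hdet 1 g hg
    obtain ⟨h22, hb2⟩ := hN hg
    -- fixed point
    have hne : (A g 0 0 - 1) * (A g 1 1 - 1) - A g 0 1 * A g 1 0 ≠ 0 := by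
      intro h0
      rw [det_fin_two] at hd
      rw [trace_fin_two] at hcon
      have hd' : A g 0 0 * A g 1 1 - A g 0 1 * A g 1 0 = 1 := hd
      have hcon' : 2 < |A g 0 0 + A g 1 1| := hcon
      have : A g 0 0 + A g 1 1 = 2 := by linarith
      rw [this] at hcon'
      norm_num at hcon'
    set D := (A g 0 0 - 1) * (A g 1 1 - 1) - A g 0 1 * A g 1 0 with hD
    have hfo : IsOfFinOrder g := by
      obtain ⟨z1, z2⟩ := hA g
      set p := (-(b g 0) * (A g 1 1 - 1) + A g 0 1 * b g 1) / D with hp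
      set q := (- (A g 0 0 - 1) * b g 1 + A g 1 0 * b g 0) / D with hq
      have hp' : p * D = -(b g 0) * (A g 1 1 - 1) + A g 0 1 * b g 1 := by
        rw [hp]; field_simp
      have hq' : q * D = - (A g 0 0 - 1) * b g 1 + A g 1 0 * b g 0 := by
        rw [hq]; field_simp
      refine h.finOrder_of_fixed g ![p, q, 0] ?_
      apply vext3
      · change ((A g).mulVec ![p, q, 0]) 0 + b g 0 = p
        rw [mulVec3]
        change A g 0 0 * p + A g 0 1 * q + A g 0 2 * 0 + b g 0 = p
        apply mul_right_cancel₀ hne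
        rw [← sub_eq_zero]
        linear_combination (A g 0 0 - 1) * hp' + A g 0 1 * hq' + b g 0 * hD
      · change ((A g).mulVec ![p, q, 0]) 1 + b g 1 = q
        rw [mulVec3]
        change A g 1 0 * p + A g 1 1 * q + A g 1 2 * 0 + b g 1 = q
        apply mul_right_cancel₀ hne
        rw [← sub_eq_zero]
        linear_combination (A g 1 0) * hp' + (A g 1 1 - 1) * hq' + b g 1 * hD
      · change ((A g).mulVec ![p, q, 0]) 2 + b g 2 = 0
        rw [mulVec3, z1, z2, hb2]
        change 0 * p + 0 * q + A g 2 2 * 0 + 0 = 0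
        ring
    obtain ⟨n, hn, hgn⟩ := isOfFinOrder_iff_pow_eq_one.1 hfo
    refine trace_pow_hyp (ρ g) hd hcon n hn.ne' ?_
    rw [← map_pow, hgn, map_one])
  have hker := der_dich ρ 2 (hdet 1) hdich
  refine h.solv_of_comm_A 4 ?_
  intro g hg k hk
  have e1 := hker g hg
  have e2 := hker k hk
  have f1 := hchi 3 g hg
  have f2 := hchi 3 k hk
  have m : ∀ g, ρ g = 1 → A g 0 0 = 1 ∧ A g 0 1 = 0 ∧ A g 1 0 = 0 ∧ A g 1 1 = 1 := by
    intro g hg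
    refine ⟨congrFun (congrFun hg 0) 0, congrFun (congrFun hg 0) 1, congrFun (congrFun hg 1) 0,
      congrFun (congrFun hg 1) 1⟩
  obtain ⟨a1, a2, a3, a4⟩ := m g e1
  obtain ⟨b1, b2, b3, b4⟩ := m k e2
  obtain ⟨z1, z2⟩ := hA g
  obtain ⟨y1, y2⟩ := hA k
  apply ext3 <;> simp only [mul3, a1, a2, a3, a4, b1, b2, b3, b4, z1, z2, y1, y2, f1, f2] <;> ring

theorem line_finish (h : AffP A b) (hA : ∀ γ, A γ 1 0 = 0 ∧ A γ 2 0 = 0)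
    (hdich : (∃ v : Fin 2 → ℝ, v ≠ 0 ∧ ∀ g ∈ derivedSeries Γ 1, ∃ c : ℝ,
      (rhoL A hA g).mulVec v = c • v) ∨
    (∀ g ∈ derivedSeries Γ 1, ∀ h ∈ derivedSeries Γ 1,
      rhoL A hA g * rhoL A hA h = rhoL A hA h * rhoL A hA g)) : Group.IsSolvable Γ := by
  set ρ := rhoL A hA with hρ
  have hchi : ∀ n, ∀ g ∈ derivedSeries Γ (n + 1), A g 0 0 = 1 := fun n g hg =>
    der_one_of_comm (chiL A hA) n g hg
  have hdet : ∀ n, ∀ g ∈ derivedSeries Γ (n + 1), (ρ g).det = 1 := fun n g hg =>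
    der_one_of_comm ((detMonoidHom).comp ρ) n g hg
  have hker := der_dich ρ 1 (hdet 0) hdich
  refine h.solv_of_comm_A 3 ?_
  intro g hg k hk
  have e1 := hker g hg
  have e2 := hker k hk
  have f1 := hchi 2 g hg
  have f2 := hchi 2 k hk
  have m : ∀ g, ρ g = 1 → A g 1 1 = 1 ∧ A g 1 2 = 0 ∧ A g 2 1 = 0 ∧ A g 2 2 = 1 := by
    intro g hg
    refine ⟨congrFun (congrFun hg 0) 0, congrFun (congrFun hg 0) 1, congrFun (congrFun hg 1) 0,
      congrFun (congrFun hg 1) 1⟩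
  obtain ⟨a1, a2, a3, a4⟩ := m g e1
  obtain ⟨b1, b2, b3, b4⟩ := m k e2
  obtain ⟨z1, z2⟩ := hA g
  obtain ⟨y1, y2⟩ := hA k
  apply ext3 <;> simp only [mul3, a1, a2, a3, a4, b1, b2, b3, b4, z1, z2, y1, y2, f1, f2] <;> ring

end AffP

end

section

open Matrix
open scoped commutatorElement

theorem adj_trace3 (M : Matrix (Fin 3) (Fin 3) ℝ) : M.adjugate.trace =
    M 0 0 * M 1 1 - M 0 1 * M 1 0 + (M 0 0 * M 2 2 - M 0 2 * M 2 0) +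
      (M 1 1 * M 2 2 - M 1 2 * M 2 1) := by
  rw [trace_fin_three, adjugate_fin_three]
  simp
  ring

theorem det_sub_smul3 (M : Matrix (Fin 3) (Fin 3) ℝ) (x : ℝ) :
    (M - x • (1 : Matrix (Fin 3) (Fin 3) ℝ)).det =
      M.det - x * M.adjugate.trace + x ^ 2 * M.trace - x ^ 3 := by
  rw [adj_trace3, det_fin_three, det_fin_three, trace_fin_three]
  simp [Matrix.sub_apply, Matrix.smul_apply, Matrix.one_apply]
  ring

theorem det_sub_one3 (M : Matrix (Fin 3) (Fin 3) ℝ) :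
    (M - 1).det = M.det - M.adjugate.trace + M.trace - 1 := by
  have := det_sub_smul3 M 1
  rw [one_smul] at this
  rw [this]; ring

theorem trace_sq3 (M : Matrix (Fin 3) (Fin 3) ℝ) :
    (M * M).trace = M.trace ^ 2 - 2 * M.adjugate.trace := by
  rw [adj_trace3, trace_fin_three, trace_fin_three, mul3, mul3, mul3]
  ring

theorem eigvec3 (M : Matrix (Fin 3) (Fin 3) ℝ) (x : ℝ)
    (h : (M - x • (1 : Matrix (Fin 3) (Fin 3) ℝ)).det = 0) :
    ∃ v, v ≠ 0 ∧ M.mulVec v = x • v := by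
  obtain ⟨v, hv, h⟩ := Matrix.exists_mulVec_eq_zero_iff.2 h
  refine ⟨v, hv, ?_⟩
  rw [sub_mulVec, smul_mulVec, one_mulVec, sub_eq_zero] at h
  exact h

theorem diag3 (M : Matrix (Fin 3) (Fin 3) ℝ) (l : ℝ) (hl : 1 < l) (u v w : Fin 3 → ℝ)
    (hu : u ≠ 0) (hv : v ≠ 0) (hw : w ≠ 0) (h1 : M.mulVec u = u) (h2 : M.mulVec v = l • v)
    (h3 : M.mulVec w = l⁻¹ • w) :
    ∃ P Q : Matrix (Fin 3) (Fin 3) ℝ, P * Q = 1 ∧ Q * P = 1 ∧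
      P * M * Q = diagonal ![1, l, l⁻¹] ∧ Q.mulVec ![1, 0, 0] = u := by
  have hl0 : (0:ℝ) < l := by linarith
  have hli : l⁻¹ < 1 := inv_lt_one_of_one_lt₀ hl
  have hind : LinearIndependent ℝ ![u, v, w] := by
    apply Module.End.eigenvectors_linearIndependent' (Matrix.toLin' M) ![1, l, l⁻¹]
    · intro i j hij
      fin_cases i <;> fin_cases j <;> simp at hij ⊢ <;> (exfalso; linarith)
    · intro i
      rw [Module.End.hasEigenvector_iff, Module.End.mem_eigenspace_iff]
      fin_cases i
      · exact ⟨by simpa using h1, hu⟩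
      · exact ⟨by simpa using h2, hv⟩
      · exact ⟨by simpa using h3, hw⟩
  let Q : Matrix (Fin 3) (Fin 3) ℝ := of fun i j => ![u, v, w] j i
  have hQ : IsUnit Q := by
    rw [← Matrix.linearIndependent_cols_iff_isUnit]
    exact hind
  have hQd : IsUnit Q.det := (Matrix.isUnit_iff_isUnit_det Q).1 hQ
  have hMQ : M * Q = Q * diagonal ![1, l, l⁻¹] := by
    ext i j
    rw [Matrix.mul_diagonal]
    have : (M * Q) i j = M.mulVec (![u, v, w] j) i := rfl
    rw [this]
    fin_cases j
    · have := congrFun h1 i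
      simpa [Q] using this
    · have := congrFun h2 i
      simp [Q] at this ⊢
      rw [this, mul_comm]
    · have := congrFun h3 i
      simp [Q] at this ⊢
      rw [this, mul_comm]
  refine ⟨Q⁻¹, Q, Matrix.nonsing_inv_mul _ hQd, Matrix.mul_nonsing_inv _ hQd, ?_, ?_⟩
  · rw [mul_assoc, hMQ, ← mul_assoc, Matrix.nonsing_inv_mul _ hQd, one_mul]
  · apply funext; intro i
    rw [mulVec3]
    simp [Q]

theorem hypDiag (M : Matrix (Fin 3) (Fin 3) ℝ) (hd : M.det = 1) (hF : (M - 1).det = 0)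
    (ht : 3 < M.trace) (u : Fin 3 → ℝ) (hu : u ≠ 0) (h1 : M.mulVec u = u) :
    ∃ l : ℝ, 1 < l ∧ ∃ P Q : Matrix (Fin 3) (Fin 3) ℝ, P * Q = 1 ∧ Q * P = 1 ∧
      P * M * Q = diagonal ![1, l, l⁻¹] ∧ Q.mulVec ![1, 0, 0] = u := by
  rw [det_sub_one3, hd] at hF
  set t := M.trace - 1 with htt
  have ht2 : 2 < t := by rw [htt]; linarith
  have hs : 0 < t ^ 2 - 4 := by nlinarith
  have hsq := Real.sq_sqrt hs.le
  set s := √(t ^ 2 - 4) with hsd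
  have hs0 : 0 ≤ s := Real.sqrt_nonneg _
  set l := (t + s) / 2 with hl
  have hl1 : 1 < l := by rw [hl]; linarith
  have hq : l ^ 2 - t * l + 1 = 0 := by rw [hl]; linear_combination hsq / 4
  have hl0 : l ≠ 0 := by linarith
  have hq' : (l⁻¹) ^ 2 - t * l⁻¹ + 1 = 0 := by
    field_simp; linear_combination hq
  have hroot : ∀ x : ℝ, x ^ 2 - t * x + 1 = 0 →
      (M - x • (1 : Matrix (Fin 3) (Fin 3) ℝ)).det = 0 := by
    intro x hx
    rw [det_sub_smul3, hd]
    rw [htt] at hx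
    linear_combination (-(x - 1)) * hx + x * hF
  obtain ⟨v, hv, hv'⟩ := eigvec3 M l (hroot l hq)
  obtain ⟨w, hw, hw'⟩ := eigvec3 M l⁻¹ (hroot _ hq')
  exact ⟨l, hl1, diag3 M l hl1 u v w hu hv hw h1 hv' hw'⟩

namespace AffP

variable {Γ : Type*} [Group Γ] {A : Γ →* Matrix (Fin 3) (Fin 3) ℝ} {b : Γ → Fin 3 → ℝ}

theorem line_hyp_shape (h : AffP A b) (hA : ∀ γ, A γ 1 0 = 0 ∧ A γ 2 0 = 0) (γ : Γ) (l α : ℝ)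
    (hl : 1 < l) (hγ : A γ = diagonal ![1, l, l⁻¹]) (hb : b γ = ![α, 0, 0]) (k : Γ)
    (hk : A k 0 0 = 1) : A k 1 2 = 0 := by
  by_contra hne
  have hl0 : (0:ℝ) < l := by linarith
  have hli : l⁻¹ ≤ 1 := inv_le_one_of_one_le₀ hl.le
  have hpow : ∀ n : ℕ, A (γ ^ n) = diagonal ![1, l ^ n, (l⁻¹) ^ n] := by
    intro n
    rw [map_pow, hγ, Matrix.diagonal_pow]
    congr 1
    ext i; fin_cases i <;> simp
  have hact1 : ∀ x y z : ℝ, affAct A b γ ![x, y, z] = ![x + α, l * y, l⁻¹ * z] := by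
    intro x y z
    rw [affAct, hγ, hb]
    ext i
    rw [Pi.add_apply, mulVec_diagonal]
    fin_cases i <;> simp
  have hact : ∀ (n : ℕ) (x y z : ℝ), affAct A b (γ ^ n) ![x, y, z] =
      ![x + n * α, l ^ n * y, (l⁻¹) ^ n * z] := by
    intro n
    induction n with
    | zero => intro x y z; rw [pow_zero, h.act_one]; simp
    | succ n ih =>
      intro x y z
      rw [pow_succ, h.act_mul, hact1, ih]
      congr 1
      · push_cast; ring
      congr 1
      · ring
      congr 1
      ring
  set s := - b k 1 / A k 1 2 with hs
  have hs' : A k 1 2 * s + b k 1 = 0 := by rw [hs]; field_simp; ring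
  have hkz : ∀ n : ℕ, affAct A b k ![-(n * α), 0, s] =
      ![-(n * α) + (A k 0 2 * s + b k 0), 0, A k 2 2 * s + b k 2] := by
    intro n
    obtain ⟨z1, z2⟩ := hA k
    apply vext3
    · rw [affAct, Pi.add_apply, mulVec3, hk]; simp; ring
    · rw [affAct, Pi.add_apply, mulVec3, z1]; simp; linarith
    · rw [affAct, Pi.add_apply, mulVec3, z2]; simp
  have hpb : ∀ n : ℕ, |(l⁻¹) ^ n| ≤ 1 := by
    intro n
    rw [abs_of_nonneg (by positivity)]
    exact pow_le_one₀ (by positivity) hli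
  have hfin : (Set.range fun n : ℕ => γ ^ n * k * (γ ^ n)⁻¹).Finite := by
    refine h.finite_of_bdd _ (|s|) (|A k 0 2 * s + b k 0| + |A k 2 2 * s + b k 2|) ?_
    rintro _ ⟨n, rfl⟩
    refine ⟨affAct A b (γ ^ n) ![-(n * α), 0, s], ?_, ?_⟩
    · rw [hact, pi_norm_le_iff_of_nonneg (abs_nonneg _)]
      intro i
      fin_cases i
      · simp
      · simp
      · change |(l⁻¹) ^ n * s| ≤ |s|
        rw [abs_mul]
        exact mul_le_of_le_one_left (abs_nonneg _) (hpb n)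
    · rw [← h.act_mul, inv_mul_cancel_right, h.act_mul, hkz, hact,
        pi_norm_le_iff_of_nonneg (by positivity)]
      intro i
      fin_cases i
      · simp
      · simp; positivity
      · change |(l⁻¹) ^ n * _| ≤ _
        rw [abs_mul]
        exact (mul_le_of_le_one_left (abs_nonneg _) (hpb n)).trans (by simp)
  have hinj : Function.Injective fun n : ℕ => γ ^ n * k * (γ ^ n)⁻¹ := by
    intro m n hmn
    have key : ∀ n : ℕ, A (γ ^ n * k * (γ ^ n)⁻¹) 1 2 = l ^ n * l ^ n * A k 1 2 := by
      intro n
      have e : A (γ ^ n * k * (γ ^ n)⁻¹) * A (γ ^ n) = A (γ ^ n) * A k := by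
        rw [← map_mul, ← map_mul]; simp
      generalize A (γ ^ n * k * (γ ^ n)⁻¹) = X at e
      have e2 := congrFun (congrFun e 1) 2
      rw [hpow, Matrix.mul_diagonal, Matrix.diagonal_mul] at e2
      simp at e2
      field_simp at e2
      rw [e2]; ring
    have e := congrArg (fun g => A g 1 2) hmn
    simp only [key] at e
    have e3 := mul_right_cancel₀ hne e
    rw [← pow_add, ← pow_add] at e3
    have := pow_right_injective₀ hl0 hl.ne' e3
    omega
  exact Set.infinite_range_of_injective hinj hfin

theorem line_solv (h : AffP A b) (hA : ∀ γ, A γ 1 0 = 0 ∧ A γ 2 0 = 0) : Group.IsSolvable Γ := by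
  have hchi : ∀ g ∈ derivedSeries Γ 1, A g 0 0 = 1 := fun g hg =>
    der_one_of_comm (chiL A hA) 0 g hg
  have hdet : ∀ g ∈ derivedSeries Γ 1, (rhoL A hA g).det = 1 := fun g hg =>
    der_one_of_comm ((detMonoidHom).comp (rhoL A hA)) 0 g hg
  by_cases hyp : ∀ g ∈ derivedSeries Γ 1, |(rhoL A hA g).trace| ≤ 2
  · exact h.line_finish hA (sl2_dich _ _ hdet hyp)
  push Not at hyp
  obtain ⟨g, hg, hgt⟩ := hyp
  have hd := hdet g hg
  have h00 := hchi g hg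
  obtain ⟨z1, z2⟩ := hA g
  set M := A g with hM
  have hMe : M.mulVec ![1, 0, 0] = ![1, 0, 0] := by
    apply vext3 <;> rw [mulVec3] <;> simp [h00, z1, z2]
  have he : (![1, 0, 0] : Fin 3 → ℝ) ≠ 0 := by
    intro h; have := congrFun h 0; simp at this
  have hF : ∀ N : Matrix (Fin 3) (Fin 3) ℝ, N.mulVec ![1, 0, 0] = ![1, 0, 0] → (N - 1).det = 0 := by
    intro N hN
    refine Matrix.exists_mulVec_eq_zero_iff.1 ⟨_, he, ?_⟩
    rw [sub_mulVec, one_mulVec, hN, sub_self]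
  have hMd : M.det = 1 := by
    have e : (rhoL A hA g).det = M 1 1 * M 2 2 - M 1 2 * M 2 1 := by
      rw [det_fin_two]; rfl
    rw [e] at hd
    rw [det_fin_three, h00, z1, z2]; linarith
  have ht : M.trace = 1 + (rhoL A hA g).trace := by
    rw [trace_fin_three, trace_fin_two, h00, add_assoc]; rfl
  have hMM : (M * M).mulVec ![1, 0, 0] = ![1, 0, 0] := by rw [← mulVec_mulVec, hMe, hMe]
  have hadj := hF M hMe
  rw [det_sub_one3, hMd] at hadj
  have htr : 3 < (M * M).trace := by
    rw [trace_sq3]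
    have h4 : 2 ^ 2 < (rhoL A hA g).trace ^ 2 := by
      rw [← sq_abs (rhoL A hA g).trace]; gcongr
    have : M.adjugate.trace = M.trace := by linarith
    rw [this, ht]; nlinarith
  obtain ⟨l, hl, P, Q, hPQ, hQP, hdiag, hQ⟩ := hypDiag (M * M) (by rw [det_mul, hMd, one_mul])
    (hF _ hMM) htr _ he hMM
  have h' := h.conj P Q hPQ hQP
  set A' := conjHom A P Q hPQ hQP with hA'
  set b' := fun γ => P.mulVec (b γ)
  have hgg : A' (g * g) = diagonal ![1, l, l⁻¹] := by
    rw [← hdiag, hM, ← map_mul]; rfl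
  have hP : P.mulVec ![1, 0, 0] = ![1, 0, 0] := by
    rw [← hQ, mulVec_mulVec, hPQ, one_mulVec, hQ]
  have hA'1 : ∀ γ, A' γ 1 0 = 0 ∧ A' γ 2 0 = 0 := by
    intro γ
    have e1 : (A γ).mulVec ![1, 0, 0] = A γ 0 0 • ![1, 0, 0] := by
      obtain ⟨z1, z2⟩ := hA γ
      apply vext3 <;> rw [mulVec3] <;> simp [z1, z2]
    have e : (A' γ).mulVec ![1, 0, 0] = A γ 0 0 • ![1, 0, 0] := by
      change (P * A γ * Q).mulVec _ = _
      rw [← mulVec_mulVec, hQ, ← mulVec_mulVec, e1, mulVec_smul, hP]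
    have f1 := congrFun e 1
    have f2 := congrFun e 2
    rw [mulVec3] at f1 f2
    simp at f1 f2
    exact ⟨f1, f2⟩
  have hl1 : l - 1 ≠ 0 := by linarith
  have hl2 : l⁻¹ - 1 ≠ 0 := by
    have := inv_lt_one_of_one_lt₀ hl
    linarith
  have h'' := h'.trans ![0, - b' (g * g) 1 / (l - 1), - b' (g * g) 2 / (l⁻¹ - 1)]
  have hchi' : ∀ g ∈ derivedSeries Γ 1, A' g 0 0 = 1 := fun g hg =>
    der_one_of_comm (chiL A' hA'1) 0 g hg
  have hshape := h''.line_hyp_shape hA'1 (g * g) l (b' (g * g) 0) hl hgg (by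
    rw [hgg]
    have e1 : b' (g * g) 1 + l * (-b' (g * g) 1 / (l - 1)) - (-b' (g * g) 1 / (l - 1)) = 0 := by
      field_simp; ring
    have e2 : b' (g * g) 2 + l⁻¹ * (-b' (g * g) 2 / (l⁻¹ - 1)) -
        (-b' (g * g) 2 / (l⁻¹ - 1)) = 0 := by
      generalize l⁻¹ = m at hl2
      field_simp; ring
    apply vext3 <;> rw [Pi.sub_apply, Pi.add_apply, mulVec_diagonal]
    · simp
    · exact e1
    · exact e2)
  refine h''.line_finish hA'1 (Or.inl ⟨![0, 1], ?_, ?_⟩)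
  · intro h; have := congrFun h 1; simp at this
  · intro k hk
    refine ⟨A' k 2 2, ?_⟩
    have e := hshape k (hchi' k hk)
    ext i; fin_cases i
    · change (rhoL A' hA'1 k).mulVec ![0, 1] 0 = A' k 2 2 * 0
      rw [mulVec2]
      change A' k 1 1 * 0 + A' k 1 2 * 1 = _
      rw [e]; ring
    · change (rhoL A' hA'1 k).mulVec ![0, 1] 1 = A' k 2 2 * 1
      rw [mulVec2]
      change A' k 2 1 * 0 + A' k 2 2 * 1 = _
      ring

end AffP

end

section

open Matrix

theorem exists_conj_vec (x v : Fin 3 → ℝ) (hx : x ≠ 0) (hv : v ≠ 0) :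
    ∃ P Q : Matrix (Fin 3) (Fin 3) ℝ, P * Q = 1 ∧ Q * P = 1 ∧ Q.mulVec x = v := by
  obtain ⟨f, hf⟩ := SeparatingDual.exists_continuousLinearEquiv_apply_eq (R := ℝ) hx hv
  refine ⟨LinearMap.toMatrix' (f.symm.toLinearEquiv : (Fin 3 → ℝ) →ₗ[ℝ] (Fin 3 → ℝ)),
    LinearMap.toMatrix' (f.toLinearEquiv : (Fin 3 → ℝ) →ₗ[ℝ] (Fin 3 → ℝ)), ?_, ?_, ?_⟩
  · rw [← LinearMap.toMatrix'_comp, ← LinearMap.toMatrix'_id]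
    congr 1
    ext; simp
  · rw [← LinearMap.toMatrix'_comp, ← LinearMap.toMatrix'_id]
    congr 1
    ext; simp
  · rw [LinearMap.toMatrix'_mulVec]
    exact hf

namespace AffP

variable {Γ : Type*} [Group Γ] {A : Γ →* Matrix (Fin 3) (Fin 3) ℝ} {b : Γ → Fin 3 → ℝ}

theorem solv_of_line (h : AffP A b) (v : Fin 3 → ℝ) (hv : v ≠ 0)
    (hA : ∀ γ, ∃ c : ℝ, (A γ).mulVec v = c • v) : Group.IsSolvable Γ := by
  have he : (![1, 0, 0] : Fin 3 → ℝ) ≠ 0 := by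
    intro h; have := congrFun h 0; simp at this
  obtain ⟨P, Q, hPQ, hQP, hQ⟩ := exists_conj_vec _ v he hv
  refine (h.conj P Q hPQ hQP).line_solv ?_
  intro γ
  obtain ⟨c, hc⟩ := hA γ
  have e : (conjHom A P Q hPQ hQP γ).mulVec ![1, 0, 0] = c • ![1, 0, 0] := by
    change (P * A γ * Q).mulVec _ = _
    rw [← mulVec_mulVec, hQ, ← mulVec_mulVec, hc, mulVec_smul, ← hQ, mulVec_mulVec, hPQ,
      one_mulVec]
  have f1 := congrFun e 1
  have f2 := congrFun e 2
  rw [mulVec3] at f1 f2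
  simp at f1 f2
  exact ⟨f1, f2⟩

theorem solv_of_coline (h : AffP A b) (v : Fin 3 → ℝ) (hv : v ≠ 0)
    (hA : ∀ γ, ∃ c : ℝ, v ᵥ* (A γ) = c • v) : Group.IsSolvable Γ := by
  have he : (![0, 0, 1] : Fin 3 → ℝ) ≠ 0 := by
    intro h; have := congrFun h 2; simp at this
  obtain ⟨Q, P, hQP, hPQ, hP⟩ := exists_conj_vec _ v he hv
  have hPQ' : Pᵀ * Qᵀ = 1 := by rw [← transpose_mul, hQP, transpose_one]
  have hQP' : Qᵀ * Pᵀ = 1 := by rw [← transpose_mul, hPQ, transpose_one]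
  have hP' : ![0, 0, 1] ᵥ* Pᵀ = v := by rw [vecMul_transpose, hP]
  refine (h.conj _ _ hPQ' hQP').plane_solv ?_
  intro γ
  obtain ⟨c, hc⟩ := hA γ
  have e : ![0, 0, 1] ᵥ* (conjHom A _ _ hPQ' hQP' γ) = c • ![0, 0, 1] := by
    change _ ᵥ* (Pᵀ * A γ * Qᵀ) = _
    rw [← vecMul_vecMul, ← vecMul_vecMul, hP', hc, smul_vecMul, ← hP', vecMul_vecMul, hPQ',
      vecMul_one]
  have f1 := congrFun e 0
  have f2 := congrFun e 1
  simp [vecMul, dotProduct, Fin.sum_univ_three] at f1 f2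
  exact ⟨f1, f2⟩

theorem solv_of_sub (h : AffP A b) (W : Submodule ℝ (Fin 3 → ℝ)) (h0 : W ≠ ⊥) (h1 : W ≠ ⊤)
    (hA : ∀ γ, ∀ w ∈ W, (A γ).mulVec w ∈ W) : Group.IsSolvable Γ := by
  have hr := Submodule.finrank_lt h1
  rw [Module.finrank_fin_fun] at hr
  have hpos : 0 < Module.finrank ℝ W := by
    rw [Nat.pos_iff_ne_zero]
    exact fun h => h0 (Submodule.finrank_eq_zero.1 h)
  obtain ⟨w, hw, hw0⟩ := Submodule.exists_mem_ne_zero_of_ne_bot h0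
  rcases (by omega : Module.finrank ℝ W = 1 ∨ Module.finrank ℝ W = 2) with h2 | h2
  · refine h.solv_of_line w hw0 (fun γ => ?_)
    obtain ⟨c, hc⟩ := exists_smul_eq_of_finrank_eq_one h2 (x := (⟨w, hw⟩ : W))
      (by simpa [Subtype.ext_iff] using hw0) ⟨_, hA γ w hw⟩
    exact ⟨c, by simpa using (congrArg Subtype.val hc).symm⟩
  · obtain ⟨f, hf0, hf⟩ := Submodule.exists_le_ker_of_lt_top W (lt_top_iff_ne_top.2 h1)
    have hker : W = LinearMap.ker f := by
      apply Submodule.eq_of_le_of_finrank_le hf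
      rw [h2]
      have := Submodule.finrank_lt (s := LinearMap.ker f)
        (fun h => hf0 (LinearMap.ker_eq_top.1 h))
      rw [Module.finrank_fin_fun] at this
      omega
    set v : Fin 3 → ℝ := fun i => f (Pi.single i 1) with hv
    have hfv : ∀ x, f x = v ⬝ᵥ x := by
      intro x
      conv_lhs => rw [← Finset.univ_sum_single x, map_sum]
      refine Finset.sum_congr rfl (fun i _ => ?_)
      have : Pi.single i (x i) = x i • (Pi.single i 1 : Fin 3 → ℝ) := by
        rw [← Pi.single_smul, smul_eq_mul, mul_one]
      rw [this, map_smul, smul_eq_mul, mul_comm]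
    refine h.solv_of_coline v ?_ (fun γ => ?_)
    · intro h
      apply hf0
      ext x
      simp [hfv, h]
    · let g := f ∘ₗ (Matrix.toLin' (A γ))
      have hg : g ∈ Submodule.span ℝ (Set.range (fun _ : Fin 1 => f)) := by
        apply mem_span_of_iInf_ker_le_ker
        intro x hx
        have hx' : x ∈ W := by
          rw [hker]; simpa using hx
        have := hA γ x hx'
        rw [hker] at this
        exact this
      rw [Set.range_const, Submodule.mem_span_singleton] at hg
      obtain ⟨c, hc⟩ := hg
      refine ⟨c, ?_⟩
      ext i
      have e := LinearMap.congr_fun hc (Pi.single i 1)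
      have e2 : g (Pi.single i 1) = (v ᵥ* A γ) i := by
        change f ((Matrix.toLin' (A γ)) (Pi.single i 1)) = _
        rw [Matrix.toLin'_apply, hfv, dotProduct_mulVec, dotProduct_single_one]
      rw [← e2, ← e]
      rfl

end AffP

end

section

open Matrix

theorem cubic_root (d e t : ℝ) : ∃ x : ℝ, d - x * e + x ^ 2 * t - x ^ 3 = 0 := by
  set R := 1 + |d| + |e| + |t| with hR
  have hd := abs_nonneg d
  have he := abs_nonneg e
  have ht := abs_nonneg t
  have hR1 : 1 ≤ R := by linarith
  have hb : |d| + R * |e| + R ^ 2 * |t| < R ^ 3 := by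
    have h1 : |d| ≤ R ^ 2 * |d| := le_mul_of_one_le_left hd (one_le_pow₀ hR1)
    have h2 : R * |e| ≤ R ^ 2 * |e| := by
      apply mul_le_mul_of_nonneg_right _ he
      nlinarith
    have h3 : R ^ 3 = R ^ 2 + R ^ 2 * |d| + R ^ 2 * |e| + R ^ 2 * |t| := by
      rw [pow_succ]; nth_rewrite 2 [hR]; ring
    have : 0 < R ^ 2 := by positivity
    linarith
  have hc : Continuous fun x : ℝ => d - x * e + x ^ 2 * t - x ^ 3 := by fun_prop
  have hRe1 := mul_le_mul_of_nonneg_left (le_abs_self e) (by linarith : 0 ≤ R)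
  have hRe2 := mul_le_mul_of_nonneg_left (neg_abs_le e) (by linarith : 0 ≤ R)
  have hRt1 := mul_le_mul_of_nonneg_left (le_abs_self t) (by positivity : 0 ≤ R ^ 2)
  have hRt2 := mul_le_mul_of_nonneg_left (neg_abs_le t) (by positivity : 0 ≤ R ^ 2)
  have h := intermediate_value_univ R (-R) hc
  have := h (show (0:ℝ) ∈ _ from ⟨by
    linarith [le_abs_self d, neg_abs_le d], by
    have e1 : (-R) ^ 2 = R ^ 2 := by ring
    have e2 : (-R) ^ 3 = - R ^ 3 := by ring
    rw [e1, e2]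
    linarith [le_abs_self d, neg_abs_le d]⟩)
  obtain ⟨x, hx⟩ := this
  exact ⟨x, hx⟩

theorem real_eig (M : Matrix (Fin 3) (Fin 3) ℝ) : ∃ (c : ℝ) (v : Fin 3 → ℝ), v ≠ 0 ∧
    M.mulVec v = c • v := by
  obtain ⟨x, hx⟩ := cubic_root M.det M.adjugate.trace M.trace
  rw [← det_sub_smul3] at hx
  exact ⟨x, eigvec3 M x hx⟩

/-- irreducibility -/
def Irr {Γ : Type*} [Group Γ] (A : Γ →* Matrix (Fin 3) (Fin 3) ℝ) : Prop :=
  ∀ W : Submodule ℝ (Fin 3 → ℝ), (∀ γ, ∀ w ∈ W, (A γ).mulVec w ∈ W) → W = ⊥ ∨ W = ⊤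

theorem burnside {Γ : Type*} [Group Γ] (A : Γ →* Matrix (Fin 3) (Fin 3) ℝ) (hirr : Irr A) :
    Submodule.span ℝ (Set.range A) = ⊤ := by
  let B : Γ →* Module.End ℝ (Fin 3 → ℝ) :=
    { toFun := fun γ => Matrix.toLinAlgEquiv' (A γ)
      map_one' := by rw [map_one, map_one]
      map_mul' := fun x y => by rw [map_mul, map_mul] }
  have hB : ∀ γ v, B γ v = (A γ).mulVec v := fun γ v => rfl
  let S : Subalgebra ℝ (Module.End ℝ (Fin 3 → ℝ)) := Algebra.adjoin ℝ (Set.range B)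
  have hBS : ∀ γ, B γ ∈ S := fun γ => Algebra.subset_adjoin ⟨γ, rfl⟩
  have hS : ∀ s ∈ S, s ∈ Submodule.span ℝ (Set.range B) := by
    intro s hs
    have : s ∈ Subalgebra.toSubmodule S := hs
    rw [Algebra.adjoin_eq_span] at this
    have e : (Submonoid.closure (Set.range B) : Set (Module.End ℝ (Fin 3 → ℝ))) = Set.range B := by
      have : Set.range B = (MonoidHom.mrange B : Set _) := by simp
      rw [this, Submonoid.closure_eq]
    rwa [e] at this
  have hsub : ∀ N : Submodule S (Fin 3 → ℝ), N = ⊥ ∨ N = ⊤ := by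
    intro N
    rcases hirr (N.restrictScalars ℝ) (fun γ w hw => N.smul_mem ⟨B γ, hBS γ⟩ hw) with h | h
    · left
      exact (Submodule.restrictScalars_eq_bot_iff ℝ S _).1 h
    · right
      exact (Submodule.restrictScalars_eq_top_iff ℝ S _).1 h
  have hsimple : IsSimpleModule S (Fin 3 → ℝ) := by
    refine { eq_bot_or_eq_top := hsub, exists_pair_ne := ⟨⊥, ⊤, bot_ne_top⟩ }
  have hcomm : ∀ f : Module.End S (Fin 3 → ℝ), ∃ c : ℝ, ∀ v, f v = c • v := by
    intro f
    obtain ⟨c, v, hv, hcv⟩ := real_eig (LinearMap.toMatrix' (f.restrictScalars ℝ))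
    rw [LinearMap.toMatrix'_mulVec] at hcv
    let N : Submodule S (Fin 3 → ℝ) :=
      { carrier := {w | f w = c • w}
        zero_mem' := by simp
        add_mem' := by
          intro x y hx hy
          change f x = c • x at hx
          change f y = c • y at hy
          change f (x + y) = c • (x + y)
          rw [map_add, hx, hy, smul_add]
        smul_mem' := by
          intro s x hx
          change f x = c • x at hx
          change f (s • x) = c • (s • x)
          rw [map_smul, hx, smul_comm] }
    refine ⟨c, fun w => ?_⟩
    rcases hsub N with h | h
    · exfalso
      have : v ∈ N := hcv
      rw [h] at this
      exact hv this
    · have : w ∈ N := by rw [h]; trivial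
      exact this
  have hall : ∀ g : Module.End ℝ (Fin 3 → ℝ), g ∈ S := by
    intro g
    let g' : Module.End (Module.End S (Fin 3 → ℝ)) (Fin 3 → ℝ) :=
      { toFun := g
        map_add' := map_add g
        map_smul' := by
          intro f v
          obtain ⟨c, hc⟩ := hcomm f
          change g (f v) = f (g v)
          rw [hc, hc, map_smul] }
    obtain ⟨r, hr⟩ := jacobson_density (R := S) (M := Fin 3 → ℝ) g' (Finset.univ.image fun i : Fin 3 => Pi.single i (1:ℝ))
    have : g = r := by
      apply LinearMap.pi_ext'
      intro i
      ext
      have := hr (Pi.single i 1) (by simp)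
      have e : g (Pi.single i 1) = (r : Module.End ℝ (Fin 3 → ℝ)) (Pi.single i 1) := this
      simp [e]
    rw [this]; exact r.2
  rw [eq_top_iff]
  intro M _
  have h1 := hS _ (hall (Matrix.toLinAlgEquiv' M))
  have h2 : Set.range B = (Matrix.toLinAlgEquiv' (R := ℝ) (n := Fin 3)).toLinearMap '' Set.range A := by
    rw [← Set.range_comp]; rfl
  rw [h2, Submodule.span_image] at h1
  obtain ⟨N, hN, hNM⟩ := h1
  have : N = M := (Matrix.toLinAlgEquiv' (R := ℝ) (n := Fin 3)).injective hNM
  rwa [this] at hN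

/-- no solvable subgroup of finite index -/
def NVS (Γ : Type*) [Group Γ] : Prop := ∀ H : Subgroup Γ, H.index ≠ 0 → ¬ Group.IsSolvable H

namespace AffP

variable {Γ : Type*} [Group Γ] {A : Γ →* Matrix (Fin 3) (Fin 3) ℝ} {b : Γ → Fin 3 → ℝ}

theorem irr_restrict (h : AffP A b) (hn : NVS Γ) (H : Subgroup Γ) (hH : H.index ≠ 0) :
    Irr (A.comp H.subtype) := by
  intro W hW
  by_contra hcon
  push Not at hcon
  exact hn H hH ((h.restrict H).solv_of_sub W hcon.1 hcon.2 hW)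

theorem irr (h : AffP A b) (hn : NVS Γ) : Irr A := by
  intro W hW
  exact h.irr_restrict hn ⊤ (by simp) W (fun γ w hw => hW γ w hw)

theorem span_top (h : AffP A b) (hn : NVS Γ) : Submodule.span ℝ (Set.range A) = ⊤ :=
  burnside A (h.irr hn)

end AffP

end

section

open Matrix

theorem abs_det_of_pow (M : Matrix (Fin 3) (Fin 3) ℝ) (n : ℕ) (hn : n ≠ 0) (h : M ^ n = 1) :
    |M.det| = 1 := by
  have h1 : |M.det| ^ n = 1 := by rw [← abs_pow, ← det_pow, h, det_one, abs_one]
  exact (pow_eq_one_iff_of_nonneg (abs_nonneg _) hn).1 h1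

theorem abs_trace_of_pow (M : Matrix (Fin 3) (Fin 3) ℝ) (n : ℕ) (hn : n ≠ 0) (h : M ^ n = 1) :
    |M.trace| ≤ 3 := by
  set N : Matrix (Fin 3) (Fin 3) ℂ := M.map (algebraMap ℝ ℂ) with hN
  have hNn : N ^ n = 1 := by
    have : N = (algebraMap ℝ ℂ).mapMatrix M := rfl
    rw [this, ← map_pow, h, map_one]
  have htr : N.trace = (M.trace : ℂ) := by
    simp [hN, Matrix.trace_fin_three]
  have h1 := Matrix.trace_eq_sum_roots_charpoly N
  have h2 : ∀ z ∈ N.charpoly.roots, ‖z‖ ≤ 1 := by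
    intro z hz
    rw [Polynomial.mem_roots (Matrix.charpoly_monic N).ne_zero] at hz
    have hz' := (Matrix.mem_spectrum_iff_isRoot_charpoly).2 hz
    have hz2 := spectrum.pow_mem_pow N n hz'
    rw [hNn] at hz2
    rw [spectrum.one_eq, Set.mem_singleton_iff] at hz2
    have h3 : ‖z‖ ^ n = 1 := by rw [← norm_pow, hz2, norm_one]
    exact ((pow_eq_one_iff_of_nonneg (norm_nonneg _) hn).1 h3).le
  have hcard : N.charpoly.roots.card ≤ 3 := by
    refine (Polynomial.card_roots' _).trans ?_
    rw [Matrix.charpoly_natDegree_eq_dim]; simp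
  have h4 : ‖N.trace‖ ≤ 3 := by
    rw [h1]
    refine (norm_multiset_sum_le _).trans ?_
    refine (Multiset.sum_le_card_nsmul _ 1 ?_).trans ?_
    · intro x hx
      obtain ⟨z, hz, rfl⟩ := Multiset.mem_map.1 hx
      exact h2 z hz
    · rw [Multiset.card_map, nsmul_eq_mul, mul_one]
      exact_mod_cast hcard
  rw [htr, Complex.norm_real] at h4
  exact h4

theorem one_mem_span_pow {E : Type*} [Ring E] [Algebra ℝ E] [FiniteDimensional ℝ E] (a : E)
    (ha : ∀ x, a * x = 0 → x = 0) (N : ℕ) :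
    (1 : E) ∈ Submodule.span ℝ {x | ∃ n, N ≤ n ∧ x = a ^ n} := by
  let V : ℕ → Submodule ℝ E := fun N => Submodule.span ℝ {x | ∃ n, N ≤ n ∧ x = a ^ n}
  have hle : ∀ N, V (N + 1) ≤ V N := by
    intro N
    apply Submodule.span_mono
    rintro _ ⟨n, hn, rfl⟩
    exact ⟨n, by omega, rfl⟩
  have hmap : ∀ N, (V N).map (LinearMap.mulLeft ℝ a) = V (N + 1) := by
    intro N
    rw [Submodule.map_span]
    congr 1
    ext x
    constructor
    · rintro ⟨_, ⟨n, hn, rfl⟩, rfl⟩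
      exact ⟨n + 1, by omega, by simp [pow_succ']⟩
    · rintro ⟨n, hn, rfl⟩
      refine ⟨a ^ (n - 1), ⟨n - 1, by omega, rfl⟩, ?_⟩
      rw [LinearMap.mulLeft_apply, ← pow_succ']
      congr 1; omega
  have hinj : Function.Injective (LinearMap.mulLeft ℝ a) := by
    rw [← LinearMap.ker_eq_bot, LinearMap.ker_eq_bot']
    exact fun x hx => ha x hx
  have heq : ∀ N, V (N + 1) = V N := by
    intro N
    apply Submodule.eq_of_le_of_finrank_eq (hle N)
    rw [← hmap N]
    exact (LinearEquiv.finrank_eq (Submodule.equivMapOfInjective _ hinj _)).symm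
  have hall : ∀ N, V N = V 0 := by
    intro N
    induction N with
    | zero => rfl
    | succ n ih => rw [heq, ih]
  change 1 ∈ V N
  rw [hall]
  exact Submodule.subset_span ⟨0, le_rfl, (pow_zero a).symm⟩

/-- auxiliary algebra -/
abbrev E4 := Matrix (Fin 3) (Fin 3) ℝ × Matrix (Fin 3) (Fin 3) ℝ × ℝ × ℝ

theorem F_recur (g h : Matrix (Fin 3) (Fin 3) ℝ) (hh : h.det ≠ 0) (N : ℕ)
    (hF : ∀ n, N ≤ n → (g * h ^ n - 1).det = 0) : (g - 1).det = 0 := by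
  let a : E4 := (h, h.adjugate, h.det, 1)
  let ψ : E4 →ₗ[ℝ] ℝ :=
    { toFun := fun x => g.det * x.2.2.1 - (x.2.1 * g.adjugate).trace + (g * x.1).trace - x.2.2.2
      map_add' := by
        intro x y
        simp only [Prod.fst_add, Prod.snd_add, mul_add, add_mul, trace_add]
        ring
      map_smul' := by
        intro c x
        simp only [Prod.smul_fst, Prod.smul_snd, smul_eq_mul, Matrix.mul_smul, Matrix.smul_mul,
          trace_smul, RingHom.id_apply]
        ring }
  have ha : ∀ x, a * x = 0 → x = 0 := by
    rintro ⟨x1, x2, x3, x4⟩ hx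
    simp only [a, Prod.mk_mul_mk, Prod.mk_eq_zero] at hx
    obtain ⟨h1, h2, h3, h4⟩ := hx
    have hu : IsUnit h.det := isUnit_iff_ne_zero.2 hh
    have e1 : x1 = 0 := by
      calc x1 = h⁻¹ * (h * x1) := by rw [← mul_assoc, Matrix.nonsing_inv_mul _ hu, one_mul]
        _ = 0 := by rw [h1, mul_zero]
    have e2 : x2 = 0 := by
      have : h.det • x2 = 0 := by
        have e := congrArg (fun y => h * y) h2
        simp only [← mul_assoc, mul_adjugate, mul_zero] at e
        simpa using e
      exact (smul_eq_zero.1 this).resolve_left hh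
    have e3 : x3 = 0 := (mul_eq_zero.1 h3).resolve_left hh
    have e4 : x4 = 0 := by simpa using h4
    simp [e1, e2, e3, e4]
  have hap : ∀ n, ψ (a ^ n) = (g * h ^ n - 1).det := by
    intro n
    have : a ^ n = (h ^ n, h.adjugate ^ n, h.det ^ n, 1 ^ n) := rfl
    rw [this, det_sub_one3]
    change g.det * h.det ^ n - (h.adjugate ^ n * g.adjugate).trace + (g * h ^ n).trace - 1 ^ n = _
    rw [adjugate_mul_distrib, adjugate_pow, det_mul, det_pow, one_pow]
  have h1 := one_mem_span_pow a ha N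
  have hker : Submodule.span ℝ {x | ∃ n, N ≤ n ∧ x = a ^ n} ≤ LinearMap.ker ψ := by
    rw [Submodule.span_le]
    rintro _ ⟨n, hn, rfl⟩
    rw [SetLike.mem_coe, LinearMap.mem_ker, hap, hF n hn]
  have h2 := hker h1
  rw [LinearMap.mem_ker] at h2
  have h3 := hap 0
  rw [pow_zero, h2, pow_zero, mul_one] at h3
  exact h3.symm

namespace AffP

variable {Γ : Type*} [Group Γ] {A : Γ →* Matrix (Fin 3) (Fin 3) ℝ} {b : Γ → Fin 3 → ℝ}

theorem det_ne (A : Γ →* Matrix (Fin 3) (Fin 3) ℝ) (γ : Γ) : (A γ).det ≠ 0 := by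
  intro h
  have := congrArg Matrix.det (mul_inv_A (A := A) γ)
  rw [det_mul, h, det_one] at this
  simp at this

theorem fin_facts (h : AffP A b) (γ : Γ) (hF : (A γ - 1).det ≠ 0) :
    ∃ n : ℕ, n ≠ 0 ∧ A γ ^ n = 1 := by
  obtain ⟨n, hn, hg⟩ := isOfFinOrder_iff_pow_eq_one.1 (h.finOrder_of_det γ hF)
  exact ⟨n, hn.ne', by rw [← map_pow, hg, map_one]⟩

theorem F_zero_of_det (h : AffP A b) (k : Γ) (hk : |(A k).det| ≠ 1) (g : Γ) :
    (A g - 1).det = 0 := by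
  by_cases hex : ∃ N : ℕ, |(A (g * k ^ N)).det| = 1
  · obtain ⟨N, hN⟩ := hex
    refine F_recur (A g) (A k) (det_ne A k) (N + 1) (fun n hn => ?_)
    by_contra hcon
    rw [← map_pow, ← map_mul] at hcon
    obtain ⟨m, hm, hp⟩ := h.fin_facts _ hcon
    have h1 := abs_det_of_pow _ m hm hp
    rw [map_mul, det_mul, abs_mul, map_pow, det_pow, abs_pow] at h1 hN
    obtain ⟨j, rfl⟩ : ∃ j, n = N + j := ⟨n - N, by omega⟩
    rw [pow_add, ← mul_assoc, hN, one_mul] at h1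
    exact hk ((pow_eq_one_iff_of_nonneg (abs_nonneg _) (by omega)).1 h1)
  · push Not at hex
    refine F_recur (A g) (A k) (det_ne A k) 0 (fun n hn => ?_)
    by_contra hcon
    rw [← map_pow, ← map_mul] at hcon
    obtain ⟨m, hm, hp⟩ := h.fin_facts _ hcon
    exact hex n (abs_det_of_pow _ m hm hp)

end AffP

end

section

open Matrix

/-- the cofactor representation -/
def cofHom {Γ : Type*} [Group Γ] (A : Γ →* Matrix (Fin 3) (Fin 3) ℝ) :
    Γ →* Matrix (Fin 3) (Fin 3) ℝ where
  toFun γ := (A γ).adjugateᵀ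
  map_one' := by rw [map_one, adjugate_one, transpose_one]
  map_mul' := fun x y => by rw [map_mul, adjugate_mul_distrib, transpose_mul]

theorem cof_span {Γ : Type*} [Group Γ] (A : Γ →* Matrix (Fin 3) (Fin 3) ℝ)
    (hs : Submodule.span ℝ (Set.range A) = ⊤) : Submodule.span ℝ (Set.range (cofHom A)) = ⊤ := by
  have h1 : ∀ γ, (A γ)ᵀ ∈ Submodule.span ℝ (Set.range (cofHom A)) := by
    intro γ
    have hd := AffP.det_ne A γ⁻¹
    have e : (A γ)ᵀ = ((A γ⁻¹).det)⁻¹ • cofHom A γ⁻¹ := by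
      rw [eq_inv_smul_iff₀ hd]
      change _ = (A γ⁻¹).adjugateᵀ
      rw [← transpose_smul]
      congr 1
      calc (A γ⁻¹).det • A γ = ((A γ⁻¹).adjugate * A γ⁻¹) * A γ := by
            rw [adjugate_mul, smul_mul, one_mul]
        _ = (A γ⁻¹).adjugate := by rw [mul_assoc, AffP.inv_mul_A, mul_one]
    rw [e]
    exact Submodule.smul_mem _ _ (Submodule.subset_span ⟨_, rfl⟩)
  rw [eq_top_iff]
  intro M _
  have hM : Mᵀ ∈ Submodule.span ℝ (Set.range A) := by rw [hs]; trivial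
  have : ∀ N ∈ Submodule.span ℝ (Set.range A),
      Nᵀ ∈ Submodule.span ℝ (Set.range (cofHom A)) := by
    intro N hN
    induction hN using Submodule.span_induction with
    | mem x hx => obtain ⟨γ, rfl⟩ := hx; exact h1 γ
    | zero => simp
    | add x y _ _ hx hy => rw [transpose_add]; exact Submodule.add_mem _ hx hy
    | smul c x _ hx => rw [transpose_smul]; exact Submodule.smul_mem _ _ hx
  simpa using this _ hM

theorem char_lemma {Γ : Type*} [Group Γ] (A : Γ →* Matrix (Fin 3) (Fin 3) ℝ) (hirr : Irr A)
    (hF : ∀ γ, (A γ - 1).det = 0) : ∃ P : Matrix (Fin 3) (Fin 3) ℝ, P.det ≠ 0 ∧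
      ∀ γ, (A γ).det = 1 ∧ (A γ)ᵀ * P * A γ = P := by
  have hsp := burnside A hirr
  have hspC := cof_span A hsp
  let σ : Γ → E4 := fun γ => (A γ, cofHom A γ, 1, (A γ).det)
  have hσ : ∀ x y, σ x * σ y = σ (x * y) := by
    intro x y
    simp only [σ, Prod.mk_mul_mk, map_mul, det_mul, mul_one]
  let S : Submodule ℝ E4 := Submodule.span ℝ (Set.range σ)
  have hSm : ∀ x ∈ S, ∀ y ∈ S, x * y ∈ S := by
    intro x hx y hy
    have h1 : S * S ≤ S := by
      rw [Submodule.span_mul_span]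
      apply Submodule.span_mono
      rintro _ ⟨_, ⟨a, rfl⟩, _, ⟨c, rfl⟩, rfl⟩
      exact ⟨a * c, (hσ a c).symm⟩
    exact h1 (Submodule.mul_mem_mul hx hy)
  let ψ : E4 →ₗ[ℝ] ℝ :=
    { toFun := fun x => x.2.2.2 - x.2.1.trace + x.1.trace - x.2.2.1
      map_add' := by
        intro x y
        simp only [Prod.fst_add, Prod.snd_add, trace_add]
        ring
      map_smul' := by
        intro c x
        simp only [Prod.smul_fst, Prod.smul_snd, smul_eq_mul,
          trace_smul, RingHom.id_apply]
        ring }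
  have hψ : ∀ x ∈ S, ψ x = 0 := by
    have : S ≤ LinearMap.ker ψ := by
      rw [Submodule.span_le]
      rintro _ ⟨γ, rfl⟩
      have h1 := hF γ
      rw [det_sub_one3] at h1
      rw [SetLike.mem_coe, LinearMap.mem_ker]
      change (A γ).det - ((A γ).adjugateᵀ).trace + (A γ).trace - 1 = 0
      rw [trace_transpose]
      exact h1
    exact fun x hx => this hx
  have hX : ∀ X : Matrix (Fin 3) (Fin 3) ℝ, ∃ Y a d, ((X, Y, a, d) : E4) ∈ S := by
    intro X
    have hX : X ∈ Submodule.span ℝ (Set.range A) := by rw [hsp]; trivial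
    induction hX using Submodule.span_induction with
    | mem x hx => obtain ⟨γ, rfl⟩ := hx; exact ⟨_, _, _, Submodule.subset_span ⟨γ, rfl⟩⟩
    | zero => exact ⟨0, 0, 0, S.zero_mem⟩
    | add x y _ _ hx hy =>
      obtain ⟨a1, a2, a3, ha⟩ := hx
      obtain ⟨b1, b2, b3, hb⟩ := hy
      exact ⟨_, _, _, S.add_mem ha hb⟩
    | smul c x _ hx =>
      obtain ⟨a1, a2, a3, ha⟩ := hx
      exact ⟨_, _, _, S.smul_mem c ha⟩
  have hY : ∀ Y : Matrix (Fin 3) (Fin 3) ℝ, ∃ X a d, ((X, Y, a, d) : E4) ∈ S := by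
    intro Y
    have hY : Y ∈ Submodule.span ℝ (Set.range (cofHom A)) := by rw [hspC]; trivial
    induction hY using Submodule.span_induction with
    | mem x hx => obtain ⟨γ, rfl⟩ := hx; exact ⟨_, _, _, Submodule.subset_span ⟨γ, rfl⟩⟩
    | zero => exact ⟨0, 0, 0, S.zero_mem⟩
    | add x y _ _ hx hy =>
      obtain ⟨a1, a2, a3, ha⟩ := hx
      obtain ⟨b1, b2, b3, hb⟩ := hy
      exact ⟨_, _, _, S.add_mem ha hb⟩
    | smul c x _ hx =>
      obtain ⟨a1, a2, a3, ha⟩ := hx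
      exact ⟨_, _, _, S.smul_mem c ha⟩
  have hK : ∀ Y a d, ((0, Y, a, d) : E4) ∈ S → Y = 0 := by
    intro Y a d hm
    by_contra hne
    obtain ⟨i, j, hij⟩ : ∃ i j, Y i j ≠ 0 := by
      by_contra hcon
      push Not at hcon
      exact hne (by ext i j; simp [hcon])
    have hs : ∀ p q, ∃ a d, ((0, Matrix.single p q 1, a, d) : E4) ∈ S := by
      intro p q
      obtain ⟨X1, a1, d1, h1⟩ := hY (Matrix.single p i 1)
      obtain ⟨X2, a2, d2, h2⟩ := hY (Matrix.single j q 1)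
      have h3 := S.smul_mem (Y i j)⁻¹ (hSm _ (hSm _ h1 _ hm) _ h2)
      rw [Prod.mk_mul_mk, Prod.mk_mul_mk, Prod.mk_mul_mk, Prod.mk_mul_mk, Prod.mk_mul_mk,
        Prod.mk_mul_mk, mul_zero, zero_mul, Prod.smul_mk, Prod.smul_mk, Prod.smul_mk,
        smul_zero] at h3
      have e : (Y i j)⁻¹ • (Matrix.single p i (1:ℝ) * Y * Matrix.single j q 1) =
          Matrix.single p q 1 := by
        rw [Matrix.single_mul_mul_single, Matrix.smul_single]
        congr 1
        simp [hij]
      rw [e] at h3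
      exact ⟨_, _, h3⟩
    obtain ⟨a1, d1, h1⟩ := hs 0 1
    obtain ⟨a2, d2, h2⟩ := hs 1 0
    obtain ⟨a3, d3, h3⟩ := hs 0 0
    have h4 := hSm _ (S.sub_mem (hSm _ h1 _ h2) (hSm _ h2 _ h1)) _ h3
    have h5 := hψ _ h4
    simp [ψ, mul_comm a2 a1, mul_comm d2 d1, sub_mul] at h5
  choose θ ta td hθ using hX
  have hθu : ∀ X Y a d, ((X, Y, a, d) : E4) ∈ S → Y = θ X := by
    intro X Y a d hm
    have h1 := S.sub_mem hm (hθ X)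
    rw [Prod.mk_sub_mk, Prod.mk_sub_mk, Prod.mk_sub_mk, sub_self] at h1
    exact sub_eq_zero.1 (hK _ _ _ h1)
  have hθm : ∀ X Y, θ (X * Y) = θ X * θ Y := fun X Y =>
    (hθu _ _ _ _ (hSm _ (hθ X) _ (hθ Y))).symm
  have hθa : ∀ X Y, θ (X + Y) = θ X + θ Y := fun X Y =>
    (hθu _ _ _ _ (S.add_mem (hθ X) (hθ Y))).symm
  have hθs : ∀ (c : ℝ) X, θ (c • X) = c • θ X := fun c X =>
    (hθu _ _ _ _ (S.smul_mem c (hθ X))).symm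
  have hθA : ∀ γ, θ (A γ) = cofHom A γ := fun γ =>
    (hθu _ _ _ _ (Submodule.subset_span ⟨γ, rfl⟩)).symm
  have hθ1 : θ 1 = 1 := by
    have := hθA 1
    rwa [map_one, map_one] at this
  let e : Fin 3 → Matrix (Fin 3) (Fin 3) ℝ := fun i => Matrix.single i 0 1
  have he0 : θ (e 0) ≠ 0 := by
    intro h0
    have hz : ∀ i, θ (Matrix.single i i 1) = 0 := by
      intro i
      have : Matrix.single i i (1:ℝ) = Matrix.single i 0 1 * e 0 * Matrix.single 0 i 1 := by
        simp [e]
      rw [this, hθm, hθm, h0, mul_zero, zero_mul]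
    have h1 : (1 : Matrix (Fin 3) (Fin 3) ℝ) = Matrix.single 0 0 1 + Matrix.single 1 1 1 +
        Matrix.single 2 2 1 := by
      apply ext3 <;> simp [Matrix.single, Matrix.one_apply]
    have h2 := hθ1
    rw [h1, hθa, hθa, hz, hz, hz] at h2
    rw [← h1] at h2
    have := congrFun (congrFun h2 0) 0
    simp at this
  obtain ⟨w, hw⟩ : ∃ w, (θ (e 0)).mulVec w ≠ 0 := by
    by_contra hcon
    push Not at hcon
    apply he0
    apply Matrix.ext_of_mulVec_single
    intro i
    rw [hcon, zero_mulVec]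
  let P : Matrix (Fin 3) (Fin 3) ℝ := of fun i j => (θ (e j)).mulVec w i
  have hPA : ∀ γ, P * A γ = cofHom A γ * P := by
    intro γ
    ext i j
    have e1 : A γ * e j = A γ 0 j • e 0 + A γ 1 j • e 1 + A γ 2 j • e 2 := by
      apply ext3 <;> fin_cases j <;> simp [e, mul3, Matrix.single]
    have e2 : (cofHom A γ * P) i j = (cofHom A γ * θ (e j)).mulVec w i := by
      rw [← mulVec_mulVec]; rfl
    rw [e2, ← hθA, ← hθm, e1, hθa, hθa, hθs, hθs, hθs, mul3, add_mulVec, add_mulVec, smul_mulVec,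
      smul_mulVec, smul_mulVec]
    simp only [P, of_apply, Pi.add_apply, Pi.smul_apply, smul_eq_mul]
    ring
  have hPd : P.det ≠ 0 := by
    intro hd
    obtain ⟨v, hv, hPv⟩ := Matrix.exists_mulVec_eq_zero_iff.2 hd
    rcases hirr (LinearMap.ker (Matrix.mulVecLin P)) (by
      intro γ x hx
      rw [LinearMap.mem_ker, mulVecLin_apply] at hx ⊢
      rw [mulVec_mulVec, hPA, ← mulVec_mulVec, hx, mulVec_zero]) with h | h
    · have : v ∈ LinearMap.ker (Matrix.mulVecLin P) := hPv
      rw [h] at this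
      exact hv this
    · apply hw
      have : (Pi.single 0 1 : Fin 3 → ℝ) ∈ LinearMap.ker (Matrix.mulVecLin P) := by rw [h]; trivial
      rw [LinearMap.mem_ker, mulVecLin_apply, mulVec_single_one] at this
      exact this
  have hu : IsUnit P.det := isUnit_iff_ne_zero.2 hPd
  refine ⟨P, hPd, fun γ => ?_⟩
  have htr : (A γ).adjugate.trace = (A γ).trace := by
    have e1 : cofHom A γ = P * A γ * P⁻¹ := by
      rw [hPA, mul_assoc, Matrix.mul_nonsing_inv _ hu, mul_one]
    have e2 : (cofHom A γ).trace = (A γ).adjugate.trace := trace_transpose _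
    rw [← e2, e1, trace_mul_comm, ← mul_assoc, Matrix.nonsing_inv_mul _ hu, one_mul]
  have h1 := hF γ
  rw [det_sub_one3, htr] at h1
  have hd : (A γ).det = 1 := by linarith
  refine ⟨hd, ?_⟩
  rw [mul_assoc, hPA, ← mul_assoc]
  change (A γ)ᵀ * (A γ).adjugateᵀ * P = P
  rw [← transpose_mul, adjugate_mul, hd, one_smul, transpose_one, one_mul]

end

section

open Matrix

theorem growth_zero (l a0 a1 a2 : ℝ) (hl : 1 < l)
    (h : ∀ N : ℕ, ∃ n, N ≤ n ∧ |a0 + a1 * l ^ n + a2 * (l⁻¹) ^ n| ≤ 3) : a1 = 0 := by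
  by_contra hne
  have hpos : 0 < |a1| := abs_pos.2 hne
  have ht := tendsto_pow_atTop_atTop_of_one_lt hl
  obtain ⟨N, hN⟩ := Filter.eventually_atTop.1
    (ht.eventually_gt_atTop ((3 + |a0| + |a2|) / |a1|))
  obtain ⟨n, hn, hb⟩ := h N
  have h1 := hN n hn
  rw [div_lt_iff₀ hpos] at h1
  have hl0 : (0:ℝ) < l := by linarith
  have hp : |(l⁻¹) ^ n| ≤ 1 := by
    rw [abs_of_nonneg (by positivity)]
    exact pow_le_one₀ (by positivity) (inv_le_one_of_one_le₀ hl.le)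
  have h2 : |a2 * (l⁻¹) ^ n| ≤ |a2| := by
    rw [abs_mul]; exact mul_le_of_le_one_right (abs_nonneg _) hp
  have h3 : |a1 * l ^ n| = l ^ n * |a1| := by
    rw [abs_mul, abs_of_pos (pow_pos hl0 n), mul_comm]
  have h4 : a1 * l ^ n = (a0 + a1 * l ^ n + a2 * (l⁻¹) ^ n) + (-a0) + (-(a2 * (l⁻¹) ^ n)) := by ring
  have h5 : |a1 * l ^ n| ≤ 3 + |a0| + |a2| := by
    rw [h4]
    refine (abs_add_three _ _ _).trans ?_
    rw [abs_neg, abs_neg]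
    linarith
  linarith

theorem mul_diag_mul (M N : Matrix (Fin 3) (Fin 3) ℝ) (d : Fin 3 → ℝ) (i j : Fin 3) :
    (M * diagonal d * N) i j = M i 0 * N 0 j * d 0 + M i 1 * N 1 j * d 1 + M i 2 * N 2 j * d 2 := by
  rw [mul3, mul_diagonal, mul_diagonal, mul_diagonal]; ring

namespace AffP

variable {Γ : Type*} [Group Γ] {A : Γ →* Matrix (Fin 3) (Fin 3) ℝ} {b : Γ → Fin 3 → ℝ}

theorem F_zero_diag (h : AffP A b) (hn : NVS Γ) (γ : Γ) (l : ℝ) (hl : 1 < l)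
    (hγ : A γ = diagonal ![1, l, l⁻¹]) (g : Γ) : (A g - 1).det = 0 := by
  have hpow : ∀ n : ℕ, A (γ ^ n) = diagonal ![1, l ^ n, (l⁻¹) ^ n] := by
    intro n
    rw [map_pow, hγ, Matrix.diagonal_pow]
    congr 1
    ext i; fin_cases i <;> simp
  have hinf : ∀ g : Γ, (A g - 1).det ≠ 0 → ∀ i : Γ, ∀ N : ℕ, ∃ n, N ≤ n ∧
      (A (g * (i * γ ^ n * i⁻¹)) - 1).det ≠ 0 := by
    intro g hg i N
    by_contra hcon
    push Not at hcon
    refine hg (F_recur (A g) (A (i * γ * i⁻¹)) (det_ne A _) N (fun n hn => ?_))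
    rw [← map_pow, ← map_mul, conj_pow]
    exact hcon n hn
  let R : Γ → Γ → Prop := Relation.ReflTransGen (fun i j => A (i⁻¹ * j) 1 1 ≠ 0)
  have hR : ∀ i j, R i j → ∀ g, (A g - 1).det ≠ 0 → A (j⁻¹ * g * i) 1 1 = 0 := by
    intro i j hij
    induction hij using Relation.ReflTransGen.head_induction_on with
    | refl =>
      intro g hg
      apply growth_zero l (A (j⁻¹ * g * j) 0 0) _ (A (j⁻¹ * g * j) 2 2) hl
      intro N
      obtain ⟨n, hn, hF⟩ := hinf g hg j N
      refine ⟨n, hn, ?_⟩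
      obtain ⟨m, hm, hp⟩ := h.fin_facts _ hF
      have h1 := abs_trace_of_pow _ m hm hp
      have h2 : (A (g * (j * γ ^ n * j⁻¹))).trace = (A (j⁻¹ * g * j) * A (γ ^ n)).trace := by
        rw [show g * (j * γ ^ n * j⁻¹) = (g * j * γ ^ n) * j⁻¹ by group, map_mul, trace_mul_comm,
          ← map_mul, ← map_mul]
        congr 2; group
      rw [h2, hpow, trace_fin_three, mul_diagonal, mul_diagonal, mul_diagonal] at h1
      simpa using h1
    | @head i k hik hkj ih =>
      intro g hg
      have : A (j⁻¹ * g * i) 1 1 * A (i⁻¹ * k) 1 1 = 0 := by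
        apply growth_zero l (A (j⁻¹ * g * i) 1 0 * A (i⁻¹ * k) 0 1) _
          (A (j⁻¹ * g * i) 1 2 * A (i⁻¹ * k) 2 1) hl
        intro N
        obtain ⟨n, hn, hF⟩ := hinf g hg i N
        refine ⟨n, hn, ?_⟩
        have h1 := ih _ hF
        rw [show j⁻¹ * (g * (i * γ ^ n * i⁻¹)) * k = (j⁻¹ * g * i) * γ ^ n * (i⁻¹ * k) by group,
          map_mul, map_mul A _ (γ ^ n), hpow, mul_diag_mul] at h1
        simp only [cons_val_zero, cons_val_one, cons_val] at h1
        rw [mul_one] at h1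
        rw [h1]; norm_num
      exact (mul_eq_zero.1 this).resolve_right hik
  by_contra hg
  let v : Γ → Fin 3 → ℝ := fun k => (A k).mulVec ![0, 1, 0]
  let φ : Γ → (Fin 3 → ℝ) →ₗ[ℝ] ℝ := fun k => (LinearMap.proj 1).comp (mulVecLin (A k⁻¹))
  have hφ : ∀ k x, φ k x = (A k⁻¹).mulVec x 1 := fun k x => rfl
  have hmulv : ∀ j k, (A j).mulVec (v k) = v (j * k) := by
    intro j k
    simp only [v]
    rw [mulVec_mulVec, ← map_mul]
  have hφv : ∀ i j, φ i (v j) = A (i⁻¹ * j) 1 1 := by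
    intro i j
    rw [hφ, hmulv]
    simp only [v]
    rw [mulVec3]
    simp
  let Y : Γ → Submodule ℝ (Fin 3 → ℝ) := fun i => ⨅ j, ⨅ (_ : R i j), LinearMap.ker (φ j)
  have hmemY : ∀ i x, x ∈ Y i ↔ ∀ j, R i j → φ j x = 0 := by
    intro i x
    simp only [Y, Submodule.mem_iInf, LinearMap.mem_ker]
  have hYmono : ∀ i j, R i j → Y i ≤ Y j := by
    intro i j hij x hx
    rw [hmemY] at hx ⊢
    exact fun m hm => hx m (hij.trans hm)
  have hReq : ∀ k i j, R i j → R (k * i) (k * j) := by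
    intro k i j hij
    refine Relation.ReflTransGen.lift (fun x => k * x) (fun a c hac => ?_) _ _ hij
    change A ((k * a)⁻¹ * (k * c)) 1 1 ≠ 0
    rwa [_root_.mul_inv_rev, show a⁻¹ * k⁻¹ * (k * c) = a⁻¹ * c by group]
  have hφeq : ∀ k j x, φ (k * j) ((A k).mulVec x) = φ j x := by
    intro k j x
    rw [hφ, hφ, mulVec_mulVec, ← map_mul]
    congr 3; group
  have hYeq : ∀ k i x, x ∈ Y i → (A k).mulVec x ∈ Y (k * i) := by
    intro k i x hx
    rw [hmemY] at hx ⊢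
    intro j hj
    have h1 := hx (k⁻¹ * j) (by
      have := hReq k⁻¹ _ _ hj
      rwa [inv_mul_cancel_left] at this)
    rw [← hφeq k, mul_inv_cancel_left] at h1
    exact h1
  have hinj : ∀ k, Function.Injective (mulVecLin (A k)) := by
    intro k x y hxy
    have := congrArg (A k⁻¹).mulVec (show (A k).mulVec x = (A k).mulVec y from hxy)
    rwa [mulVec_mulVec, mulVec_mulVec, inv_mul_A, one_mulVec, one_mulVec] at this
  have hfr1 : ∀ k i, Module.finrank ℝ (Y i) ≤ Module.finrank ℝ (Y (k * i)) := by
    intro k i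
    have h1 : (Y i).map (mulVecLin (A k)) ≤ Y (k * i) := by
      rintro _ ⟨x, hx, rfl⟩
      exact hYeq k i x hx
    have h2 := Submodule.finrank_mono h1
    rwa [← LinearEquiv.finrank_eq (Submodule.equivMapOfInjective _ (hinj k) _)] at h2
  have hfr : ∀ i j, Module.finrank ℝ (Y i) ≤ Module.finrank ℝ (Y j) := by
    intro i j
    have := hfr1 (j * i⁻¹) i
    rwa [inv_mul_cancel_right] at this
  have hYR : ∀ i j, R i j → Y i = Y j := fun i j hij =>
    Submodule.eq_of_le_of_finrank_le (hYmono i j hij) (hfr j i)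
  have hYv : ∀ i j, v j ∉ Y i → Y i = Y j := by
    intro i j hj
    rw [hmemY] at hj
    push Not at hj
    obtain ⟨m, hm, hmj⟩ := hj
    rw [hφv] at hmj
    exact hYR i j (hm.tail hmj)
  have hv0 : ∀ k, φ k (v k) = 1 := by
    intro k
    rw [hφv, inv_mul_cancel, map_one]; simp
  have hY1 : Y 1 ≠ ⊥ := by
    intro h0
    have h1 : v (g * 1) ∈ Y 1 := by
      rw [hmemY]
      intro j hj
      rw [hφv, ← mul_assoc]
      exact hR 1 j hj g hg
    rw [h0, Submodule.mem_bot] at h1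
    have := hv0 (g * 1)
    rw [h1, map_zero] at this
    exact zero_ne_one this
  have hYtop : Y 1 ≠ ⊤ := by
    intro h0
    have h1 : v 1 ∈ Y 1 := by rw [h0]; trivial
    rw [hmemY] at h1
    have := h1 1 Relation.ReflTransGen.refl
    rw [hv0] at this
    exact one_ne_zero this
  have hYtr : ∀ k i j, Y i = Y j → Y (k * i) = Y (k * j) := by
    have hle : ∀ k i j, Y i = Y j → Y (k * i) ≤ Y (k * j) := by
      intro k i j hij x hx
      have h1 := hYeq k⁻¹ _ x hx
      rw [inv_mul_cancel_left, hij] at h1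
      have h2 := hYeq k _ _ h1
      rwa [mulVec_mulVec, mul_inv_A, one_mulVec] at h2
    exact fun k i j hij => le_antisymm (hle k i j hij) (hle k j i hij.symm)
  let H : Subgroup Γ :=
    { carrier := {k | Y k = Y 1}
      one_mem' := rfl
      mul_mem' := by
        intro a c ha hc
        change Y a = Y 1 at ha
        change Y c = Y 1 at hc
        change Y (a * c) = Y 1
        rw [hYtr a c 1 hc, mul_one, ha]
      inv_mem' := by
        intro a ha
        change Y a = Y 1 at ha
        change Y a⁻¹ = Y 1
        have := hYtr a⁻¹ _ _ ha
        rw [inv_mul_cancel, mul_one] at this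
        exact this.symm }
  have hH : H.index ≠ 0 := by
    intro h0
    have hinf : Infinite (Γ ⧸ H) := by
      by_contra hfin
      rw [not_infinite_iff_finite] at hfin
      exact (Subgroup.index_ne_zero_of_finite (H := H)) h0
    let f : Fin 4 → Γ := fun i => Quotient.out (Infinite.natEmbedding (Γ ⧸ H) i)
    have hf : ∀ i j, Y (f i) = Y (f j) → i = j := by
      intro i j hij
      have h1 := hYtr (f i)⁻¹ _ _ hij
      rw [inv_mul_cancel] at h1
      have h2 : (f i)⁻¹ * f j ∈ H := h1.symm
      rw [← QuotientGroup.eq] at h2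
      simp only [f, QuotientGroup.out_eq'] at h2
      exact Fin.ext ((Infinite.natEmbedding (Γ ⧸ H)).injective h2)
    have hlin : LinearIndependent ℝ (fun i => v (f i)) := by
      rw [Fintype.linearIndependent_iff]
      intro c hc i
      have h1 := congrArg (φ (f i)) hc
      rw [map_sum, map_zero, Finset.sum_eq_single i] at h1
      · rwa [map_smul, hv0, smul_eq_mul, mul_one] at h1
      · intro j _ hji
        rw [map_smul]
        have h2 : v (f j) ∈ Y (f i) := by
          by_contra hcon
          exact hji (hf _ _ (hYv _ _ hcon)).symm
        rw [hmemY] at h2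
        rw [h2 _ Relation.ReflTransGen.refl, smul_zero]
      · simp
    have := hlin.fintype_card_le_finrank
    simp at this
  rcases h.irr_restrict hn H hH (Y 1) (by
    rintro ⟨k, hk⟩ w hw
    have h1 := hYeq k 1 w hw
    rw [mul_one] at h1
    change Y k = Y 1 at hk
    rw [hk] at h1
    exact h1) with h1 | h1
  · exact hY1 h1
  · exact hYtop h1

theorem exists_diag (h : AffP A b) (hdet : ∀ γ, |(A γ).det| = 1) (k : Γ)
    (hk : 3 < |(A k).trace|) : ∃ (γ : Γ) (l : ℝ) (P Q : Matrix (Fin 3) (Fin 3) ℝ), 1 < l ∧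
      P * Q = 1 ∧ Q * P = 1 ∧ P * A γ * Q = diagonal ![1, l, l⁻¹] := by
  have hF : (A k - 1).det = 0 := by
    by_contra hcon
    obtain ⟨m, hm, hp⟩ := h.fin_facts _ hcon
    have := abs_trace_of_pow _ m hm hp
    linarith
  have hd := hdet k
  have hF' := hF
  rw [det_sub_one3] at hF'
  obtain ⟨u, hu, hku⟩ := Matrix.exists_mulVec_eq_zero_iff.2 hF
  rw [sub_mulVec, one_mulVec, sub_eq_zero] at hku
  have htr : 3 < (A k * A k).trace := by
    rw [trace_sq3]
    have e : (A k).adjugate.trace = (A k).det + (A k).trace - 1 := by linarith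
    rw [e]
    have hd1 : (A k).det ≤ 1 := by rw [← hd]; exact le_abs_self _
    rcases lt_abs.1 hk with h1 | h1 <;> nlinarith
  obtain ⟨l, hl, P, Q, hPQ, hQP, hdg, -⟩ := hypDiag (A k * A k) (by
      rw [det_mul]
      rw [← abs_mul_abs_self, hd, one_mul]) (by
      have e : A k * A k - 1 = (A k - 1) * (A k + 1) := by noncomm_ring
      rw [e, det_mul, hF, zero_mul]) htr u hu (by rw [← mulVec_mulVec, hku, hku])
  refine ⟨k * k, l, P, Q, hl, hPQ, hQP, ?_⟩
  rw [map_mul]; exact hdg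

theorem F_conj (P Q : Matrix (Fin 3) (Fin 3) ℝ) (hPQ : P * Q = 1) (M : Matrix (Fin 3) (Fin 3) ℝ) :
    (P * M * Q - 1).det = (M - 1).det := by
  have e : P * M * Q - 1 = P * (M - 1) * Q := by
    rw [mul_sub, sub_mul, mul_one, hPQ]
  have h1 : P.det * Q.det = 1 := by rw [← det_mul, hPQ, det_one]
  rw [e, det_mul, det_mul]
  linear_combination (M - 1).det * h1

theorem F_zero_of_trace (h : AffP A b) (hn : NVS Γ) (hdet : ∀ γ, |(A γ).det| = 1) (k : Γ)
    (hk : 3 < |(A k).trace|) (g : Γ) : (A g - 1).det = 0 := by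
  obtain ⟨γ, l, P, Q, hl, hPQ, hQP, hdg⟩ := h.exists_diag hdet k hk
  have := (h.conj P Q hPQ hQP).F_zero_diag hn γ l hl hdg g
  rwa [← F_conj P Q hPQ]

end AffP

end

section

open Matrix

namespace AffP

variable {Γ : Type*} [Group Γ] {A : Γ →* Matrix (Fin 3) (Fin 3) ℝ} {b : Γ → Fin 3 → ℝ}

theorem infinite_range (h : AffP A b) (hn : NVS Γ) (hfin : (Set.range A).Finite) : False := by
  refine hn A.ker ?_ ?_
  · have : Finite (Γ ⧸ A.ker) := by
      have : Finite (Set.range A) := hfin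
      refine Finite.of_injective (β := Set.range A)
        (fun q => ⟨A (Quotient.out q), ⟨_, rfl⟩⟩) ?_
      intro p q hpq
      have h1 : A (Quotient.out p) = A (Quotient.out q) := congrArg Subtype.val hpq
      have h2 : (Quotient.out p)⁻¹ * Quotient.out q ∈ A.ker := by
        rw [MonoidHom.mem_ker, map_mul, ← h1, inv_mul_A]
      rw [← QuotientGroup.eq] at h2
      simpa only [QuotientGroup.out_eq'] using h2
    exact Subgroup.index_ne_zero_of_finite
  · refine (h.restrict A.ker).solv_of_comm_A 0 ?_
    rintro ⟨g, hg⟩ - ⟨k, hk⟩ -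
    change A g * A k = A k * A g
    rw [MonoidHom.mem_ker.1 hg, MonoidHom.mem_ker.1 hk]

theorem A_inj (h : AffP A b) (hn : NVS Γ) (t : Γ) (ht : A t = 1) : t = 1 := by
  by_contra hne
  have hb : b t ≠ 0 := fun h0 => hne (h.faith t ht h0)
  -- translations
  have hadd : ∀ s g, A s = 1 → b (s * g) = b s + b g := by
    intro s g hs
    rw [h.coc, hs, one_mulVec, add_comm]
  have hconj : ∀ k, A (k * t * k⁻¹) = 1 ∧ b (k * t * k⁻¹) = (A k).mulVec (b t) := by
    intro k
    refine ⟨by rw [map_mul, map_mul, ht, mul_one, mul_inv_A], ?_⟩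
    have e := h.coc k k⁻¹
    rw [mul_inv_cancel, h.b_one] at e
    rw [h.coc, h.coc, map_mul, ht, mul_one]
    rw [add_comm _ (b k), ← add_assoc, ← e, zero_add]
  let W : Submodule ℝ (Fin 3 → ℝ) := Submodule.span ℝ (Set.range fun k => (A k).mulVec (b t))
  have hW : W = ⊤ := by
    rcases h.irr hn W (by
      intro γ w hw
      induction hw using Submodule.span_induction with
      | mem x hx =>
        obtain ⟨k, rfl⟩ := hx
        exact Submodule.subset_span ⟨γ * k, by simp only [map_mul, mulVec_mulVec]⟩
      | zero => rw [mulVec_zero]; exact W.zero_mem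
      | add x y _ _ hx hy => rw [mulVec_add]; exact W.add_mem hx hy
      | smul c x _ hx => rw [mulVec_smul]; exact W.smul_mem c hx) with h0 | h0
    · exfalso
      have : b t ∈ W := Submodule.subset_span ⟨1, by simp only [map_one, one_mulVec]⟩
      rw [h0] at this
      exact hb this
    · exact h0
  -- every vector can be corrected by a translation
  have hred : ∀ x ∈ W, ∃ C : ℝ, ∀ r : ℝ, ∃ s, A s = 1 ∧ ‖b s + r • x‖ ≤ C := by
    intro x hx
    induction hx using Submodule.span_induction with
    | mem x hx =>
      obtain ⟨k, rfl⟩ := hx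
      refine ⟨‖(A k).mulVec (b t)‖, fun r => ?_⟩
      have hz : ∀ n : ℤ, A ((k * t * k⁻¹) ^ n) = 1 ∧
          b ((k * t * k⁻¹) ^ n) = (n : ℝ) • (A k).mulVec (b t) := by
        intro n
        obtain ⟨h1, h2⟩ := hconj k
        set τ := k * t * k⁻¹
        have hinv : A τ⁻¹ = 1 := by
          have := mul_inv_A (A := A) τ
          rwa [h1, one_mul] at this
        have hbinv : b τ⁻¹ = - b τ := by
          have := hadd τ τ⁻¹ h1
          rw [mul_inv_cancel, h.b_one] at this
          exact (neg_eq_of_add_eq_zero_right this.symm).symm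
        induction n using Int.induction_on with
        | zero => simp [h.b_one]
        | succ n ih =>
          rw [_root_.zpow_add_one, map_mul, ih.1, h1, one_mul, hadd _ _ ih.1, ih.2, h2]
          refine ⟨rfl, ?_⟩
          push_cast
          rw [add_smul, one_smul]
        | pred n ih =>
          rw [_root_.zpow_sub_one, map_mul, ih.1, hinv, one_mul, hadd _ _ ih.1, ih.2, hbinv, h2]
          refine ⟨rfl, ?_⟩
          push_cast
          rw [sub_smul, one_smul, sub_eq_add_neg]
      refine ⟨_, (hz (-⌊r⌋)).1, ?_⟩
      rw [(hz _).2, ← add_smul, norm_smul]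
      refine mul_le_of_le_one_left (norm_nonneg _) ?_
      push_cast
      rw [neg_add_eq_sub, Real.norm_eq_abs, Int.self_sub_floor, abs_of_nonneg (Int.fract_nonneg r)]
      exact (Int.fract_lt_one r).le
    | zero =>
      refine ⟨0, fun r => ⟨1, by rw [map_one], by simp [h.b_one]⟩⟩
    | add x y _ _ hx hy =>
      obtain ⟨C1, h1⟩ := hx
      obtain ⟨C2, h2⟩ := hy
      refine ⟨C1 + C2, fun r => ?_⟩
      obtain ⟨s1, hs1, e1⟩ := h1 r
      obtain ⟨s2, hs2, e2⟩ := h2 r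
      refine ⟨s1 * s2, by rw [map_mul, hs1, hs2, one_mul], ?_⟩
      rw [hadd _ _ hs1, smul_add, add_add_add_comm]
      exact (norm_add_le _ _).trans (add_le_add e1 e2)
    | smul c x _ hx =>
      obtain ⟨C1, h1⟩ := hx
      refine ⟨C1, fun r => ?_⟩
      obtain ⟨s1, hs1, e1⟩ := h1 (r * c)
      exact ⟨s1, hs1, by rwa [smul_smul]⟩
  have hall : ∀ i : Fin 3, ∃ C : ℝ, ∀ r : ℝ, ∃ s, A s = 1 ∧
      ‖b s + r • (Pi.single i 1 : Fin 3 → ℝ)‖ ≤ C := fun i => hred _ (by rw [hW]; trivial)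
  choose C hC using hall
  apply h.infinite_range hn
  have hfin := h.finite_of_bdd {γ | ‖b γ‖ ≤ C 0 + C 1 + C 2} 0 (C 0 + C 1 + C 2) (by
    intro γ hγ
    exact ⟨0, by simp, by rwa [act_zero]⟩)
  refine (hfin.image A).subset ?_
  rintro _ ⟨γ, rfl⟩
  obtain ⟨s0, a0, e0⟩ := hC 0 (b γ 0)
  obtain ⟨s1, a1, e1⟩ := hC 1 (b γ 1)
  obtain ⟨s2, a2, e2⟩ := hC 2 (b γ 2)
  refine ⟨s0 * (s1 * (s2 * γ)), ?_, by
    rw [map_mul, map_mul, map_mul, a0, a1, a2, one_mul, one_mul, one_mul]⟩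
  change ‖b _‖ ≤ _
  rw [hadd _ _ a0, hadd _ _ a1, hadd _ _ a2]
  have e : b s0 + (b s1 + (b s2 + b γ)) = (b s0 + b γ 0 • (Pi.single 0 1 : Fin 3 → ℝ)) +
      (b s1 + b γ 1 • (Pi.single 1 1 : Fin 3 → ℝ)) +
      (b s2 + b γ 2 • (Pi.single 2 1 : Fin 3 → ℝ)) := by
    apply vext3 <;> simp <;> ring
  rw [e]
  exact (norm_add₃_le).trans (add_le_add (add_le_add e0 e1) e2)

theorem bdd_of_trace (hs : Submodule.span ℝ (Set.range A) = ⊤) (ht : ∀ γ, |(A γ).trace| ≤ 3) :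
    ∃ C : ℝ, ∀ γ i j, |A γ i j| ≤ C := by
  have h1 : ∀ M ∈ Submodule.span ℝ (Set.range A), ∃ C : ℝ, ∀ γ, |(A γ * M).trace| ≤ C := by
    intro M hM
    induction hM using Submodule.span_induction with
    | mem x hx => obtain ⟨k, rfl⟩ := hx; exact ⟨3, fun γ => by rw [← map_mul]; exact ht _⟩
    | zero => exact ⟨0, fun γ => by simp⟩
    | add x y _ _ hx hy =>
      obtain ⟨C1, h1⟩ := hx
      obtain ⟨C2, h2⟩ := hy
      refine ⟨C1 + C2, fun γ => ?_⟩
      rw [mul_add, trace_add]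
      exact (abs_add_le _ _).trans (add_le_add (h1 γ) (h2 γ))
    | smul c x _ hx =>
      obtain ⟨C1, h1⟩ := hx
      refine ⟨|c| * C1, fun γ => ?_⟩
      rw [Matrix.mul_smul, trace_smul, smul_eq_mul, abs_mul]
      exact mul_le_mul_of_nonneg_left (h1 γ) (abs_nonneg _)
  have h2 : ∀ p : Fin 3 × Fin 3, ∃ C : ℝ, ∀ γ, |A γ p.1 p.2| ≤ C := by
    rintro ⟨i, j⟩
    obtain ⟨C, hC⟩ := h1 (Matrix.single j i 1) (by rw [hs]; trivial)
    refine ⟨C, fun γ => ?_⟩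
    have := hC γ
    rw [Matrix.trace_mul_single] at this
    simpa using this
  choose C hC using h2
  refine ⟨∑ p, |C p|, fun γ i j => (hC (i, j) γ).trans ((le_abs_self _).trans ?_)⟩
  exact Finset.single_le_sum (f := fun p => |C p|) (fun _ _ => abs_nonneg _) (Finset.mem_univ (i, j))

end AffP

end

section

open Matrix

section Zass

attribute [local instance] Matrix.linftyOpNormedRing

local notation "M3" => Matrix (Fin 3) (Fin 3) ℝ

theorem norm_one_M3 : ‖(1 : M3)‖ = 1 := by
  rw [← Matrix.diagonal_one, Matrix.linfty_opNorm_diagonal]; simp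

theorem norm_inv_le (a a' : M3) (h : a' * a = 1) (ha : ‖a - 1‖ ≤ 1 / 8) : ‖a'‖ ≤ 8 / 7 := by
  have e : a' = 1 - a' * (a - 1) := by rw [mul_sub, h]; simp
  have h1 : ‖a'‖ ≤ ‖(1 : M3)‖ + ‖a'‖ * ‖a - 1‖ := by
    calc ‖a'‖ = ‖1 - a' * (a - 1)‖ := by rw [← e]
      _ ≤ ‖(1 : M3)‖ + ‖a' * (a - 1)‖ := norm_sub_le _ _
      _ ≤ _ := by gcongr; exact norm_mul_le _ _
  rw [norm_one_M3] at h1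
  nlinarith [norm_nonneg a', norm_nonneg (a - 1)]

theorem norm_comm_le (a a' b b' : M3) (ha : a * a' = 1) (hb : b * b' = 1)
    (h1 : ‖a - 1‖ ≤ 1 / 8) (h2 : ‖b - 1‖ ≤ 1 / 8) :
    ‖a * b * a' * b' - 1‖ ≤ ‖b - 1‖ / 2 := by
  have ha2 : a' * a = 1 := mul_eq_one_comm.1 ha
  have hb2 : b' * b = 1 := mul_eq_one_comm.1 hb
  have e : a * b * a' * b' - 1 = ((a - 1) * (b - 1) - (b - 1) * (a - 1)) * a' * b' := by
    have e1 : (a - 1) * (b - 1) - (b - 1) * (a - 1) = a * b - b * a := by noncomm_ring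
    rw [e1, sub_mul, sub_mul, mul_assoc b a a', ha, mul_one, hb]
  have n1 := norm_inv_le a a' ha2 h1
  have n2 := norm_inv_le b b' hb2 h2
  have n3 : ‖(a - 1) * (b - 1) - (b - 1) * (a - 1)‖ ≤ ‖b - 1‖ / 4 := by
    have := norm_sub_le ((a - 1) * (b - 1)) ((b - 1) * (a - 1))
    have := norm_mul_le (a - 1) (b - 1)
    have := norm_mul_le (b - 1) (a - 1)
    nlinarith [norm_nonneg (b - 1)]
  rw [e]
  calc _ ≤ ‖(a - 1) * (b - 1) - (b - 1) * (a - 1)‖ * ‖a'‖ * ‖b'‖ :=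
        (norm_mul_le _ _).trans (by gcongr; exact norm_mul_le _ _)
    _ ≤ (‖b - 1‖ / 4) * (8 / 7) * (8 / 7) := by gcongr
    _ ≤ ‖b - 1‖ / 2 := by nlinarith [norm_nonneg (b - 1)]

theorem norm_le_of_near (a : M3) (h : ‖a - 1‖ ≤ 1 / 8) : ‖a‖ ≤ 9 / 8 := by
  have : ‖a‖ ≤ ‖a - 1‖ + ‖(1 : M3)‖ := by
    calc ‖a‖ = ‖(a - 1) + 1‖ := by rw [sub_add_cancel]
      _ ≤ _ := norm_add_le _ _
  rw [norm_one_M3] at this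
  linarith

/-- iterated commutators -/
def itComm {Γ : Type*} [Group Γ] (γ δ : Γ) : ℕ → Γ
  | 0 => δ
  | n + 1 => γ * itComm γ δ n * γ⁻¹ * (itComm γ δ n)⁻¹

namespace AffP

variable {Γ : Type*} [Group Γ] {A : Γ →* Matrix (Fin 3) (Fin 3) ℝ} {b : Γ → Fin 3 → ℝ}

theorem itComm_near (γ δ : Γ) (h1 : ‖A γ - 1‖ ≤ 1 / 8) (h2 : ‖A δ - 1‖ ≤ 1 / 8) (n : ℕ) :
    ‖A (itComm γ δ n) - 1‖ ≤ 1 / 8 ∧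
    ‖A (itComm γ δ (n + 1)) - 1‖ ≤ ‖A (itComm γ δ n) - 1‖ / 2 := by
  have key : ∀ n, ‖A (itComm γ δ n) - 1‖ ≤ 1 / 8 →
      ‖A (itComm γ δ (n + 1)) - 1‖ ≤ ‖A (itComm γ δ n) - 1‖ / 2 := by
    intro n hn
    have := norm_comm_le (A γ) (A γ⁻¹) (A (itComm γ δ n)) (A (itComm γ δ n)⁻¹) (mul_inv_A _)
      (mul_inv_A _) h1 hn
    simpa only [itComm, map_mul] using this
  have : ‖A (itComm γ δ n) - 1‖ ≤ 1 / 8 := by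
    induction n with
    | zero => exact h2
    | succ n ih => have := key n ih; linarith
  exact ⟨this, key n this⟩

theorem itComm_trans (h : AffP A b) (γ δ : Γ) (h1 : ‖A γ - 1‖ ≤ 1 / 8) (h2 : ‖A δ - 1‖ ≤ 1 / 8)
    (n : ℕ) : ‖b (itComm γ δ n)‖ ≤ ‖b δ‖ + 2 * ‖b γ‖ := by
  induction n with
  | zero => have := norm_nonneg (b γ); change ‖b δ‖ ≤ _; linarith
  | succ n ih =>
    obtain ⟨e1, e2⟩ := itComm_near (A := A) γ δ h1 h2 n
    set d := itComm γ δ n with hd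
    set c := itComm γ δ (n + 1) with hc
    have hcd : c * (d * γ) = γ * d := by
      rw [hc, itComm]; simp only [← hd]; group
    have hb := congrArg b hcd
    rw [h.coc, h.coc, h.coc, mulVec_add, mulVec_mulVec] at hb
    have hb' : b c = (A γ - A c).mulVec (b d) + (1 - A c * A d).mulVec (b γ) := by
      rw [Matrix.sub_mulVec, Matrix.sub_mulVec, one_mulVec]
      have hb2 : b c = (A γ).mulVec (b d) + b γ -
          ((A c * A d).mulVec (b γ) + (A c).mulVec (b d)) := by
        rw [← hb]; abel
      rw [hb2]; abel
    have n1 : ‖A γ - A c‖ ≤ 1 / 4 := by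
      have : A γ - A c = (A γ - 1) - (A c - 1) := by abel
      rw [this]
      have := norm_sub_le (A γ - 1) (A c - 1)
      linarith
    have n2 : ‖1 - A c * A d‖ ≤ 1 := by
      have : 1 - A c * A d = -((A c - 1) * A d) - (A d - 1) := by noncomm_ring
      rw [this]
      have a1 := norm_sub_le (-((A c - 1) * A d)) (A d - 1)
      rw [norm_neg] at a1
      have a2 := norm_mul_le (A c - 1) (A d)
      have a3 := norm_le_of_near _ e1
      nlinarith [norm_nonneg (A c - 1), norm_nonneg (A d)]
    rw [hb']
    calc _ ≤ ‖(A γ - A c).mulVec (b d)‖ + ‖(1 - A c * A d).mulVec (b γ)‖ := norm_add_le _ _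
      _ ≤ ‖A γ - A c‖ * ‖b d‖ + ‖1 - A c * A d‖ * ‖b γ‖ :=
        add_le_add (linfty_opNorm_mulVec _ _) (linfty_opNorm_mulVec _ _)
      _ ≤ 1 / 4 * (‖b δ‖ + 2 * ‖b γ‖) + 1 * ‖b γ‖ := by gcongr
      _ ≤ _ := by nlinarith [norm_nonneg (b γ), norm_nonneg (b δ)]

theorem itComm_one (h : AffP A b) (γ δ : Γ) (h1 : ‖A γ - 1‖ ≤ 1 / 8) (h2 : ‖A δ - 1‖ ≤ 1 / 8) :
    ∃ n, A (itComm γ δ n) = 1 := by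
  by_contra hne
  push Not at hne
  have hanti : StrictAnti (fun n => ‖A (itComm γ δ n) - 1‖) := by
    apply strictAnti_nat_of_succ_lt
    intro n
    have := (itComm_near (A := A) γ δ h1 h2 n).2
    have : 0 < ‖A (itComm γ δ n) - 1‖ := norm_pos_iff.2 (sub_ne_zero.2 (hne n))
    linarith
  have hinj : Function.Injective (itComm γ δ) := by
    intro i j hij
    apply hanti.injective
    simp only [hij]
  apply Set.infinite_range_of_injective hinj
  apply h.finite_of_bdd _ 0 (‖b δ‖ + 2 * ‖b γ‖)
  rintro _ ⟨n, rfl⟩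
  exact ⟨0, by simp, by rw [act_zero]; exact h.itComm_trans γ δ h1 h2 n⟩

theorem par_of_near (h : AffP A b) (γ δ : Γ) (h1 : ‖A γ - 1‖ ≤ 1 / 8) (h2 : ‖A δ - 1‖ ≤ 1 / 8)
    (x : Fin 3 → ℝ) (hx : x ≠ 0) (hfx : (A γ).mulVec x = x)
    (hH : ∀ (β : Γ) (c : ℝ), (A γ).mulVec ((A β).mulVec x) = c • ((A β).mulVec x) →
      ∃ d : ℝ, (A β).mulVec x = d • x) : ∃ m : ℝ, (A δ).mulVec x = m • x := by
  have inv_vec : ∀ (g : Γ) (v : Fin 3 → ℝ), (A g⁻¹).mulVec ((A g).mulVec v) = v := fun g v => by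
    rw [mulVec_mulVec, inv_mul_A, one_mulVec]
  have vec_inv : ∀ (g : Γ) (v : Fin 3 → ℝ), (A g).mulVec ((A g⁻¹).mulVec v) = v := fun g v => by
    rw [mulVec_mulVec, mul_inv_A, one_mulVec]
  obtain ⟨n, hn⟩ := h.itComm_one γ δ h1 h2
  have step : ∀ j, (∃ m : ℝ, (A (itComm γ δ (j + 1))).mulVec x = m • x) →
      ∃ m : ℝ, (A (itComm γ δ j)).mulVec x = m • x := by
    rintro j ⟨m, hm⟩
    rw [itComm] at hm
    set d := itComm γ δ j
    rw [map_mul, map_mul, map_mul, ← mulVec_mulVec, ← mulVec_mulVec, ← mulVec_mulVec] at hm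
    have hfx' : (A γ⁻¹).mulVec x = x := by
      conv_lhs => rw [← hfx]
      exact inv_vec _ _
    have e1 := congrArg (A γ⁻¹).mulVec hm
    rw [inv_vec, mulVec_smul, hfx'] at e1
    have e2 := congrArg (A d⁻¹).mulVec e1
    rw [inv_vec, mulVec_smul] at e2
    have e3 := congrArg (A γ).mulVec e2
    rw [vec_inv, mulVec_smul] at e3
    set w := (A d⁻¹).mulVec x with hw
    have hdw : (A d).mulVec w = x := vec_inv _ _
    have hw0 : w ≠ 0 := by
      intro h0; rw [h0, mulVec_zero] at hdw; exact hx hdw.symm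
    have hm0 : m ≠ 0 := by
      rintro rfl; rw [zero_smul] at e3; exact hw0 e3
    obtain ⟨c, hc⟩ := hH d⁻¹ m⁻¹ (by rw [← hw]; rw [eq_inv_smul_iff₀ hm0]; exact e3.symm)
    rw [← hw] at hc
    have hc0 : c ≠ 0 := by
      rintro rfl; rw [zero_smul] at hc; exact hw0 hc
    refine ⟨c⁻¹, ?_⟩
    rw [eq_inv_smul_iff₀ hc0, ← mulVec_smul, ← hc, hdw]
  have all : ∀ i, i ≤ n → ∃ m : ℝ, (A (itComm γ δ (n - i))).mulVec x = m • x := by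
    intro i
    induction i with
    | zero => intro _; exact ⟨1, by simp [hn]⟩
    | succ i ih =>
      intro hi
      apply step
      have : n - (i + 1) + 1 = n - i := by omega
      rw [this]; exact ih (by omega)
  have := all n le_rfl
  rwa [Nat.sub_self] at this

theorem zass (h : AffP A b) (hs : Submodule.span ℝ (Set.range A) = ⊤) (ε : ℝ) (hε : 0 < ε)
    (hH : ∀ γ, ‖A γ - 1‖ < ε → A γ ≠ 1 → ∃ x : Fin 3 → ℝ, x ≠ 0 ∧ (A γ).mulVec x = x ∧
      ∀ (β : Γ) (c : ℝ), (A γ).mulVec ((A β).mulVec x) = c • ((A β).mulVec x) →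
        ∃ d : ℝ, (A β).mulVec x = d • x) :
    ∃ ε' : ℝ, 0 < ε' ∧ ∀ γ, ‖A γ - 1‖ < ε' → A γ = 1 := by
  obtain ⟨B, hB, hBs, hBl⟩ := exists_linearIndependent ℝ (Set.range A)
  rw [hs] at hBs
  have hfin : B.Finite := hBl.setFinite
  have hB' : ∀ M, M ∈ B → ∃ g, A g = M := fun M hM => hB hM
  choose! k hk using hB'
  have hbd : ∃ K : ℝ, 0 ≤ K ∧ ∀ M ∈ B, ‖A (k M)⁻¹‖ * ‖A (k M)‖ ≤ K := by
    obtain ⟨K, hK⟩ := (hfin.image (fun M => ‖A (k M)⁻¹‖ * ‖A (k M)‖)).bddAbove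
    refine ⟨max K 0, le_max_right _ _, fun M hM => le_max_of_le_left ?_⟩
    exact hK ⟨M, hM, rfl⟩
  obtain ⟨K, hK0, hK⟩ := hbd
  have hε1 : 0 < min ε (1 / 8) := lt_min hε (by norm_num)
  refine ⟨min ε (1 / 8) / (K + 1), by positivity, fun γ hγ => ?_⟩
  by_contra hne
  rw [lt_div_iff₀ (by positivity)] at hγ
  have hγ1 : ‖A γ - 1‖ < min ε (1 / 8) := by nlinarith [norm_nonneg (A γ - 1)]
  have hγ2 : ‖A γ - 1‖ ≤ 1 / 8 := hγ1.le.trans (min_le_right _ _)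
  obtain ⟨x, hx, hfx, hxH⟩ := hH γ (hγ1.trans_le (min_le_left _ _)) hne
  have hpar : ∀ M ∈ B, ∃ d : ℝ, M.mulVec x = d • x := by
    intro M hM
    have hδ : ‖A ((k M)⁻¹ * γ * k M) - 1‖ ≤ 1 / 8 := by
      have e : A ((k M)⁻¹ * γ * k M) - 1 = A (k M)⁻¹ * (A γ - 1) * A (k M) := by
        rw [mul_sub, sub_mul, mul_one, inv_mul_A, map_mul, map_mul]
      rw [e]
      calc _ ≤ ‖A (k M)⁻¹‖ * ‖A γ - 1‖ * ‖A (k M)‖ :=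
            (norm_mul_le _ _).trans (by gcongr; exact norm_mul_le _ _)
        _ = (‖A (k M)⁻¹‖ * ‖A (k M)‖) * ‖A γ - 1‖ := by ring
        _ ≤ K * ‖A γ - 1‖ := by gcongr; exact hK M hM
        _ ≤ min ε (1 / 8) := by nlinarith [norm_nonneg (A γ - 1)]
        _ ≤ 1 / 8 := min_le_right _ _
    obtain ⟨m, hm⟩ := h.par_of_near γ _ hγ2 hδ x hx hfx hxH
    have e1 := congrArg (A (k M)).mulVec hm
    rw [mulVec_mulVec, ← map_mul, mulVec_smul] at e1
    have e2 : k M * ((k M)⁻¹ * γ * k M) = γ * k M := by group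
    rw [e2, map_mul, ← mulVec_mulVec] at e1
    obtain ⟨d, hd⟩ := hxH _ _ e1
    rw [hk M hM] at hd
    exact ⟨d, hd⟩
  have hall : ∀ M : M3, ∃ d : ℝ, M.mulVec x = d • x := by
    intro M
    have hM : M ∈ Submodule.span ℝ B := by rw [hBs]; trivial
    induction hM using Submodule.span_induction with
    | mem M hM => exact hpar M hM
    | zero => exact ⟨0, by simp⟩
    | add M N _ _ h1 h2 =>
      obtain ⟨c, hc⟩ := h1
      obtain ⟨d, hd⟩ := h2
      exact ⟨c + d, by rw [Matrix.add_mulVec, hc, hd, add_smul]⟩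
    | smul r M _ h1 =>
      obtain ⟨c, hc⟩ := h1
      exact ⟨r * c, by rw [Matrix.smul_mulVec, hc, smul_smul]⟩
  obtain ⟨i, hi⟩ : ∃ i, x i ≠ 0 := by
    by_contra hc; push Not at hc; exact hx (funext hc)
  obtain ⟨j, hj⟩ : ∃ j : Fin 3, j ≠ i := exists_ne i
  obtain ⟨d, hd⟩ := hall (Matrix.single j i 1)
  have d1 := congrFun hd i
  have d2 := congrFun hd j
  rw [Matrix.single_mulVec] at d1 d2
  simp [hj.symm] at d1 d2
  rcases d1 with d1 | d1
  · rw [d1, zero_mul] at d2; exact hi d2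
  · exact hi d1

end AffP

end Zass

end

section

open Matrix

theorem decomp_fixed (M : Matrix (Fin 3) (Fin 3) ℝ) (hM : M ≠ 1) (x y : Fin 3 → ℝ) (hx : x ≠ 0)
    (hfx : M.mulVec x = x) (hfy : M.mulVec y = y) (hpar : ¬ ∃ d : ℝ, y = d • x) :
    ∃ z u : Fin 3 → ℝ, u ≠ 0 ∧ M.mulVec z = z + u ∧
      ∀ q : Fin 3 → ℝ, ∃ α β κ : ℝ, q = α • x + β • y + κ • z ∧ M.mulVec q = q + κ • u := by
  obtain ⟨z, hz⟩ : ∃ z, M.mulVec z ≠ z := by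
    by_contra hc
    push Not at hc
    exact hM (Matrix.ext_of_mulVec_single fun i => by rw [hc, one_mulVec])
  refine ⟨z, M.mulVec z - z, sub_ne_zero.2 hz, by abel, fun q => ?_⟩
  have hli : LinearIndependent ℝ ![x, y, z] := by
    rw [Fintype.linearIndependent_iff]
    intro g hg
    rw [Fin.sum_univ_three] at hg
    simp only [Matrix.cons_val_zero, Matrix.cons_val_one, Matrix.cons_val] at hg
    have e := congrArg M.mulVec hg
    rw [mulVec_add, mulVec_add, mulVec_smul, mulVec_smul, mulVec_smul, hfx, hfy, mulVec_zero,
      ← hg] at e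
    have e2 : g 2 • (M.mulVec z - z) = 0 := by
      rw [smul_sub, sub_eq_zero]; exact add_left_cancel e
    have g2 : g 2 = 0 := (smul_eq_zero.1 e2).resolve_right (sub_ne_zero.2 hz)
    rw [g2, zero_smul, add_zero] at hg
    have g1 : g 1 = 0 := by
      by_contra h1
      apply hpar
      refine ⟨-(g 1)⁻¹ * g 0, ?_⟩
      have : g 1 • y = -(g 0 • x) := by rw [eq_neg_iff_add_eq_zero, add_comm]; exact hg
      rw [mul_smul, neg_smul, ← smul_neg, ← this, smul_smul, inv_mul_cancel₀ h1, one_smul]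
    rw [g1, zero_smul, add_zero] at hg
    have g0 : g 0 = 0 := (smul_eq_zero.1 hg).resolve_right hx
    intro i; fin_cases i <;> assumption
  let B := basisOfLinearIndependentOfCardEqFinrank hli (by simp)
  have hq := B.sum_repr q
  rw [Fin.sum_univ_three] at hq
  simp only [B, coe_basisOfLinearIndependentOfCardEqFinrank, Matrix.cons_val_zero,
    Matrix.cons_val_one, Matrix.cons_val] at hq
  refine ⟨_, _, _, hq.symm, ?_⟩
  conv_lhs => rw [← hq]
  conv_rhs => lhs; rw [← hq]
  rw [mulVec_add, mulVec_add, mulVec_smul, mulVec_smul, mulVec_smul, hfx, hfy, smul_sub]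
  abel

/-- the Lorentz form -/
def lf (x y : Fin 3 → ℝ) : ℝ := x 0 * y 0 + x 1 * y 1 - x 2 * y 2

theorem lf_add_right (x y z : Fin 3 → ℝ) : lf x (y + z) = lf x y + lf x z := by
  simp [lf]; ring

theorem lf_add_left (x y z : Fin 3 → ℝ) : lf (x + y) z = lf x z + lf y z := by
  simp [lf]; ring

theorem lf_smul_right (c : ℝ) (x y : Fin 3 → ℝ) : lf x (c • y) = c * lf x y := by
  simp [lf]; ring

theorem lf_smul_left (c : ℝ) (x y : Fin 3 → ℝ) : lf (c • x) y = c * lf x y := by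
  simp [lf]; ring

theorem lf_comm (x y : Fin 3 → ℝ) : lf x y = lf y x := by
  simp [lf]; ring

theorem lf_nondeg (u : Fin 3 → ℝ) (h : ∀ q, lf u q = 0) : u = 0 := by
  have h0 := h ![1, 0, 0]
  have h1 := h ![0, 1, 0]
  have h2 := h ![0, 0, 1]
  simp [lf] at h0 h1 h2
  exact vext3 h0 h1 h2

theorem lf_iso (x y : Fin 3 → ℝ) (hx : x ≠ 0) (hxx : lf x x = 0) (hyy : lf y y = 0)
    (hxy : lf x y = 0) : ∃ d : ℝ, y = d • x := by
  have hx2 : x 2 ≠ 0 := by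
    intro h2
    apply hx
    simp only [lf, h2] at hxx
    have a0 : x 0 = 0 := by nlinarith [sq_nonneg (x 0), sq_nonneg (x 1)]
    have a1 : x 1 = 0 := by nlinarith [sq_nonneg (x 0), sq_nonneg (x 1)]
    exact vext3 a0 a1 h2
  refine ⟨y 2 / x 2, ?_⟩
  set d := y 2 / x 2 with hd
  have hy2 : y 2 = d * x 2 := by rw [hd]; field_simp
  have key : (y 0 - d * x 0) ^ 2 + (y 1 - d * x 1) ^ 2 = 0 := by
    simp only [lf] at hxx hyy hxy
    rw [hy2] at hyy hxy
    linear_combination hyy - 2 * d * hxy + d ^ 2 * hxx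
  have a0 : y 0 - d * x 0 = 0 := by nlinarith [sq_nonneg (y 0 - d * x 0), sq_nonneg (y 1 - d * x 1)]
  have a1 : y 1 - d * x 1 = 0 := by nlinarith [sq_nonneg (y 0 - d * x 0), sq_nonneg (y 1 - d * x 1)]
  apply vext3
  · simp; linarith
  · simp; linarith
  · simp; linarith

section nrm

attribute [local instance] Matrix.linftyOpNormedRing Matrix.linftyOpNormedSpace

local notation "M3" => Matrix (Fin 3) (Fin 3) ℝ

theorem near_ne_neg (M : M3) (hM : ‖M - 1‖ < 1 / 8) (v : Fin 3 → ℝ) (hv : v ≠ 0) :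
    M.mulVec v ≠ (-1 : ℝ) • v := by
  intro h
  have h1 := linfty_opNorm_mulVec (M - 1) v
  have e : (M - 1).mulVec v = (-2 : ℝ) • v := by
    rw [Matrix.sub_mulVec, one_mulVec, h]; module
  rw [e, norm_smul] at h1
  have : 0 < ‖v‖ := norm_pos_iff.2 hv
  norm_num at h1
  nlinarith

theorem lor_H (M : M3) (hM : ∀ x y, lf (M.mulVec x) (M.mulVec y) = lf x y) (hne : M ≠ 1)
    (hn : ‖M - 1‖ < 1 / 8) (x : Fin 3 → ℝ) (hx : x ≠ 0) (hfx : M.mulVec x = x) (y : Fin 3 → ℝ)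
    (hxy : lf y y = lf x x) (c : ℝ) (hy : M.mulVec y = c • y) : ∃ d : ℝ, y = d • x := by
  by_cases hy0 : y = 0
  · exact ⟨0, by simp [hy0]⟩
  by_contra hpar
  have hcm : c ≠ -1 := by
    rintro rfl
    exact near_ne_neg M hn y hy0 hy
  have hc : c = 1 := by
    by_contra hc1
    have e1 := hM y y
    rw [hy, lf_smul_left, lf_smul_right] at e1
    have e2 := hM x y
    rw [hy, hfx, lf_smul_right] at e2
    have c1 : c - 1 ≠ 0 := sub_ne_zero.2 hc1
    have c2 : c + 1 ≠ 0 := fun h => hcm (by linarith)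
    have yy : lf y y = 0 := by
      have : (c - 1) * (c + 1) * lf y y = 0 := by linear_combination e1
      exact (mul_eq_zero.1 this).resolve_left (mul_ne_zero c1 c2)
    have xy : lf x y = 0 := by
      have : (c - 1) * lf x y = 0 := by linear_combination e2
      exact (mul_eq_zero.1 this).resolve_left c1
    exact hpar (lf_iso x y hx (by rw [← hxy, yy]) yy xy)
  rw [hc, one_smul] at hy
  obtain ⟨z, u, hu, hz, hdec⟩ := decomp_fixed M hne x y hx hfx hy hpar
  have ux : lf u x = 0 := by
    have := hM z x
    rw [hz, hfx, lf_add_left] at this; linarith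
  have uy : lf u y = 0 := by
    have := hM z y
    rw [hz, hy, lf_add_left] at this; linarith
  have uz : 2 * lf u z + lf u u = 0 := by
    have := hM z z
    rw [hz, lf_add_left, lf_add_right, lf_add_right, lf_comm z u] at this; linarith
  obtain ⟨α, β, κ, hq, hMu⟩ := hdec u
  have uu : lf u u = 0 := by
    by_cases hκ : κ = 0
    · rw [hκ, zero_smul, add_zero] at hMu
      have := hM u z
      rw [hMu, hz, lf_add_right] at this; linarith
    · have e1 : lf u u = κ * lf u z := by
        conv_lhs => rhs; rw [hq]
        rw [lf_add_right, lf_add_right, lf_smul_right, lf_smul_right, lf_smul_right, ux, uy]; ring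
      have e2 : (2 + κ) * lf u u = 0 := by linear_combination 2 * e1 + κ * uz
      refine (mul_eq_zero.1 e2).resolve_left fun h2 => ?_
      apply near_ne_neg M hn u hu
      rw [hMu, show κ = -2 by linarith]; module
  apply hu
  apply lf_nondeg
  intro q
  obtain ⟨α, β, κ, hq, -⟩ := hdec q
  rw [hq, lf_add_right, lf_add_right, lf_smul_right, lf_smul_right, lf_smul_right, ux, uy,
    show lf u z = 0 by linarith]; ring

namespace AffP

variable {Γ : Type*} [Group Γ] {A : Γ →* Matrix (Fin 3) (Fin 3) ℝ} {b : Γ → Fin 3 → ℝ}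

theorem zass_lor (h : AffP A b) (hs : Submodule.span ℝ (Set.range A) = ⊤)
    (hF : ∀ γ, (A γ - 1).det = 0)
    (hL : ∀ γ x y, lf ((A γ).mulVec x) ((A γ).mulVec y) = lf x y) :
    ∃ ε' : ℝ, 0 < ε' ∧ ∀ γ, ‖A γ - 1‖ < ε' → A γ = 1 := by
  apply h.zass hs (1 / 8) (by norm_num)
  intro γ hγ hne
  obtain ⟨x, hx, hfx⟩ := eigvec3 (A γ) 1 (by rw [one_smul]; exact hF γ)
  rw [one_smul] at hfx
  refine ⟨x, hx, hfx, fun β c hc => ?_⟩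
  exact lor_H (A γ) (hL γ) hne hγ x hx hfx _ (hL β x x) c hc

theorem bdd_false (h : AffP A b) (hn : NVS Γ) (ht : ∀ γ, |(A γ).trace| ≤ 3) : False := by
  have hs := h.span_top hn
  obtain ⟨C0, hC0⟩ := bdd_of_trace hs ht
  have hb : ∃ C : ℝ, 0 < C ∧ ∀ γ, ‖A γ‖ ≤ C := by
    have hc : 0 ≤ C0 := (abs_nonneg _).trans (hC0 1 0 0)
    refine ⟨3 * C0 + 1, by positivity, fun γ => ?_⟩
    rw [← Real.coe_toNNReal (3 * C0 + 1) (by positivity), ← coe_nnnorm, NNReal.coe_le_coe,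
      Matrix.linfty_opNNNorm_def]
    apply Finset.sup_le
    intro i _
    rw [← NNReal.coe_le_coe, Real.coe_toNNReal _ (by positivity), Fin.sum_univ_three]
    push_cast
    simp only [Real.norm_eq_abs]
    linarith [hC0 γ i 0, hC0 γ i 1, hC0 γ i 2]
  obtain ⟨C, hCpos, hC⟩ := hb
  have eig_le : ∀ γ (v : Fin 3 → ℝ) (c : ℝ), v ≠ 0 → (A γ).mulVec v = c • v → |c| ≤ 1 := by
    intro γ v c hv hc
    have hp : ∀ n : ℕ, (A (γ ^ n)).mulVec v = c ^ n • v := by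
      intro n
      induction n with
      | zero => simp
      | succ n ih => rw [pow_succ, map_mul, ← mulVec_mulVec, hc, mulVec_smul, ih, smul_smul]; ring_nf
    have hv' : 0 < ‖v‖ := norm_pos_iff.2 hv
    by_contra hlt
    push Not at hlt
    obtain ⟨n, hn⟩ := pow_unbounded_of_one_lt C hlt
    have h1 := linfty_opNorm_mulVec (A (γ ^ n)) v
    rw [hp, norm_smul, norm_pow, Real.norm_eq_abs] at h1
    have h2 := le_of_mul_le_mul_right h1 hv'
    linarith [hC (γ ^ n)]
  have eig_one : ∀ γ (v : Fin 3 → ℝ) (c : ℝ), ‖A γ - 1‖ < 1 / 8 → v ≠ 0 →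
      (A γ).mulVec v = c • v → c = 1 := by
    intro γ v c hγ hv hc
    have c0 : c ≠ 0 := by
      rintro rfl
      have := congrArg (A γ⁻¹).mulVec hc
      rw [mulVec_mulVec, inv_mul_A, one_mulVec, zero_smul, mulVec_zero] at this
      exact hv this
    have h1 := eig_le γ v c hv hc
    have h2 := eig_le γ⁻¹ v c⁻¹ hv (by
      have := congrArg (A γ⁻¹).mulVec hc
      rw [mulVec_mulVec, inv_mul_A, one_mulVec, mulVec_smul] at this
      rw [eq_inv_smul_iff₀ c0]; exact this.symm)
    rw [abs_inv] at h2
    have h3 : 1 ≤ |c| := (inv_le_one₀ (abs_pos.2 c0)).1 h2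
    rcases eq_or_eq_neg_of_abs_eq (le_antisymm h1 h3) with h4 | h4
    · exact h4
    · rw [h4] at hc
      exact absurd hc (near_ne_neg _ hγ v hv)
  obtain ⟨ε, hε, hz⟩ := h.zass hs (1 / 8) (by norm_num) (by
    intro γ hγ hne
    obtain ⟨c, x, hx, hfx⟩ := real_eig (A γ)
    rw [eig_one γ x c hγ hx hfx, one_smul] at hfx
    refine ⟨x, hx, hfx, fun β c hc => ?_⟩
    by_contra hpar
    have hy0 : (A β).mulVec x ≠ 0 := by
      intro h0; exact hpar ⟨0, by rw [h0, zero_smul]⟩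
    rw [eig_one γ _ c hγ hy0 hc, one_smul] at hc
    obtain ⟨z, u, hu, hz, hdec⟩ := decomp_fixed (A γ) hne x _ hx hfx hc hpar
    obtain ⟨-, -, κ, -, hMu⟩ := hdec u
    have hk := eig_one γ u (1 + κ) hγ hu (by rw [hMu]; module)
    have hk0 : κ = 0 := by linarith
    rw [hk0, zero_smul, add_zero] at hMu
    have hp : ∀ n : ℕ, (A (γ ^ n)).mulVec z = z + (n : ℝ) • u := by
      intro n
      induction n with
      | zero => simp
      | succ n ih =>
        rw [pow_succ', map_mul, ← mulVec_mulVec, ih, mulVec_add, hz, mulVec_smul, hMu]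
        push_cast; module
    have hu' : 0 < ‖u‖ := norm_pos_iff.2 hu
    obtain ⟨n, hn⟩ := exists_nat_gt ((C * ‖z‖ + ‖z‖) / ‖u‖)
    rw [div_lt_iff₀ hu'] at hn
    have h1 := linfty_opNorm_mulVec (A (γ ^ n)) z
    rw [hp] at h1
    have h2 : ‖(n : ℝ) • u‖ ≤ ‖z + (n : ℝ) • u‖ + ‖z‖ := by
      have := norm_sub_le (z + (n : ℝ) • u) z
      rwa [add_sub_cancel_left] at this
    rw [norm_smul, Real.norm_natCast] at h2
    have h3 : ‖A (γ ^ n)‖ * ‖z‖ ≤ C * ‖z‖ := by gcongr; exact hC _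
    linarith)
  apply h.infinite_range hn
  have hsep : ∀ γ δ, ‖A γ - A δ‖ < ε / C → A γ = A δ := by
    intro γ δ hγ
    have e : A (δ⁻¹ * γ) - 1 = A δ⁻¹ * (A γ - A δ) := by
      rw [mul_sub, inv_mul_A, map_mul]
    have h1 : ‖A (δ⁻¹ * γ) - 1‖ < ε := by
      rw [e]
      rw [lt_div_iff₀ hCpos] at hγ
      calc _ ≤ ‖A δ⁻¹‖ * ‖A γ - A δ‖ := norm_mul_le _ _
        _ ≤ C * ‖A γ - A δ‖ := by gcongr; exact hC _
        _ < ε := by linarith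
    have h2 := hz _ h1
    have h3 := congrArg (A δ * ·) h2
    simp only [← map_mul, mul_inv_cancel_left, mul_one] at h3
    exact h3
  have : ProperSpace M3 := FiniteDimensional.proper ℝ M3
  have hbd : Bornology.IsBounded (Set.range A) := by
    rw [isBounded_iff_forall_norm_le]
    exact ⟨C, by rintro _ ⟨γ, rfl⟩; exact hC γ⟩
  have htb : TotallyBounded (Set.range A) :=
    hbd.isCompact_closure.totallyBounded.subset subset_closure
  obtain ⟨t, htf, htc⟩ := Metric.totallyBounded_iff.1 htb (ε / C / 2) (by positivity)
  refine (htf.biUnion (t := fun y => Metric.ball y (ε / C / 2) ∩ Set.range A) ?_).subset ?_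
  · intro y _
    apply Set.Subsingleton.finite
    rintro _ ⟨h1, γ, rfl⟩ _ ⟨h2, δ, rfl⟩
    apply hsep
    rw [← dist_eq_norm]
    have := dist_triangle_right (A γ) (A δ) y
    rw [Metric.mem_ball] at h1 h2
    linarith
  · intro a ha
    obtain ⟨y, hy, hy2⟩ := Set.mem_iUnion₂.1 (htc ha)
    exact Set.mem_iUnion₂.2 ⟨y, hy, hy2, ha⟩

end AffP

end nrm

end

section

open Matrix

theorem sym_shape (S : Matrix (Fin 3) (Fin 3) ℝ) (hS : Sᵀ = S) (l : ℝ) (hl : 1 < l)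
    (hD : (diagonal ![1, l, l⁻¹])ᵀ * S * diagonal ![1, l, l⁻¹] = S) :
    S 0 1 = 0 ∧ S 0 2 = 0 ∧ S 1 0 = 0 ∧ S 2 0 = 0 ∧ S 1 1 = 0 ∧ S 2 2 = 0 ∧ S 2 1 = S 1 2 := by
  have l0 : l ≠ 0 := by positivity
  have e : ∀ i j, ![1, l, l⁻¹] i * S i j * ![1, l, l⁻¹] j = S i j := by
    intro i j
    conv_rhs => rw [← hD]
    rw [diagonal_transpose, mul_diagonal, diagonal_mul]
  have hsym : ∀ i j, S i j = S j i := fun i j => by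
    conv_lhs => rw [← hS]
    rfl
  have e01 := e 0 1
  have e02 := e 0 2
  have e11 := e 1 1
  have e22 := e 2 2
  simp at e01 e02 e11 e22
  have hl1 : l - 1 ≠ 0 := sub_ne_zero.2 hl.ne'
  have s01 : S 0 1 = 0 := by
    have : (l - 1) * S 0 1 = 0 := by linear_combination e01
    exact (mul_eq_zero.1 this).resolve_left hl1
  have s02 : S 0 2 = 0 := by
    have : (l - 1) * S 0 2 = 0 := by
      field_simp at e02
      linear_combination -e02
    exact (mul_eq_zero.1 this).resolve_left hl1
  have hl2 : l * l - 1 ≠ 0 := by nlinarith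
  have s11 : S 1 1 = 0 := by
    have : (l * l - 1) * S 1 1 = 0 := by linear_combination e11
    exact (mul_eq_zero.1 this).resolve_left hl2
  have s22 : S 2 2 = 0 := by
    have : (l * l - 1) * S 2 2 = 0 := by
      field_simp at e22
      linear_combination -e22
    exact (mul_eq_zero.1 this).resolve_left hl2
  exact ⟨s01, s02, by rw [hsym, s01], by rw [hsym, s02], s11, s22, hsym 2 1⟩

theorem mulVec_dot (S X : Matrix (Fin 3) (Fin 3) ℝ) (x y : Fin 3 → ℝ) :
    (X.mulVec x) ⬝ᵥ (S.mulVec (X.mulVec y)) = x ⬝ᵥ ((Xᵀ * S * X).mulVec y) := by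
  rw [mul_assoc, ← mulVec_mulVec, ← mulVec_mulVec, dotProduct_mulVec x, vecMul_transpose]

namespace AffP

variable {Γ : Type*} [Group Γ] {A : Γ →* Matrix (Fin 3) (Fin 3) ℝ} {b : Γ → Fin 3 → ℝ}

theorem lor_diag (h : AffP A b) (hn : NVS Γ) (hF : ∀ γ, (A γ - 1).det = 0) (g : Γ) (l : ℝ)
    (hl : 1 < l) (hg : A g = diagonal ![1, l, l⁻¹]) :
    ∃ P Q : Matrix (Fin 3) (Fin 3) ℝ, P * Q = 1 ∧ Q * P = 1 ∧
      ∀ γ x y, lf ((P * A γ * Q).mulVec x) ((P * A γ * Q).mulVec y) = lf x y := by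
  obtain ⟨T, hT, hTA⟩ := char_lemma A (h.irr hn) hF
  set S := T + Tᵀ with hS
  have hSA : ∀ γ, (A γ)ᵀ * S * A γ = S := by
    intro γ
    have e1 := (hTA γ).2
    have e2 := congrArg transpose e1
    rw [transpose_mul, transpose_mul, transpose_transpose, ← mul_assoc] at e2
    rw [hS, mul_add, add_mul, e1, e2]
  have hSS : Sᵀ = S := by rw [hS, transpose_add, transpose_transpose, add_comm]
  have hS0 : S ≠ 0 := by
    intro h0
    have e : Tᵀ = -T := by rw [eq_neg_iff_add_eq_zero, add_comm]; exact h0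
    have := congrArg det e
    rw [det_transpose, det_neg] at this
    simp at this
    exact hT (by linarith)
  have hker : ∀ v, S.mulVec v = 0 → v = 0 := by
    intro v hv
    rcases h.irr hn (LinearMap.ker (Matrix.toLin' S)) (by
      intro γ w hw
      rw [LinearMap.mem_ker, toLin'_apply] at hw ⊢
      rw [← hSA γ⁻¹, mulVec_mulVec, mul_assoc, inv_mul_A, mul_one, ← mulVec_mulVec, hw,
        mulVec_zero]) with h1 | h1
    · have : v ∈ LinearMap.ker (Matrix.toLin' S) := by
        rw [LinearMap.mem_ker, toLin'_apply]; exact hv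
      rw [h1] at this
      exact (Submodule.mem_bot ℝ).1 this
    · exfalso
      apply hS0
      rw [LinearMap.ker_eq_top] at h1
      exact (LinearEquiv.map_eq_zero_iff _).1 h1
  obtain ⟨s01, s02, s10, s20, s11, s22, s21⟩ := sym_shape S hSS l hl (by rw [← hg]; exact hSA g)
  have s0 : S 0 0 ≠ 0 := by
    intro h0
    have := congrFun (hker ![1, 0, 0] (by apply vext3 <;> simp [mulVec3, h0, s10, s20])) 0
    simp at this
  have a0 : S 1 2 ≠ 0 := by
    intro h0
    have := congrFun (hker ![0, 1, 0] (by apply vext3 <;> simp [mulVec3, s01, s11, s21, h0])) 1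
    simp at this
  set s := S 0 0
  set a := S 1 2
  let P : Matrix (Fin 3) (Fin 3) ℝ := !![1, 0, 0; 0, 1 / 2, a / s; 0, 1 / 2, -(a / s)]
  let Q : Matrix (Fin 3) (Fin 3) ℝ := !![1, 0, 0; 0, 1, 1; 0, s / (2 * a), -(s / (2 * a))]
  have hPQ : P * Q = 1 := by
    apply ext3 <;> rw [mul3] <;> simp [P, Q] <;> field_simp <;> norm_num
  have hQP : Q * P = 1 := mul_eq_one_comm.1 hPQ
  refine ⟨P, Q, hPQ, hQP, fun γ x y => ?_⟩
  have hlf : ∀ x y, s * lf x y = (Q.mulVec x) ⬝ᵥ (S.mulVec (Q.mulVec y)) := by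
    intro x y
    simp only [dotProduct, Fin.sum_univ_three, mulVec3, s01, s02, s10, s20, s11, s22, s21]
    simp only [Q, lf]
    simp
    field_simp
    ring
  have hmv : ∀ x, Q.mulVec ((P * A γ * Q).mulVec x) = (A γ).mulVec (Q.mulVec x) := by
    intro x
    rw [mulVec_mulVec, mulVec_mulVec, ← mul_assoc, ← mul_assoc, hQP, one_mul]
  have : s * lf ((P * A γ * Q).mulVec x) ((P * A γ * Q).mulVec y) = s * lf x y := by
    rw [hlf, hlf, hmv, hmv, mulVec_dot, hSA]
  exact mul_left_cancel₀ s0 this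

theorem main (h : AffP A b) (hn : NVS Γ) :
    ∃ P Q : Matrix (Fin 3) (Fin 3) ℝ, P * Q = 1 ∧ Q * P = 1 ∧
      (∀ γ x y, lf ((P * A γ * Q).mulVec x) ((P * A γ * Q).mulVec y) = lf x y) ∧
      ∃ U ∈ nhds (1 : Matrix (Fin 3) (Fin 3) ℝ), ∀ γ, A γ ∈ U → A γ = 1 := by
  have hdet : ∀ γ, |(A γ).det| = 1 := by
    by_contra hc
    push Not at hc
    obtain ⟨k, hk⟩ := hc
    obtain ⟨T, -, hTA⟩ := char_lemma A (h.irr hn) (h.F_zero_of_det k hk)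
    rw [(hTA k).1, abs_one] at hk
    exact hk rfl
  obtain ⟨k, hk⟩ : ∃ k, 3 < |(A k).trace| := by
    by_contra hc
    push Not at hc
    exact h.bdd_false hn hc
  have hF := h.F_zero_of_trace hn hdet k hk
  obtain ⟨g, l, P0, Q0, hl, hPQ0, hQP0, hg⟩ := h.exists_diag hdet k hk
  have h0 := h.conj P0 Q0 hPQ0 hQP0
  obtain ⟨P1, Q1, hPQ1, hQP1, hlf⟩ := h0.lor_diag hn
    (fun γ => (F_conj P0 Q0 hPQ0 (A γ)).trans (hF γ)) g l hl hg
  have e : ∀ M : Matrix (Fin 3) (Fin 3) ℝ, P1 * (P0 * M * Q0) * Q1 = (P1 * P0) * M * (Q0 * Q1) :=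
    fun M => by simp only [mul_assoc]
  have hPQ : (P1 * P0) * (Q0 * Q1) = 1 := by
    rw [mul_assoc, ← mul_assoc P0, hPQ0, one_mul, hPQ1]
  have hQP : (Q0 * Q1) * (P1 * P0) = 1 := mul_eq_one_comm.1 hPQ
  have hlf' : ∀ γ x y, lf (((P1 * P0) * A γ * (Q0 * Q1)).mulVec x)
      (((P1 * P0) * A γ * (Q0 * Q1)).mulVec y) = lf x y := by
    intro γ x y
    rw [← e]; exact hlf γ x y
  refine ⟨P1 * P0, Q0 * Q1, hPQ, hQP, hlf', ?_⟩
  have h1 := h.conj _ _ hPQ hQP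
  obtain ⟨ε, hε, hz⟩ := h1.zass_lor (h1.span_top hn)
    (fun γ => (F_conj _ _ hPQ (A γ)).trans (hF γ)) hlf'
  letI := Matrix.linftyOpNormedRing (n := Fin 3) (α := ℝ)
  refine ⟨{M | ‖(P1 * P0) * M * (Q0 * Q1) - 1‖ < ε}, ?_, ?_⟩
  · apply IsOpen.mem_nhds
    · refine isOpen_lt ?_ continuous_const
      refine Continuous.norm ?_
      fun_prop
    · change ‖(P1 * P0) * 1 * (Q0 * Q1) - 1‖ < ε
      rw [mul_one, hPQ, sub_self, norm_zero]; exact hε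
  · intro γ hγ
    have h2 : (P1 * P0) * A γ * (Q0 * Q1) = 1 := hz γ hγ
    calc A γ = ((Q0 * Q1) * (P1 * P0)) * A γ * ((Q0 * Q1) * (P1 * P0)) := by
          rw [hQP, one_mul, mul_one]
      _ = (Q0 * Q1) * ((P1 * P0) * A γ * (Q0 * Q1)) * (P1 * P0) := by simp only [mul_assoc]
      _ = 1 := by rw [h2, mul_one, hQP]

end AffP

end

section

open Matrix


noncomputable def linHom (Γ : Subgroup ((Fin 3 → ℝ) ≃ᵃ[ℝ] (Fin 3 → ℝ))) :
    Γ →* Matrix (Fin 3) (Fin 3) ℝ where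
  toFun γ := LinearMap.toMatrix' ((γ : (Fin 3 → ℝ) ≃ᵃ[ℝ] (Fin 3 → ℝ)).linear : _ →ₗ[ℝ] _)
  map_one' := LinearMap.toMatrix'_one
  map_mul' := fun γ δ => LinearMap.toMatrix'_mul _ _

theorem linHom_mulVec (Γ : Subgroup ((Fin 3 → ℝ) ≃ᵃ[ℝ] (Fin 3 → ℝ))) (γ : Γ) (x : Fin 3 → ℝ) :
    (linHom Γ γ).mulVec x = (γ : (Fin 3 → ℝ) ≃ᵃ[ℝ] (Fin 3 → ℝ)).linear x := by
  change (LinearMap.toMatrix' _).mulVec x = _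
  rw [LinearMap.toMatrix'_mulVec]; rfl

theorem aff_decomp (f : (Fin 3 → ℝ) ≃ᵃ[ℝ] (Fin 3 → ℝ)) (x : Fin 3 → ℝ) :
    f x = f.linear x + f 0 := by
  have := f.map_vadd 0 x
  simpa using this

theorem affP_of (Γ : Subgroup ((Fin 3 → ℝ) ≃ᵃ[ℝ] (Fin 3 → ℝ)))
    (hproper : ∀ K L : Set (Fin 3 → ℝ), IsCompact K → IsCompact L →
      {γ : (Fin 3 → ℝ) ≃ᵃ[ℝ] (Fin 3 → ℝ) | γ ∈ Γ ∧ ∃ x ∈ K, γ x ∈ L}.Finite) :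
    AffP (linHom Γ) (fun γ : Γ => (γ : (Fin 3 → ℝ) ≃ᵃ[ℝ] (Fin 3 → ℝ)) 0) where
  coc := fun γ δ => by
    rw [linHom_mulVec, ← aff_decomp]; rfl
  faith := fun γ h1 h2 => by
    apply Subtype.ext
    ext1 x
    rw [aff_decomp, ← linHom_mulVec, h1, h2, one_mulVec, add_zero]; rfl
  proper := fun R => by
    refine ((hproper (Metric.closedBall 0 R) (Metric.closedBall 0 R) (isCompact_closedBall _ _)
      (isCompact_closedBall _ _)).preimage (f := (Subtype.val : Γ → _))
      Subtype.val_injective.injOn).subset ?_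
    rintro γ ⟨x, hx, hx2⟩
    refine ⟨γ.2, x, by simpa using hx, ?_⟩
    rw [affAct, linHom_mulVec, ← aff_decomp] at hx2
    simpa using hx2

theorem linearPartGL_val (Γ : Subgroup ((Fin 3 → ℝ) ≃ᵃ[ℝ] (Fin 3 → ℝ))) (γ : Γ) :
    (linearPartGL (γ : (Fin 3 → ℝ) ≃ᵃ[ℝ] (Fin 3 → ℝ)) : Matrix (Fin 3) (Fin 3) ℝ) =
      linHom Γ γ := by
  rfl

end

open Matrix

/-- Fried–Goldman dichotomy: a subgroup `Γ ≤ Aff(ℝ³)` acting properly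
discontinuously on `ℝ³` is either virtually polycyclic, or its linear part
homomorphism `L` is injective with discrete image `L(Γ) ≤ GL(3, ℝ)` conjugate to
a subgroup of the orthogonal group `O(2,1)`. -/
theorem fried_goldman_dichotomy
    (Γ : Subgroup ((Fin 3 → ℝ) ≃ᵃ[ℝ] (Fin 3 → ℝ)))
    (hproper : ∀ K L : Set (Fin 3 → ℝ), IsCompact K → IsCompact L →
      {γ : (Fin 3 → ℝ) ≃ᵃ[ℝ] (Fin 3 → ℝ) | γ ∈ Γ ∧ ∃ x ∈ K, γ x ∈ L}.Finite) :
    IsVirtuallyPolycyclic Γ ∨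
      (Function.Injective (fun γ : Γ =>
          ((γ : (Fin 3 → ℝ) ≃ᵃ[ℝ] (Fin 3 → ℝ)).linear)) ∧
       DiscreteTopology
         (Set.range fun γ : Γ =>
           linearPartGL (γ : (Fin 3 → ℝ) ≃ᵃ[ℝ] (Fin 3 → ℝ))) ∧
       ∃ P : (Fin 3 → ℝ) ≃ₗ[ℝ] (Fin 3 → ℝ), ∀ γ : Γ, ∀ x y : Fin 3 → ℝ,
         lorentzForm
             ((P.trans (((γ : (Fin 3 → ℝ) ≃ᵃ[ℝ] (Fin 3 → ℝ)).linear).trans P.symm)) x)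
             ((P.trans (((γ : (Fin 3 → ℝ) ≃ᵃ[ℝ] (Fin 3 → ℝ)).linear).trans P.symm)) y)
           = lorentzForm x y) := by
  have h := affP_of Γ hproper
  by_cases hn : NVS Γ
  · right
    obtain ⟨P, Q, hPQ, hQP, hlf, U, hU, hUA⟩ := h.main hn
    have hinj : ∀ γ δ : Γ, linHom Γ γ = linHom Γ δ → γ = δ := by
      intro γ δ hγδ
      have := h.A_inj hn (γ⁻¹ * δ) (by rw [map_mul, ← hγδ, AffP.inv_mul_A])
      rw [inv_mul_eq_one] at this
      exact this
    refine ⟨?_, ?_, ?_⟩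
    · intro γ δ hγδ
      apply hinj
      change LinearMap.toMatrix' _ = LinearMap.toMatrix' _
      exact congrArg (fun e : (Fin 3 → ℝ) ≃ₗ[ℝ] (Fin 3 → ℝ) =>
        LinearMap.toMatrix' (e : (Fin 3 → ℝ) →ₗ[ℝ] (Fin 3 → ℝ))) hγδ
    · rw [discreteTopology_iff_isOpen_singleton]
      rintro ⟨_, γ, rfl⟩
      rw [isOpen_induced_iff]
      refine ⟨{g : GL (Fin 3) ℝ | linHom Γ γ⁻¹ * (g : Matrix (Fin 3) (Fin 3) ℝ) ∈ interior U},
        ?_, ?_⟩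
      · refine isOpen_interior.preimage (?_ : Continuous fun g : GL (Fin 3) ℝ =>
          linHom Γ γ⁻¹ * (g : Matrix (Fin 3) (Fin 3) ℝ))
        exact continuous_const.mul Units.continuous_val
      · ext ⟨_, δ, rfl⟩
        simp only [Set.mem_preimage, Set.mem_setOf_eq, Set.mem_singleton_iff]
        constructor
        · intro hδ
          rw [linearPartGL_val, ← map_mul] at hδ
          have h1 := hUA _ (interior_subset hδ)
          have h2 := h.A_inj hn _ h1
          rw [inv_mul_eq_one] at h2
          rw [h2]
        · intro hδ
          rw [show linearPartGL _ = linearPartGL _ from congrArg Subtype.val hδ, linearPartGL_val, AffP.inv_mul_A]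
          exact mem_interior_iff_mem_nhds.2 hU
    · refine ⟨LinearEquiv.ofLinear (Matrix.toLin' Q) (Matrix.toLin' P) ?_ ?_, ?_⟩
      · rw [← Matrix.toLin'_mul, hQP, Matrix.toLin'_one]
      · rw [← Matrix.toLin'_mul, hPQ, Matrix.toLin'_one]
      · intro γ x y
        have e : ∀ x, (P * linHom Γ γ * Q).mulVec x =
            P.mulVec ((γ : (Fin 3 → ℝ) ≃ᵃ[ℝ] (Fin 3 → ℝ)).linear (Q.mulVec x)) := by
          intro x
          rw [← linHom_mulVec, mulVec_mulVec, mulVec_mulVec]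
        have h1 := hlf γ x y
        rw [e, e] at h1
        exact h1
  · left
    unfold NVS at hn
    push Not at hn
    obtain ⟨H, hH, hs⟩ := hn
    exact ⟨H, hH, hs, (h.restrict H).noeth⟩
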